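/- Suppose k = C and W~ is the complexification of a finite real reflection group, i.e. V~ = V~' ⊗_R C for a real vector space V~' and W~ is generated by reflections stabilizing V~'. Assume G is a good normal subgroup of W~. Let M~ be the complement in V~ of the union of the reflecting hyperplanes of W~ and M the complement in V of the union of the reflecting hyperplanes of W (for the classical topology). Then p(M~) ⊆ M, and for any basepoint x0 in M~ the continuous map M~/W~ -> M/W induced by p induces a surjective homomorphism of fundamental groups π_1(M~/W~, [x0]) -> π_1(M/W, [p(x0)]). -/

import Mathlib

open MvPolynomial

noncomputable section

namespace ReflQuot

variable {k : Type} [Field k]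

/-- The action of an invertible matrix `g` on polynomial functions on `k^n`:
the linear form `X i` is sent to `∑ j, (g⁻¹) i j • X j`, so that
`(g • f) (v) = f (g⁻¹ ⬝ v)`. -/
def matAct {n : ℕ} (g : Matrix.GeneralLinearGroup (Fin n) k) :
    MvPolynomial (Fin n) k →ₐ[k] MvPolynomial (Fin n) k :=
  aeval fun i => ∑ j, ((↑(g⁻¹) : Matrix (Fin n) (Fin n) k) i j) • X j

/-- The algebra endomorphism of `k[X_1,…,X_m]` sending `X i` to `∑ j, M i j • X j`. -/
def polyAct {m : ℕ} (M : Fin m → Fin m → k) :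
    MvPolynomial (Fin m) k →ₐ[k] MvPolynomial (Fin m) k :=
  aeval fun i => ∑ j, M i j • X j

/-- A reflection: an automorphism of finite order whose fixed-point subspace is a
hyperplane. -/
def IsReflection {n : ℕ} (M : Matrix (Fin n) (Fin n) k) : Prop :=
  IsOfFinOrder M ∧
    Module.finrank k (LinearMap.ker (Matrix.toLin' M - LinearMap.id)) + 1 = n

/-- A double reflection: finite order, fixed points of codimension 2. -/
def IsDoubleReflection {n : ℕ} (M : Matrix (Fin n) (Fin n) k) : Prop :=
  IsOfFinOrder M ∧
    Module.finrank k (LinearMap.ker (Matrix.toLin' M - LinearMap.id)) + 2 = n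

/-- A reflection group: a group generated by its reflections. -/
def IsReflectionGroup {n : ℕ} (W : Subgroup (Matrix.GeneralLinearGroup (Fin n) k)) : Prop :=
  Subgroup.closure {g | g ∈ W ∧ IsReflection ((g : Matrix (Fin n) (Fin n) k))} = W

/-- The algebra of `G`-invariant polynomials. -/
def invariants {n : ℕ} (G : Subgroup (Matrix.GeneralLinearGroup (Fin n) k)) :
    Subalgebra k (MvPolynomial (Fin n) k) where
  carrier := {f | ∀ g ∈ G, matAct g f = f}
  mul_mem' := fun {a b} ha hb g hg => by
    rw [map_mul, ha g hg, hb g hg]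
  one_mem' := fun g _ => map_one (matAct g)
  add_mem' := fun {a b} ha hb g hg => by
    rw [map_add, ha g hg, hb g hg]
  zero_mem' := fun g _ => map_zero (matAct g)
  algebraMap_mem' := fun r g _ => (matAct g).commutes r

/-- The linear span of products of two positive-degree invariants, i.e. `(B^G_+)^2`. -/
def sqSpan {n : ℕ} (G : Subgroup (Matrix.GeneralLinearGroup (Fin n) k)) :
    Submodule k (MvPolynomial (Fin n) k) :=
  Submodule.span k {f | ∃ u ∈ invariants G, ∃ v ∈ invariants G,
    constantCoeff u = 0 ∧ constantCoeff v = 0 ∧ f = u * v}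

/-- The ideal of positive-degree elements of the polynomial ring. -/
def idealPlus (k : Type) [Field k] (m : ℕ) : Ideal (MvPolynomial (Fin m) k) :=
  Ideal.span (Set.range X)

/-- The ideal `I` of relations between the generators `p i` of the invariant algebra:
the kernel of `k[V] = k[X_1,…,X_m] → B^G`, `X i ↦ p i`. -/
def relIdeal {n m : ℕ} (p : Fin m → MvPolynomial (Fin n) k) :
    Ideal (MvPolynomial (Fin m) k) :=
  RingHom.ker (aeval p : MvPolynomial (Fin m) k →ₐ[k] MvPolynomial (Fin n) k)

/-- The context: `Wt` is a finite reflection group on `k^n`, `G` a normal subgroup of `Wt`,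
`p` a minimal system of homogeneous generators (of degrees `d`) of the invariant algebra
`B^G` whose span is `Wt`-stable (i.e. a graded `W`-equivariant section of
`B^G_+ → B^G_+/(B^G_+)^2`), and `c w` the matrix of the action of `w` on the span of the
`p i`, giving the induced action of `W = Wt/G` on `V = k^m`. -/
structure QuotSetup {n m : ℕ} (Wt G : Subgroup (Matrix.GeneralLinearGroup (Fin n) k))
    (p : Fin m → MvPolynomial (Fin n) k) (d : Fin m → ℕ)
    (c : ↥Wt → Fin m → Fin m → k) : Prop where
  finite : (Wt : Set (Matrix.GeneralLinearGroup (Fin n) k)).Finite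
  reflGroup : IsReflectionGroup Wt
  le : G ≤ Wt
  normal : ∀ w ∈ Wt, ∀ g ∈ G, w * g * w⁻¹ ∈ G
  homog : ∀ i, (p i).IsHomogeneous (d i)
  dpos : ∀ i, 0 < d i
  gen : Algebra.adjoin k (Set.range p) = invariants G
  minimal : ∀ a : Fin m → k, (∑ i, a i • p i) ∈ sqSpan G → a = 0
  equivar : ∀ (w : ↥Wt) (i), matAct (w : Matrix.GeneralLinearGroup (Fin n) k) (p i)
      = ∑ j, c w i j • p j

/-- `W = Wt/G` acts trivially on the conormal module `I/(A_+ I)`. -/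
def TrivialConormal {n m : ℕ} (Wt : Subgroup (Matrix.GeneralLinearGroup (Fin n) k))
    (p : Fin m → MvPolynomial (Fin n) k) (c : ↥Wt → Fin m → Fin m → k) : Prop :=
  ∀ w : ↥Wt, ∀ f ∈ relIdeal p, polyAct (c w) f - f ∈ idealPlus k m * relIdeal p

/-- `G` is of complete intersection: `I` is generated by `dim V - dim Vt = m - n` elements. -/
def IsCompleteIntersection {n m : ℕ} (p : Fin m → MvPolynomial (Fin n) k) : Prop :=
  ∃ s : Finset (MvPolynomial (Fin m) k), s.card = m - n ∧ Ideal.span (s : Set _) = relIdeal p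

/-- `G` is a good normal subgroup of `Wt`. -/
def IsGoodQuot {n m : ℕ} (Wt : Subgroup (Matrix.GeneralLinearGroup (Fin n) k))
    (p : Fin m → MvPolynomial (Fin n) k) (c : ↥Wt → Fin m → Fin m → k) : Prop :=
  IsCompleteIntersection p ∧ TrivialConormal Wt p c


/-- The pointwise stabilizer of a subspace `L` in `GL_n(k)`. -/
def pointStab {n : ℕ} (L : Submodule k (Fin n → k)) :
    Subgroup (Matrix.GeneralLinearGroup (Fin n) k) where
  carrier := {g | ∀ x ∈ L, Matrix.mulVec (g : Matrix (Fin n) (Fin n) k) x = x}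
  one_mem' := fun x _ => Matrix.one_mulVec x
  mul_mem' := fun {a b} ha hb x hx => by
    rw [Units.val_mul, ← Matrix.mulVec_mulVec, hb x hx, ha x hx]
  inv_mem' := fun {a} ha x hx => by
    have h1 : Matrix.mulVec (↑(a⁻¹) : Matrix (Fin n) (Fin n) k)
        (Matrix.mulVec (↑a : Matrix (Fin n) (Fin n) k) x) = x := by
      rw [Matrix.mulVec_mulVec, ← Units.val_mul, inv_mul_cancel, Units.val_one,
        Matrix.one_mulVec]
    rw [ha x hx] at h1
    exact h1

/-- The set of reflecting hyperplanes of a subgroup `W` of `GL_n(k)`. -/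
def reflHyps {n : ℕ} (W : Subgroup (Matrix.GeneralLinearGroup (Fin n) k)) :
    Set (Submodule k (Fin n → k)) :=
  {H | ∃ g ∈ W, IsReflection ((g : Matrix (Fin n) (Fin n) k)) ∧
      H = LinearMap.ker (Matrix.toLin' ((g : Matrix (Fin n) (Fin n) k)) - LinearMap.id)}

/-- The set `A'(Wt)` of reflecting hyperplanes `H` of `Wt` such that `Wt_H ≠ G_H`. -/
def reflHyps' {n : ℕ} (Wt G : Subgroup (Matrix.GeneralLinearGroup (Fin n) k)) :
    Set (Submodule k (Fin n → k)) :=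
  {H | H ∈ reflHyps Wt ∧ ¬ (Wt ⊓ pointStab H ≤ G)}

/-- `Wt_H` and `Wt_{H'}` have the same image in `W = Wt/G`. -/
def imageEq {n : ℕ} (Wt G : Subgroup (Matrix.GeneralLinearGroup (Fin n) k))
    (H H' : Submodule k (Fin n → k)) : Prop :=
  {x | ∃ g ∈ G, ∃ u ∈ Wt ⊓ pointStab H, x = g * u}
    = {x | ∃ g ∈ G, ∃ u ∈ Wt ⊓ pointStab H', x = g * u}

/-- `e_H = |G_H|`. -/
def eH {n : ℕ} (G : Subgroup (Matrix.GeneralLinearGroup (Fin n) k))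
    (H : Submodule k (Fin n → k)) : ℕ :=
  Nat.card ↥(G ⊓ pointStab H)

/-- The map `p : Vt → V`, `x ↦ (p 1 (x), …, p m (x))`. -/
def pMap {n m : ℕ} (p : Fin m → MvPolynomial (Fin n) k) (x : Fin n → k) : Fin m → k :=
  fun i => eval x (p i)

/-- The matrix of the action of (the image in `W` of) `w` on `V = k^m`. -/
def qMat {n m : ℕ} {Wt : Subgroup (Matrix.GeneralLinearGroup (Fin n) k)}
    (c : ↥Wt → Fin m → Fin m → k) (w : ↥Wt) : Matrix (Fin m) (Fin m) k :=
  Matrix.of (c w⁻¹)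

/-- The set of reflecting hyperplanes of `W = Wt/G` acting on `V = k^m`. -/
def reflHypsV {n m : ℕ} {Wt : Subgroup (Matrix.GeneralLinearGroup (Fin n) k)}
    (c : ↥Wt → Fin m → Fin m → k) : Set (Submodule k (Fin m → k)) :=
  {K | ∃ w : ↥Wt, IsReflection (qMat c w) ∧
      K = LinearMap.ker (Matrix.toLin' (qMat c w) - LinearMap.id)}

/-- The underlying matrix of an element of a subgroup of `GL_n(k)`. -/
def matOf {n : ℕ} {Wt : Subgroup (Matrix.GeneralLinearGroup (Fin n) k)} (w : ↥Wt) :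
    Matrix (Fin n) (Fin n) k :=
  ((w : Matrix.GeneralLinearGroup (Fin n) k) : Matrix (Fin n) (Fin n) k)

/-- The complement in `Vt = ℂ^n` of the union of the reflecting hyperplanes of `Wt`. -/
def bigMt {n : ℕ} (Wt : Subgroup (Matrix.GeneralLinearGroup (Fin n) ℂ)) :
    Set (Fin n → ℂ) :=
  {x | ∀ H ∈ reflHyps Wt, x ∉ H}

/-- The complement in `V = ℂ^m` of the union of the reflecting hyperplanes of
`W = Wt/G`. -/
def bigMV {n m : ℕ} {Wt : Subgroup (Matrix.GeneralLinearGroup (Fin n) ℂ)}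
    (c : ↥Wt → Fin m → Fin m → ℂ) : Set (Fin m → ℂ) :=
  {v | ∀ K ∈ reflHypsV c, v ∉ K}

/-- The relation on `Mt` whose quotient is the orbit space `Mt/Wt`. -/
def rt {n : ℕ} (Wt : Subgroup (Matrix.GeneralLinearGroup (Fin n) ℂ)) :
    ↥(bigMt Wt) → ↥(bigMt Wt) → Prop :=
  fun x y => ∃ w ∈ Wt,
    Matrix.mulVec ((w : Matrix.GeneralLinearGroup (Fin n) ℂ) :
      Matrix (Fin n) (Fin n) ℂ) x.1 = y.1

/-- The relation on `M` whose quotient is the orbit space `M/W`. -/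
def rV {n m : ℕ} {Wt : Subgroup (Matrix.GeneralLinearGroup (Fin n) ℂ)}
    (c : ↥Wt → Fin m → Fin m → ℂ) : ↥(bigMV c) → ↥(bigMV c) → Prop :=
  fun a b => ∃ w : ↥Wt, Matrix.mulVec (qMat c w) a.1 = b.1

section

open Filter Topology in
theorem eventually_add_mul_pos {a : ℝ} (ha : 0 < a) (b : ℝ) :
    ∀ᶠ ε in 𝓝[>] (0 : ℝ), 0 < a + ε * b := by
  have h : Tendsto (fun ε : ℝ => a + ε * b) (𝓝 0) (𝓝 (a + 0 * b)) :=
    Continuous.tendsto (by fun_prop) 0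
  exact (h.mono_left nhdsWithin_le_nhds).eventually (lt_mem_nhds (by simpa using ha))

open Filter Topology in
theorem eventually_add_mul_ne {b : ℝ} (a : ℝ) (hb : b ≠ 0) :
    ∀ᶠ ε in 𝓝[>] (0 : ℝ), a + ε * b ≠ 0 := by
  rcases eq_or_ne a 0 with rfl | ha
  · filter_upwards [self_mem_nhdsWithin] with ε hε
    simpa using ⟨(ne_of_gt hε : ε ≠ 0), hb⟩
  · have h : Tendsto (fun ε : ℝ => a + ε * b) (𝓝 0) (𝓝 (a + 0 * b)) :=
      Continuous.tendsto (by fun_prop) 0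
    exact (h.mono_left nhdsWithin_le_nhds).eventually_ne (by simpa using ha)

section RealReflectionGroups

variable {E : Type*} [AddCommGroup E] [Module ℝ E]

/-- A real reflection: `v ↦ v - f v • x` with `f x = 2`. -/
def IsRealRefl (r : E ≃ₗ[ℝ] E) : Prop :=
  ∃ (f : Module.Dual ℝ E) (x : E), f x = 2 ∧ ∀ v, r v = v - f v • x

theorem IsRealRefl.conj {r : E ≃ₗ[ℝ] E} (hr : IsRealRefl r) (w : E ≃ₗ[ℝ] E) :
    IsRealRefl (w * r * w⁻¹) := by
  obtain ⟨f, x, hfx, hr⟩ := hr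
  refine ⟨f ∘ₗ (w⁻¹ : E ≃ₗ[ℝ] E).toLinearMap, w x, ?_, fun v => ?_⟩
  · change f (w⁻¹ (w x)) = 2
    rw [← LinearEquiv.mul_apply, inv_mul_cancel]; exact hfx
  · change w (r (w⁻¹ v)) = v - f (w⁻¹ v) • w x
    rw [hr, map_sub, map_smul, ← LinearEquiv.mul_apply w, mul_inv_cancel]
    rfl

theorem IsRealRefl.mul_self {r : E ≃ₗ[ℝ] E} (hr : IsRealRefl r) : r * r = 1 := by
  obtain ⟨f, x, hfx, hr⟩ := hr
  ext v
  change r (r v) = v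
  rw [hr (r v), hr v, map_sub, map_smul, hfx, smul_eq_mul, sub_sub, ← add_smul,
    show f v + (f v - f v * 2) = 0 by ring, zero_smul, sub_zero]

/-- The reflections in a group of linear automorphisms. -/
def reflSet (W : Subgroup (E ≃ₗ[ℝ] E)) : Set (E ≃ₗ[ℝ] E) := {r | r ∈ W ∧ IsRealRefl r}

theorem reflSet_conj {W : Subgroup (E ≃ₗ[ℝ] E)} {r w : E ≃ₗ[ℝ] E} (hr : r ∈ reflSet W)
    (hw : w ∈ W) : w * r * w⁻¹ ∈ reflSet W :=
  ⟨W.mul_mem (W.mul_mem hw hr.1) (W.inv_mem hw), hr.2.conj w⟩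

theorem reflSet_conj' {W : Subgroup (E ≃ₗ[ℝ] E)} {r w : E ≃ₗ[ℝ] E} (hr : r ∈ reflSet W)
    (hw : w ∈ W) : w⁻¹ * r * w ∈ reflSet W := by
  simpa using reflSet_conj hr (W.inv_mem hw)

/-- In a finite group, a reflection is determined by its hyperplane. -/
theorem reflection_eq_of_form_eq {W : Subgroup (E ≃ₗ[ℝ] E)} [Finite W] {r r' : E ≃ₗ[ℝ] E}
    (hr : r ∈ W) (hr' : r' ∈ W) {f : Module.Dual ℝ E} {x x' : E} (hx : f x = 2) (hx' : f x' = 2)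
    (h : ∀ v, r v = v - f v • x) (h' : ∀ v, r' v = v - f v • x') : r = r' := by
  have hcomp : ∀ v, (r * r') v = v + f v • (x - x') := fun v => by
    change r (r' v) = _
    rw [h, h', map_sub, map_smul, hx', smul_eq_mul, smul_sub,
      show f v - f v * 2 = -f v by ring, neg_smul]
    abel
  have hpow : ∀ (N : ℕ) v, ((r * r') ^ N) v = v + (N : ℝ) • f v • (x - x') := by
    intro N
    induction N with
    | zero => intro v; simp
    | succ N ih =>
      intro v
      rw [pow_succ]
      change ((r * r') ^ N) ((r * r') v) = _
      rw [hcomp, ih, map_add, map_smul, map_sub, hx, hx']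
      simp only [sub_self, smul_zero, add_zero]
      push_cast
      rw [add_smul, one_smul]
      abel
  have hfin : IsOfFinOrder (⟨r * r', W.mul_mem hr hr'⟩ : W) := isOfFinOrder_of_finite _
  obtain ⟨N, hN, hN1⟩ := isOfFinOrder_iff_pow_eq_one.1 hfin
  have h1 : (r * r') ^ N = 1 := by simpa using congrArg Subtype.val hN1
  have h2 := hpow N x
  rw [h1, hx] at h2
  have h3 : (N : ℝ) • (2 : ℝ) • (x - x') = 0 := by
    have : (1 : E ≃ₗ[ℝ] E) x = x := rfl
    rw [this] at h2
    simpa using h2.symm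
  have hxx : x = x' := by
    rcases smul_eq_zero.1 h3 with h4 | h4
    · exact absurd h4 (by positivity)
    · exact sub_eq_zero.1 ((smul_eq_zero.1 h4).resolve_left two_ne_zero)
  ext v
  rw [h, h', hxx]

/-- A base point of a finite real group off its reflecting hyperplanes, with defining
equations of all these hyperplanes, normalised to be positive at the base point. -/
structure Chamber (W : Subgroup (E ≃ₗ[ℝ] E)) where
  base : E
  form : (E ≃ₗ[ℝ] E) → Module.Dual ℝ E
  root : (E ≃ₗ[ℝ] E) → E
  form_root : ∀ r ∈ reflSet W, form r (root r) = 2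
  refl_apply : ∀ r ∈ reflSet W, ∀ v, r v = v - form r v • root r
  base_pos : ∀ r ∈ reflSet W, 0 < form r base

theorem exists_chamber (W : Subgroup (E ≃ₗ[ℝ] E)) (b : E)
    (hb : ∀ r ∈ reflSet W, r b ≠ b) : ∃ K : Chamber W, K.base = b := by
  have : ∀ r, ∃ (f : Module.Dual ℝ E) (x : E), r ∈ reflSet W →
      f x = 2 ∧ (∀ v, r v = v - f v • x) ∧ 0 < f b := by
    intro r
    by_cases hr : r ∈ reflSet W
    · obtain ⟨f, x, hfx, h⟩ := hr.2
      have hfb : f b ≠ 0 := fun h0 => hb r hr (by rw [h, h0, zero_smul, sub_zero])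
      rcases lt_or_gt_of_ne hfb with hlt | hgt
      · refine ⟨-f, -x, fun _ => ⟨by simpa using hfx, fun v => ?_, by simpa using hlt⟩⟩
        simpa using h v
      · exact ⟨f, x, fun _ => ⟨hfx, h, hgt⟩⟩
    · exact ⟨0, 0, fun h => absurd h hr⟩
  choose f x hfx using this
  exact ⟨⟨b, f, x, fun r hr => (hfx r hr).1, fun r hr => (hfx r hr).2.1,
    fun r hr => (hfx r hr).2.2⟩, rfl⟩

theorem exists_moved_by_all (W : Subgroup (E ≃ₗ[ℝ] E)) [Finite W] :
    ∃ b : E, ∀ r ∈ reflSet W, r b ≠ b := by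
  have hR : (reflSet W).Finite := (Set.toFinite (W : Set (E ≃ₗ[ℝ] E))).subset fun r hr => hr.1
  have : Finite (reflSet W) := hR
  choose f x hfx h using fun r : reflSet W => r.2.2
  obtain ⟨b, hb⟩ := Module.Dual.exists_forall_ne_zero_of_forall_exists f
    fun r => ⟨x r, by rw [hfx r]; norm_num⟩
  refine ⟨b, fun r hr hrb => hb ⟨r, hr⟩ ?_⟩
  have h1 := h ⟨r, hr⟩ b
  simp only [hrb] at h1
  have h2 : f ⟨r, hr⟩ b • x ⟨r, hr⟩ = 0 := by simpa using h1.symm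
  rcases smul_eq_zero.1 h2 with h3 | h3
  · exact h3
  · have := hfx ⟨r, hr⟩
    rw [h3, map_zero] at this
    norm_num at this

namespace Chamber

variable {W : Subgroup (E ≃ₗ[ℝ] E)} (K : Chamber W)

/-- The open chamber of the base point. -/
def opn : Set E := {v | ∀ r ∈ reflSet W, 0 < K.form r v}

/-- The relatively open facet of the chamber on the hyperplane of `t`. -/
def face (t : E ≃ₗ[ℝ] E) : Set E :=
  {z | K.form t z = 0 ∧ ∀ r ∈ reflSet W, r ≠ t → 0 < K.form r z}

/-- The reflection `t` is a reflection in a wall of the chamber. -/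
def IsSimple (t : E ≃ₗ[ℝ] E) : Prop := t ∈ reflSet W ∧ (K.face t).Nonempty

variable {K}

theorem form_refl {r : E ≃ₗ[ℝ] E} (hr : r ∈ reflSet W) (v : E) :
    K.form r (r v) = - K.form r v := by
  rw [K.refl_apply r hr v, map_sub, map_smul, K.form_root r hr, smul_eq_mul]; ring

theorem refl_eq_iff {r : E ≃ₗ[ℝ] E} (hr : r ∈ reflSet W) (v : E) :
    r v = v ↔ K.form r v = 0 := by
  constructor
  · intro h
    have := form_refl (K := K) hr v
    rw [h] at this
    linarith
  · intro h
    rw [K.refl_apply r hr v, h, zero_smul, sub_zero]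

theorem form_conj {r w : E ≃ₗ[ℝ] E} (hr : r ∈ reflSet W) (hw : w ∈ W) :
    ∃ c : ℝ, c ≠ 0 ∧ ∀ v, K.form (w * r * w⁻¹) (w v) = c * K.form r v := by
  have hr' := reflSet_conj hr hw
  have key : ∀ v, K.form (w * r * w⁻¹) (w v) • K.root (w * r * w⁻¹)
      = K.form r v • w (K.root r) := by
    intro v
    have h1 := K.refl_apply _ hr' (w v)
    have h2 : (w * r * w⁻¹) (w v) = w (r v) := by
      change w (r (w⁻¹ (w v))) = _
      rw [← LinearEquiv.mul_apply w⁻¹, inv_mul_cancel]; rfl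
    rw [h2, K.refl_apply r hr v, map_sub, map_smul] at h1
    exact (sub_right_inj.1 h1).symm
  have key2 : ∀ v, K.form (w * r * w⁻¹) (w v)
      = (K.form (w * r * w⁻¹) (w (K.root r)) / 2) * K.form r v := by
    intro v
    have := congrArg (K.form (w * r * w⁻¹)) (key v)
    rw [map_smul, map_smul, K.form_root _ hr', smul_eq_mul, smul_eq_mul] at this
    linarith
  refine ⟨_, fun h0 => ?_, key2⟩
  have h3 := key2 (w⁻¹ (K.root (w * r * w⁻¹)))
  rw [h0, zero_mul, ← LinearEquiv.mul_apply w, mul_inv_cancel] at h3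
  have h4 := K.form_root _ hr'
  rw [show (1 : E ≃ₗ[ℝ] E) (K.root (w * r * w⁻¹)) = K.root (w * r * w⁻¹) from rfl] at h3
  linarith

theorem form_apply_ne {r w : E ≃ₗ[ℝ] E} (hr : r ∈ reflSet W) (hw : w ∈ W) {v : E}
    (hv : ∀ r ∈ reflSet W, K.form r v ≠ 0) : K.form r (w v) ≠ 0 := by
  obtain ⟨c, hc, h⟩ := form_conj (K := K) (reflSet_conj' hr hw) hw
  have e : w * (w⁻¹ * r * w) * w⁻¹ = r := by group
  rw [e] at h
  rw [h]
  exact mul_ne_zero hc (hv _ (reflSet_conj' hr hw))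

theorem eq_of_form_eq [Finite W] {r r' : E ≃ₗ[ℝ] E} (hr : r ∈ reflSet W) (hr' : r' ∈ reflSet W)
    {c : ℝ} (h : K.form r' = c • K.form r) : r = r' := by
  refine reflection_eq_of_form_eq hr.1 hr'.1 (f := K.form r) (x := K.root r)
    (x' := c • K.root r') (K.form_root r hr) ?_ (K.refl_apply r hr) ?_
  · have := K.form_root r' hr'
    rw [h] at this
    simpa using this
  · intro v
    rw [K.refl_apply r' hr' v, h, smul_smul]
    simp [mul_comm]

/-- For distinct reflections, the hyperplanes are distinct. -/
theorem exists_form_ne [Finite W] {r r' : E ≃ₗ[ℝ] E} (hr : r ∈ reflSet W) (hr' : r' ∈ reflSet W)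
    (hne : r ≠ r') : ∃ v, K.form r v = 0 ∧ K.form r' v ≠ 0 := by
  by_contra! hcon
  apply hne
  refine eq_of_form_eq (K := K) hr hr' (c := K.form r' (K.root r) / 2) (LinearMap.ext fun v => ?_)
  have h1 := hcon (v - (K.form r v / 2) • K.root r) (by
    rw [map_sub, map_smul, K.form_root r hr, smul_eq_mul]; ring)
  rw [map_sub, map_smul, smul_eq_mul] at h1
  rw [LinearMap.smul_apply, smul_eq_mul]
  linarith

/-- A simple reflection preserves the positivity of all other forms. -/
theorem IsSimple.form_pos {t r : E ≃ₗ[ℝ] E} (ht : K.IsSimple t) (hr : r ∈ reflSet W)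
    (hrt : r ≠ t) {v : E} (hv : ∀ r ∈ reflSet W, r ≠ t → 0 < K.form r v) :
    0 < K.form r (t v) := by
  obtain ⟨htR, z, hz0, hz⟩ := ht
  obtain ⟨c, hc, h⟩ := form_conj (K := K) (reflSet_conj' hr htR.1) htR.1
  have e : t * (t⁻¹ * r * t) * t⁻¹ = r := by group
  rw [e] at h
  have hne : t⁻¹ * r * t ≠ t := fun h' => hrt (by
    have : r = t * (t⁻¹ * r * t) * t⁻¹ := e.symm
    rw [h'] at this; simpa using this)
  have hR := reflSet_conj' hr htR.1
  have h1 := h z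
  rw [(refl_eq_iff htR z).2 hz0] at h1
  have h2 := hz r hr hrt
  have h3 := hz _ hR hne
  have hcpos : 0 < c := by
    by_contra! hneg
    nlinarith
  rw [h]
  exact mul_pos hcpos (hv _ hR hne)

/-- Exchange condition. -/
theorem exchange {T : Set (E ≃ₗ[ℝ] E)} (hT : ∀ t ∈ T, K.IsSimple t) {v : E} (hv : v ∈ K.opn)
    {t : E ≃ₗ[ℝ] E} (ht : t ∈ T) (l : List (E ≃ₗ[ℝ] E)) (hl : ∀ s ∈ l, s ∈ T)
    (hneg : K.form t (l.prod v) < 0) :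
    ∃ l' : List (E ≃ₗ[ℝ] E), (∀ s ∈ l', s ∈ T) ∧ l'.length < l.length ∧ t * l.prod = l'.prod := by
  induction l using List.reverseRecOn with
  | nil => exact absurd (hv t (hT t ht).1) (not_lt.2 (by simpa using hneg.le))
  | append_singleton l s ih =>
    have hlT : ∀ s ∈ l, s ∈ T := fun s hs => hl s (by simp [hs])
    have hs : s ∈ T := hl s (by simp)
    have hprodW : l.prod ∈ W := Subgroup.list_prod_mem _ fun s hs => (hT s (hlT s hs)).1.1
    have hvne : ∀ r ∈ reflSet W, K.form r v ≠ 0 := fun r hr => (hv r hr).ne'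
    rcases lt_or_gt_of_ne (form_apply_ne (hT t ht).1 hprodW hvne) with h | h
    · obtain ⟨l', h1, h2, h3⟩ := ih hlT h
      refine ⟨l' ++ [s], ?_, by simpa using h2, by
        rw [List.prod_append, List.prod_append, ← h3, mul_assoc]⟩
      intro u hu
      rcases List.mem_append.1 hu with hu | hu
      · exact h1 u hu
      · rw [List.mem_singleton.1 hu]; exact hs
    · refine ⟨l, hlT, by simp, ?_⟩
      obtain ⟨c, hc, hform⟩ := form_conj (K := K) (reflSet_conj' (hT t ht).1 hprodW) hprodW
      have e : l.prod * (l.prod⁻¹ * t * l.prod) * l.prod⁻¹ = t := by group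
      rw [e] at hform
      have hR := reflSet_conj' (hT t ht).1 hprodW
      have hc0 : 0 < c := by
        have h1 := hv _ hR
        rw [hform v] at h
        exact pos_of_mul_pos_left h h1.le
      rw [List.prod_append, List.prod_singleton, LinearEquiv.mul_apply, hform] at hneg
      have hst : l.prod⁻¹ * t * l.prod = s := by
        by_contra hne
        have := (hT s hs).form_pos hR hne (v := v) fun r hr _ => hv r hr
        nlinarith
      have : t * l.prod = l.prod * s := by rw [← hst]; group
      rw [List.prod_append, List.prod_singleton, ← mul_assoc, this, mul_assoc,
        (hT s hs).1.2.mul_self, mul_one]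

/-- If simple reflections in `T` generate the group, a nontrivial element sends the chamber
across a wall of some element of `T`. -/
theorem exists_form_neg {T : Set (E ≃ₗ[ℝ] E)} (hT : ∀ t ∈ T, K.IsSimple t)
    (hgen : Subgroup.closure T = W) {v : E} (hv : v ∈ K.opn) {w : E ≃ₗ[ℝ] E} (hw : w ∈ W)
    (hw1 : w ≠ 1) : ∃ t ∈ T, K.form t (w v) < 0 := by
  have hTinv : ∀ t ∈ T, t⁻¹ = t := fun t ht => inv_eq_of_mul_eq_one_left (hT t ht).1.2.mul_self
  have hlist : ∃ l : List (E ≃ₗ[ℝ] E), (∀ s ∈ l, s ∈ T) ∧ l.prod = w := by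
    rw [← hgen] at hw
    rw [← Subgroup.mem_toSubmonoid, Subgroup.closure_toSubmonoid] at hw
    obtain ⟨l, hl, hp⟩ := Submonoid.exists_list_of_mem_closure hw
    refine ⟨l, fun s hs => ?_, hp⟩
    rcases hl s hs with h | h
    · exact h
    · have := hTinv _ h
      rw [inv_inv] at this
      rw [this]; exact h
  obtain ⟨l, hl, hp⟩ := hlist
  induction hN : l.length using Nat.strong_induction_on generalizing l with
  | _ N ih =>
    cases l with
    | nil => exact absurd hp.symm (by simpa using hw1)
    | cons t l =>
      have ht : t ∈ T := hl t (by simp)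
      have hlT : ∀ s ∈ l, s ∈ T := fun s hs => hl s (by simp [hs])
      have hvne : ∀ r ∈ reflSet W, K.form r v ≠ 0 := fun r hr => (hv r hr).ne'
      rcases lt_or_gt_of_ne (form_apply_ne (hT t ht).1 hw hvne) with h | h
      · exact ⟨t, ht, h⟩
      · have h2 : K.form t (l.prod v) < 0 := by
          rw [← hp, List.prod_cons, LinearEquiv.mul_apply, form_refl (hT t ht).1] at h
          linarith
        obtain ⟨l', h3, h4, h5⟩ := exchange hT hv ht l hlT h2
        exact ih l'.length (by rw [← hN, List.length_cons]; omega) l' h3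
          (by rw [← h5, ← hp, List.prod_cons]) rfl

theorem eq_one_of_mem_opn {T : Set (E ≃ₗ[ℝ] E)} (hT : ∀ t ∈ T, K.IsSimple t)
    (hgen : Subgroup.closure T = W) {v : E} (hv : v ∈ K.opn) {w : E ≃ₗ[ℝ] E} (hw : w ∈ W)
    (hwv : w v ∈ K.opn) : w = 1 := by
  by_contra h
  obtain ⟨t, ht, hlt⟩ := exists_form_neg hT hgen hv hw h
  exact absurd (hwv t (hT t ht).1) (not_lt.2 hlt.le)

theorem base_mem_opn : K.base ∈ K.opn := K.base_pos

/-- A generating set of simple reflections contains all simple reflections. -/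
theorem IsSimple.mem_of_generating {T : Set (E ≃ₗ[ℝ] E)} (hT : ∀ t ∈ T, K.IsSimple t)
    (hgen : Subgroup.closure T = W) {s : E ≃ₗ[ℝ] E} (hs : K.IsSimple s) : s ∈ T := by
  have hs1 : s ≠ 1 := fun h => by
    have := form_refl (K := K) hs.1 K.base
    rw [h] at this
    have hb := K.base_pos s hs.1
    rw [h, show (1 : E ≃ₗ[ℝ] E) K.base = K.base from rfl] at *
    linarith
  obtain ⟨t, ht, hlt⟩ := exists_form_neg hT hgen base_mem_opn hs.1.1 hs1
  by_contra hmem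
  exact absurd (hs.form_pos (hT t ht).1 (fun h => hmem (h ▸ ht)) fun r hr _ => K.base_pos r hr)
    (not_lt.2 hlt.le)

/-- The stabiliser of a point of a facet. -/
theorem eq_one_or_eq_of_mem_face [Finite W] {T : Set (E ≃ₗ[ℝ] E)} (hT : ∀ t ∈ T, K.IsSimple t)
    (hgen : Subgroup.closure T = W) {t : E ≃ₗ[ℝ] E} (ht : K.IsSimple t) {z : E}
    (hz : z ∈ K.face t) {w : E ≃ₗ[ℝ] E} (hw : w ∈ W) (hwz : w z = z) : w = 1 ∨ w = t := by
  have hR : Finite (reflSet W) :=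
    (Set.toFinite (W : Set (E ≃ₗ[ℝ] E))).subset fun r hr => hr.1
  have hev : ∀ᶠ ε in nhdsWithin (0 : ℝ) (Set.Ioi 0), ∀ r : reflSet W, r.1 ≠ t →
      0 < K.form r.1 z + ε * K.form r.1 (K.root t) ∧
      0 < K.form r.1 z + ε * K.form r.1 (w (K.root t)) := by
    rw [Filter.eventually_all]
    intro r
    by_cases hrt : r.1 = t
    · exact Filter.Eventually.of_forall fun _ h => absurd hrt h
    · filter_upwards [eventually_add_mul_pos (hz.2 r.1 r.2 hrt) (K.form r.1 (K.root t)),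
        eventually_add_mul_pos (hz.2 r.1 r.2 hrt) (K.form r.1 (w (K.root t)))] with ε h1 h2 _
      exact ⟨h1, h2⟩
  obtain ⟨ε, hε, hpos⟩ := (hev.and self_mem_nhdsWithin).exists
  set v := z + ε • K.root t with hv
  have hvC : v ∈ K.opn := by
    intro r hr
    by_cases hrt : r = t
    · subst hrt
      rw [hv, map_add, map_smul, hz.1, K.form_root r hr, smul_eq_mul]
      have : 0 < ε := hpos
      linarith
    · rw [hv, map_add, map_smul, smul_eq_mul]
      exact (hε ⟨r, hr⟩ hrt).1
  have hwv : ∀ r ∈ reflSet W, r ≠ t → 0 < K.form r (w v) := by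
    intro r hr hrt
    rw [hv, map_add, map_smul, hwz, map_add, map_smul, smul_eq_mul]
    exact (hε ⟨r, hr⟩ hrt).2
  have hne := form_apply_ne ht.1 hw fun r hr => (hvC r hr).ne'
  rcases lt_or_gt_of_ne hne with h | h
  · right
    have h1 : t * w = 1 := by
      refine eq_one_of_mem_opn hT hgen hvC (W.mul_mem ht.1.1 hw) fun r hr => ?_
      by_cases hrt : r = t
      · subst hrt
        rw [LinearEquiv.mul_apply, form_refl hr]; linarith
      · exact ht.form_pos hr hrt hwv
    have h2 := ht.1.2.mul_self
    exact mul_left_cancel (h1.trans h2.symm)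
  · left
    refine eq_one_of_mem_opn hT hgen hvC hw fun r hr => ?_
    by_cases hrt : r = t
    · subst hrt; exact h
    · exact hwv r hr hrt

end Chamber
end RealReflectionGroups

end

section

section RealReflectionGroups
variable {E : Type*} [AddCommGroup E] [Module ℝ E]

theorem finite_reflSet (W : Subgroup (E ≃ₗ[ℝ] E)) [Finite W] : Finite (reflSet W) :=
  (Set.toFinite (W : Set (E ≃ₗ[ℝ] E))).subset fun _ hr => hr.1

namespace Chamber
variable {W : Subgroup (E ≃ₗ[ℝ] E)} (K : Chamber W)

/-- The points off all reflecting hyperplanes. -/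
def reg : Set E := {v | ∀ r ∈ reflSet W, K.form r v ≠ 0}

/-- `y` is generic relative to `a` when the segment from `a` to `y` crosses the reflecting
hyperplanes at distinct times. -/
def Generic (a y : E) : Prop := ∀ r ∈ reflSet W, ∀ r' ∈ reflSet W, r ≠ r' →
  K.form r a * K.form r' y ≠ K.form r' a * K.form r y

variable {K}

theorem opn_subset_reg : K.opn ⊆ K.reg := fun _ hv r hr => (hv r hr).ne'

theorem reg_smul {w : E ≃ₗ[ℝ] E} (hw : w ∈ W) {v : E} (hv : v ∈ K.reg) : w v ∈ K.reg :=
  fun _ hr => form_apply_ne hr hw hv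

open Classical in
/-- A direction along which every point becomes regular and generic relative to `a`. -/
theorem exists_generic_direction [Finite W] {a : E} (ha : a ∈ K.reg) :
    ∃ e ∈ K.reg, K.Generic a e := by
  have := finite_reflSet W
  let F : reflSet W × Option (reflSet W) → Module.Dual ℝ E := fun q =>
    match q.2 with
    | none => K.form q.1
    | some r' => if q.1 = r' then K.form q.1 else
        K.form q.1.1 a • K.form r'.1 - K.form r'.1 a • K.form q.1.1
  have hF : ∀ q, ∃ v, F q v ≠ 0 := by
    have h0 : ∀ r : reflSet W, K.form r.1 K.base ≠ 0 := fun r => (K.base_pos r.1 r.2).ne'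
    rintro ⟨r, _ | r'⟩
    · exact ⟨K.base, h0 r⟩
    · by_cases h : r = r'
      · exact ⟨K.base, by simpa [F, h] using h0 r'⟩
      · obtain ⟨v, hv, hv'⟩ := exists_form_ne (K := K) r.2 r'.2 fun h' => h (Subtype.ext h')
        refine ⟨v, ?_⟩
        simp [F, h, hv, hv', ha r.1 r.2]
  obtain ⟨e, he⟩ := Module.Dual.exists_forall_ne_zero_of_forall_exists F hF
  refine ⟨e, fun r hr => he (⟨r, hr⟩, none), fun r hr r' hr' hne h => ?_⟩
  have hne' : (⟨r, hr⟩ : reflSet W) ≠ ⟨r', hr'⟩ := fun h' => hne (congrArg Subtype.val h')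
  have := he (⟨r, hr⟩, some ⟨r', hr'⟩)
  simp only [F, if_neg hne', LinearMap.sub_apply, LinearMap.smul_apply, smul_eq_mul] at this
  exact this (sub_eq_zero.2 h)

open Filter Topology in
theorem eventually_generic [Finite W] {a e : E} (he : e ∈ K.reg) (hae : K.Generic a e) (y : E) :
    ∀ᶠ ε in 𝓝[>] (0 : ℝ), y + ε • e ∈ K.reg ∧ K.Generic a (y + ε • e) := by
  have := finite_reflSet W
  have h1 : ∀ᶠ ε in 𝓝[>] (0 : ℝ), ∀ r : reflSet W, K.form r y + ε * K.form r e ≠ 0 :=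
    eventually_all.2 fun r => eventually_add_mul_ne _ (he r r.2)
  have h2 : ∀ᶠ ε in 𝓝[>] (0 : ℝ), ∀ r r' : reflSet W, r.1 ≠ r'.1 →
      (K.form r a * K.form r' y - K.form r' a * K.form r y)
        + ε * (K.form r a * K.form r' e - K.form r' a * K.form r e) ≠ 0 := by
    refine eventually_all.2 fun r => eventually_all.2 fun r' => ?_
    by_cases h : r.1 = r'.1
    · exact Eventually.of_forall fun _ h' => absurd h h'
    · filter_upwards [eventually_add_mul_ne (K.form r a * K.form r' y - K.form r' a * K.form r y)
        (sub_ne_zero.2 (hae r r.2 r' r'.2 h))] with ε hε _ using hε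
  filter_upwards [h1, h2] with ε h1 h2
  refine ⟨fun r hr => by simpa using h1 ⟨r, hr⟩, fun r hr r' hr' hne h => ?_⟩
  refine h2 ⟨r, hr⟩ ⟨r', hr'⟩ hne ?_
  simp only [map_add, map_smul, smul_eq_mul] at h
  linear_combination h

/-- The first hyperplane crossed by a generic segment. -/
theorem exists_first_crossing [Finite W] {a y : E} (ha : a ∈ K.reg)
    (hgen : K.Generic a y) (hsep : ∃ r ∈ reflSet W, K.form r a * K.form r y < 0) :
    ∃ t ∈ reflSet W, K.form t a * K.form t y < 0 ∧ ∃ τ : ℝ, 0 < τ ∧ τ < 1 ∧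
      K.form t (a + τ • (y - a)) = 0 ∧
      ∀ r ∈ reflSet W, r ≠ t → 0 < K.form r a * K.form r (a + τ • (y - a)) := by
  have := finite_reflSet W
  let S : Set (E ≃ₗ[ℝ] E) := {r | r ∈ reflSet W ∧ K.form r a * K.form r y < 0}
  have hS : S.Finite := Set.Finite.subset (Set.toFinite (reflSet W)) fun r hr => hr.1
  obtain ⟨t, ⟨htR, hts⟩, hmin⟩ := hS.exists_minimalFor
    (fun r => K.form r a / (K.form r a - K.form r y)) S hsep
  have key : ∀ r, r ∈ S → 0 < K.form r a * (K.form r a - K.form r y) := fun r hr => by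
    have := hr.2
    nlinarith [sq_nonneg (K.form r a)]
  have hd : ∀ r ∈ S, K.form r a - K.form r y ≠ 0 := fun r hr h => by
    have := key r hr
    rw [h, mul_zero] at this
    exact lt_irrefl _ this
  have hτ : ∀ r ∈ S, 0 < K.form r a / (K.form r a - K.form r y) := fun r hr => by
    have := key r hr
    rw [← mul_pos_iff_of_pos_right (sq_pos_of_ne_zero (hd r hr))]
    calc 0 < _ := this
      _ = _ := by field_simp [hd r hr]
  set τ := K.form t a / (K.form t a - K.form t y) with hτdef
  have htS : t ∈ S := ⟨htR, hts⟩
  have hτt : τ * (K.form t a - K.form t y) = K.form t a := div_mul_cancel₀ _ (hd t htS)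
  have hτ1 : τ < 1 := by
    have h1 := key t htS
    have h2 : 0 < (K.form t a - K.form t y) ^ 2 := sq_pos_of_ne_zero (hd t htS)
    have h3 : (1 - τ) * (K.form t a - K.form t y) ^ 2
        = K.form t y ^ 2 - K.form t a * K.form t y := by
      linear_combination (K.form t y - K.form t a) * hτt
    have h4 : 0 < (1 - τ) * (K.form t a - K.form t y) ^ 2 := by
      rw [h3]; nlinarith [sq_nonneg (K.form t y)]
    linarith [pos_of_mul_pos_left h4 h2.le]
  refine ⟨t, htR, hts, τ, hτ t htS, hτ1, ?_, fun r hr hrt => ?_⟩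
  · rw [map_add, map_smul, map_sub, smul_eq_mul]; linarith
  · rw [map_add, map_smul, map_sub, smul_eq_mul]
    have hsq : 0 < K.form r a * K.form r a := mul_self_pos.2 (ha r hr)
    have hτ0 := hτ t htS
    rcases lt_or_ge (K.form r a * K.form r y) 0 with h | h
    · have hrS : r ∈ S := ⟨hr, h⟩
      have hle : τ ≤ K.form r a / (K.form r a - K.form r y) := by
        rcases le_total τ (K.form r a / (K.form r a - K.form r y)) with h' | h'
        · exact h'
        · exact hmin hrS h'
      have hτr : K.form r a / (K.form r a - K.form r y) * (K.form r a - K.form r y)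
          = K.form r a := div_mul_cancel₀ _ (hd r hrS)
      have hne : τ ≠ K.form r a / (K.form r a - K.form r y) := fun h' => by
        rw [← h'] at hτr
        apply hgen r hr t htR hrt
        linear_combination (K.form t a - K.form t y) * hτr -
          (K.form r a - K.form r y) * hτt
      have hlt := lt_of_le_of_ne hle hne
      have := mul_lt_mul_of_pos_right hlt (key r hrS)
      have h3 : K.form r a / (K.form r a - K.form r y) * (K.form r a * (K.form r a - K.form r y))
        = K.form r a * K.form r a := by
        rw [mul_comm (K.form r a) (_ - _), ← mul_assoc, hτr]
      linarith
    · nlinarith [mul_pos hsq (sub_pos.2 hτ1), mul_nonneg hτ0.le h]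

theorem IsSimple.form_conj_pos {t r : E ≃ₗ[ℝ] E} (ht : K.IsSimple t) (hr : r ∈ reflSet W)
    (hrt : r ≠ t) : t * r * t⁻¹ ≠ t ∧
      ∃ c : ℝ, 0 < c ∧ ∀ v, K.form (t * r * t⁻¹) (t v) = c * K.form r v := by
  obtain ⟨htR, z, hz0, hz⟩ := ht
  have hne : t * r * t⁻¹ ≠ t := fun h' => hrt (by
    have : r = t⁻¹ * (t * r * t⁻¹) * t := by group
    rw [h'] at this; simpa using this)
  obtain ⟨c, hc, h⟩ := form_conj (K := K) hr htR.1
  have h1 := h z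
  rw [(refl_eq_iff htR z).2 hz0] at h1
  have h2 := hz r hr hrt
  have h3 := hz _ (reflSet_conj hr htR.1) hne
  refine ⟨hne, c, ?_, h⟩
  by_contra! hneg
  nlinarith

/-- Every regular point can be moved into the chamber by simple reflections. -/
theorem exists_mem_closure_simple [Finite W] {y : E} (hy : y ∈ K.reg) :
    ∃ w ∈ Subgroup.closure {t | K.IsSimple t}, w y ∈ K.opn := by
  have := finite_reflSet W
  let N : E → Set (E ≃ₗ[ℝ] E) := fun y => {r | r ∈ reflSet W ∧ K.form r y < 0}
  have hN : ∀ y, (N y).Finite := fun y =>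
    Set.Finite.subset (Set.toFinite (reflSet W)) fun r hr => hr.1
  induction hcard : (N y).ncard using Nat.strong_induction_on generalizing y with
  | _ n ih =>
    by_cases hneg : ∃ r ∈ reflSet W, K.form r y < 0
    swap
    · push Not at hneg
      exact ⟨1, one_mem _, fun r hr => lt_of_le_of_ne (hneg r hr) (hy r hr).symm⟩
    obtain ⟨e, he, hbe⟩ := exists_generic_direction (opn_subset_reg (base_mem_opn (K := K)))
    have hev : ∀ᶠ ε in nhdsWithin (0 : ℝ) (Set.Ioi 0), ∀ r : reflSet W,
        0 < K.form r y * K.form r y + ε * (K.form r y * K.form r e) :=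
      Filter.eventually_all.2 fun r =>
        eventually_add_mul_pos (mul_self_pos.2 (hy r.1 r.2)) _
    obtain ⟨ε, ⟨_, hg⟩, hsign⟩ := ((eventually_generic he hbe y).and hev).exists
    have hneg' : ∀ r ∈ reflSet W, (K.form r (y + ε • e) < 0 ↔ K.form r y < 0) := by
      intro r hr
      have h1 := hsign ⟨r, hr⟩
      have h2 : K.form r (y + ε • e) = K.form r y + ε * K.form r e := by simp
      rw [h2]
      have h3 : 0 < K.form r y * (K.form r y + ε * K.form r e) := by linarith
      constructor <;> intro h <;> by_contra! h' <;> nlinarith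
    obtain ⟨t, htR, hts, τ, _, _, hz0, hz⟩ := exists_first_crossing
      (opn_subset_reg (base_mem_opn (K := K))) hg (by
        obtain ⟨r, hr, h⟩ := hneg
        exact ⟨r, hr, mul_neg_of_pos_of_neg (K.base_pos r hr) ((hneg' r hr).2 h)⟩)
    have ht : K.IsSimple t := ⟨htR, _, hz0, fun r hr hrt =>
      pos_of_mul_pos_right (hz r hr hrt) (K.base_pos r hr).le⟩
    have hty : K.form t y < 0 := (hneg' t htR).1 (by
      have := K.base_pos t htR
      by_contra! h
      nlinarith)
    have htt : t⁻¹ = t := inv_eq_of_mul_eq_one_left htR.2.mul_self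
    have hlt : (N (t y)).ncard < (N y).ncard := by
      have hsub : (fun r => t * r * t⁻¹) '' N (t y) ⊆ N y \ {t} := by
        rintro _ ⟨r, ⟨hr, hr0⟩, rfl⟩
        have hrt : r ≠ t := by
          rintro rfl
          rw [form_refl hr] at hr0
          linarith
        obtain ⟨hne, c, hc, hform⟩ := ht.form_conj_pos hr hrt
        refine ⟨⟨reflSet_conj hr htR.1, ?_⟩, hne⟩
        have h1 := hform (t y)
        rw [← LinearEquiv.mul_apply t t, htR.2.mul_self] at h1
        change K.form (t * r * t⁻¹) y = _ at h1
        change K.form (t * r * t⁻¹) y < 0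
        rw [h1]
        exact mul_neg_of_pos_of_neg hc hr0
      calc (N (t y)).ncard = ((fun r => t * r * t⁻¹) '' N (t y)).ncard :=
            (Set.ncard_image_of_injective _ (MulAut.conj t).injective).symm
        _ ≤ (N y \ {t}).ncard := Set.ncard_le_ncard hsub ((hN y).sdiff)
        _ < (N y).ncard := Set.ncard_sdiff_singleton_lt_of_mem ⟨htR, hty⟩ (hN y)
    obtain ⟨w, hw, hwy⟩ := ih _ (hcard ▸ hlt) (reg_smul htR.1 hy) rfl
    exact ⟨w * t, mul_mem hw (Subgroup.subset_closure ht), hwy⟩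

/-- The simple reflections generate a finite real reflection group. -/
theorem closure_simple [Finite W] (hW : Subgroup.closure (reflSet W) = W) :
    Subgroup.closure {t | K.IsSimple t} = W := by
  apply le_antisymm
  · rw [Subgroup.closure_le]
    exact fun t ht => ht.1.1
  · have hle : Subgroup.closure {t | K.IsSimple t} ≤ W := by
      rw [Subgroup.closure_le]
      exact fun t ht => ht.1.1
    conv_lhs => rw [← hW]
    rw [Subgroup.closure_le]
    intro r hr
    have := finite_reflSet W
    obtain ⟨z, hz0, hz⟩ : ∃ z, K.form r z = 0 ∧ ∀ r' ∈ reflSet W, r' ≠ r → K.form r' z ≠ 0 := by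
      let F : {r' : reflSet W // r'.1 ≠ r} → Module.Dual ℝ (LinearMap.ker (K.form r)) :=
        fun r' => K.form r'.1.1 ∘ₗ (LinearMap.ker (K.form r)).subtype
      obtain ⟨z, hz⟩ := Module.Dual.exists_forall_ne_zero_of_forall_exists F (by
        intro r'
        obtain ⟨v, hv, hv'⟩ := exists_form_ne (K := K) hr r'.1.2 r'.2.symm
        exact ⟨⟨v, hv⟩, hv'⟩)
      exact ⟨z.1, z.2, fun r' hr' hne => hz ⟨⟨r', hr'⟩, hne⟩⟩
    have hev : ∀ᶠ ε in nhdsWithin (0 : ℝ) (Set.Ioi 0), ∀ r' : reflSet W, r'.1 ≠ r →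
        0 < K.form r'.1 z * K.form r'.1 z + ε * (K.form r'.1 z * K.form r'.1 (K.root r)) := by
      rw [Filter.eventually_all]
      intro r'
      by_cases hrt : r'.1 = r
      · exact Filter.Eventually.of_forall fun _ h => absurd hrt h
      · filter_upwards [eventually_add_mul_pos (mul_self_pos.2 (hz r'.1 r'.2 hrt))
          (K.form r'.1 z * K.form r'.1 (K.root r))] with ε h1 _ using h1
    obtain ⟨ε, hε, hpos⟩ := (hev.and self_mem_nhdsWithin).exists
    have hpos : 0 < ε := hpos
    have hy : z + ε • K.root r ∈ K.reg := by
      intro r' hr'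
      rw [map_add, map_smul, smul_eq_mul]
      by_cases h : r' = r
      · rw [h, hz0, K.form_root r hr]; positivity
      · intro h0
        have := hε ⟨r', hr'⟩ h
        have h2 : K.form r' z * (K.form r' z + ε * K.form r' (K.root r)) = 0 := by
          rw [h0, mul_zero]
        simp only at this
        linarith
    obtain ⟨w, hw, hwy⟩ := exists_mem_closure_simple hy
    have hwW := hle hw
    have hsim : K.IsSimple (w * r * w⁻¹) := by
      refine ⟨reflSet_conj hr hwW, w z, ?_, fun r' hr' hne => ?_⟩
      · obtain ⟨c, _, h⟩ := form_conj (K := K) hr hwW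
        rw [h, hz0, mul_zero]
      · obtain ⟨c, hc, h⟩ := form_conj (K := K) (reflSet_conj' hr' hwW) hwW
        have e : w * (w⁻¹ * r' * w) * w⁻¹ = r' := by group
        rw [e] at h
        have hne' : w⁻¹ * r' * w ≠ r := fun h' => hne (by rw [← h']; group)
        have h1 := hε ⟨_, reflSet_conj' hr' hwW⟩ hne'
        have h2 := hwy r' hr'
        simp only at h1
        rw [h, map_add, map_smul, smul_eq_mul] at h2
        rw [h]
        generalize K.form (w⁻¹ * r' * w) z = a at *
        generalize K.form (w⁻¹ * r' * w) (K.root r) = b at *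
        have h3 : 0 < a * (a + ε * b) := by linarith
        rcases lt_or_gt_of_ne hc with h4 | h4
        · have : a + ε * b < 0 := by by_contra! h5; nlinarith
          exact mul_pos_of_neg_of_neg h4 (by by_contra! h5; nlinarith)
        · have : 0 < a + ε * b := by by_contra! h5; nlinarith
          exact mul_pos h4 (by by_contra! h5; nlinarith)
    have : r = w⁻¹ * (w * r * w⁻¹) * w := by group
    rw [this]
    exact mul_mem (mul_mem (inv_mem hw) (Subgroup.subset_closure hsim)) hw

end Chamber
end RealReflectionGroups

end

section

open Path.Homotopic in
theorem homotopic_of_starConvex {F : Type*} [NormedAddCommGroup F] [NormedSpace ℝ F]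
    {M S : Set F} {c : F} (hS : StarConvex ℝ c S) (hSM : S ⊆ M) {x y : M} (f g : Path x y)
    (hf : ∀ s, (f s).1 ∈ S) (hg : ∀ s, (g s).1 ∈ S) : f.Homotopic g := by
  have := hS.contractibleSpace ⟨_, hf 0⟩
  have hx : x.1 ∈ S := by simpa using hf 0
  have hy : y.1 ∈ S := by simpa using hf 1
  let lift : ∀ f : Path x y, (∀ s, (f s).1 ∈ S) → Path (⟨x.1, hx⟩ : S) ⟨y.1, hy⟩ := fun f hf =>
    { toFun := fun s => ⟨(f s).1, hf s⟩
      continuous_toFun := by fun_prop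
      source' := by simp
      target' := by simp }
  exact (SimplyConnectedSpace.paths_homotopic (lift f hf) (lift g hg)).map
    ⟨Set.inclusion hSM, continuous_inclusion hSM⟩

theorem exists_path_of_convex {F : Type*} [NormedAddCommGroup F] [NormedSpace ℝ F]
    {M S : Set F} (hS : Convex ℝ S) (hSM : S ⊆ M) (x y : M) (hx : x.1 ∈ S) (hy : y.1 ∈ S) :
    ∃ f : Path x y, ∀ s, (f s).1 ∈ S := by
  obtain ⟨f, hf⟩ := (hS.isPathConnected ⟨_, hx⟩).joinedIn _ hx _ hy
  exact ⟨{ toFun := fun s => ⟨f s, hSM (hf s)⟩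
           continuous_toFun := by fun_prop
           source' := by simp
           target' := by simp }, hf⟩

section
variable {E : Type*} [NormedAddCommGroup E] [NormedSpace ℝ E]
variable {W : Subgroup (E ≃ₗ[ℝ] E)}

namespace Chamber
variable (K : Chamber W)

/-- The complement of the complexified reflecting hyperplanes, in real coordinates. -/
def hypComp : Set (E × E) := {q | ∀ r ∈ reflSet W, K.form r q.1 ≠ 0 ∨ K.form r q.2 ≠ 0}

/-- The points with real part in the chamber of `a`. -/
def chSet (a : E) : Set (E × E) := {q | ∀ r ∈ reflSet W, 0 < K.form r a * K.form r q.1}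

/-- The union of the two chambers adjacent to the wall of `t` near `a`, together with one
half of the complexified wall. -/
def wallSet (a : E) (t : E ≃ₗ[ℝ] E) (e : ℝ) : Set (E × E) :=
  {q | (∀ r ∈ reflSet W, r ≠ t → 0 < K.form r a * K.form r q.1) ∧
    (K.form t q.1 ≠ 0 ∨ 0 < e * K.form t q.2)}

variable {K}

theorem convex_chSet (a : E) : Convex ℝ (K.chSet a) := by
  intro x hx y hy s s' hs hs' hss r hr
  have h1 := hx r hr
  have h2 := hy r hr
  have : K.form r a * K.form r (s • x + s' • y).1
      = s * (K.form r a * K.form r x.1) + s' * (K.form r a * K.form r y.1) := by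
    simp; ring
  rw [this]
  rcases hs.lt_or_eq with h | h
  · have := mul_pos h h1
    have := mul_nonneg hs' h2.le
    linarith
  · rw [← h, zero_add] at hss
    rw [← h, hss]; linarith

theorem chSet_subset (a : E) : K.chSet a ⊆ K.hypComp := fun q hq r hr =>
  Or.inl fun h => by simpa [h] using hq r hr

theorem wallSet_subset (a : E) (t : E ≃ₗ[ℝ] E) (e : ℝ) : K.wallSet a t e ⊆ K.hypComp := by
  intro q hq r hr
  by_cases hrt : r = t
  · subst hrt
    exact hq.2.imp id fun h h0 => by simp [h0] at h
  · exact Or.inl fun h => by simpa [h] using hq.1 r hr hrt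

theorem starConvex_wallSet {a z : E} {t : E ≃ₗ[ℝ] E} (ht : t ∈ reflSet W) {e : ℝ} (he : e ≠ 0)
    (hz0 : K.form t z = 0) (hz : ∀ r ∈ reflSet W, r ≠ t → 0 < K.form r a * K.form r z) :
    StarConvex ℝ (z, e • K.root t) (K.wallSet a t e) := by
  intro q hq s s' hs hs' hss
  refine ⟨fun r hr hrt => ?_, ?_⟩
  · have h1 := hz r hr hrt
    have h2 := hq.1 r hr hrt
    have : K.form r a * K.form r (s • (z, e • K.root t) + s' • q).1
        = s * (K.form r a * K.form r z) + s' * (K.form r a * K.form r q.1) := by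
      simp; ring
    rw [this]
    rcases hs.lt_or_eq with h | h
    · have := mul_pos h h1
      have := mul_nonneg hs' h2.le
      linarith
    · rw [← h, zero_add] at hss
      rw [← h, hss]; linarith
  · have e1 : K.form t (s • (z, e • K.root t) + s' • q).1 = s' * K.form t q.1 := by
      simp [hz0]
    have e2 : e * K.form t (s • (z, e • K.root t) + s' • q).2
        = s * (e * e * 2) + s' * (e * K.form t q.2) := by
      simp [K.form_root t ht]; ring
    have hee : 0 < e * e * 2 := mul_pos (mul_self_pos.2 he) two_pos
    rw [e1, e2]
    rcases hs'.lt_or_eq with h | h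
    · rcases hq.2 with h' | h'
      · exact Or.inl (mul_ne_zero h.ne' h')
      · right
        have := mul_pos h h'
        have := mul_nonneg hs hee.le
        linarith
    · right
      rw [← h, add_zero] at hss
      rw [← h, hss]; linarith

theorem chSet_subset_wallSet {a : E} {t : E ≃ₗ[ℝ] E} (ht : t ∈ reflSet W) (e : ℝ) :
    K.chSet a ⊆ K.wallSet a t e := fun q hq =>
  ⟨fun r hr _ => hq r hr, Or.inl fun h => by simpa [h] using hq t ht⟩

/-- The set on the other side of a wall. -/
theorem chSet_refl_subset_wallSet {a a' : E} {t : E ≃ₗ[ℝ] E} (ht : t ∈ reflSet W) (e : ℝ)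
    (h : ∀ r ∈ reflSet W, r ≠ t → 0 < K.form r a * K.form r a') :
    K.chSet a' ⊆ K.wallSet a t e := fun q hq =>
  ⟨fun r hr hrt => by
    have h1 := h r hr hrt
    have h2 := hq r hr
    have h3 : 0 < (K.form r a' * K.form r a') * (K.form r a * K.form r q.1) := by
      have := mul_pos h1 h2
      linarith
    exact pos_of_mul_pos_right h3 (mul_self_nonneg _),
  Or.inl fun h => by simpa [h] using hq t ht⟩

/-- Signs of forms are transported by the group. -/
theorem mul_form_pos {w r : E ≃ₗ[ℝ] E} (hr : r ∈ reflSet W) (hw : w ∈ W) (x y : E) :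
    0 < K.form r (w x) * K.form r (w y) ↔
      0 < K.form (w⁻¹ * r * w) x * K.form (w⁻¹ * r * w) y := by
  obtain ⟨c, hc, h⟩ := form_conj (K := K) (reflSet_conj' hr hw) hw
  have e : w * (w⁻¹ * r * w) * w⁻¹ = r := by group
  rw [e] at h
  rw [h, h, show ∀ a b : ℝ, c * a * (c * b) = (c * c) * (a * b) from fun a b => by ring]
  exact mul_pos_iff_of_pos_left (mul_self_pos.2 hc)

theorem smul_mem_chSet {w : E ≃ₗ[ℝ] E} (hw : w ∈ W) {a : E} {q : E × E} (hq : q ∈ K.chSet a) :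
    (w q.1, w q.2) ∈ K.chSet (w a) := fun _ hr =>
  (mul_form_pos hr hw _ _).2 (hq _ (reflSet_conj' hr hw))

theorem smul_mem_wallSet {w t : E ≃ₗ[ℝ] E} (hw : w ∈ W) (ht : t ∈ reflSet W) :
    ∃ c : ℝ, c ≠ 0 ∧ ∀ (a : E) (e : ℝ) (q : E × E), q ∈ K.wallSet a t e →
      (w q.1, w q.2) ∈ K.wallSet (w a) (w * t * w⁻¹) (c * e) := by
  obtain ⟨c, hc, h⟩ := form_conj (K := K) ht hw
  refine ⟨c, hc, fun a e q hq => ⟨fun r hr hrt => ?_, ?_⟩⟩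
  · refine (mul_form_pos hr hw _ _).2 (hq.1 _ (reflSet_conj' hr hw) fun h' => hrt ?_)
    rw [← h']; group
  · rw [h, h]
    refine hq.2.imp (mul_ne_zero hc) fun h0 => ?_
    rw [show c * e * (c * K.form t q.2) = (c * c) * (e * K.form t q.2) by ring]
    exact mul_pos (mul_self_pos.2 hc) h0

theorem isOpen_hypComp [FiniteDimensional ℝ E] [Finite W] : IsOpen K.hypComp := by
  have := finite_reflSet W
  have : K.hypComp = ⋂ r : reflSet W, {q | K.form r q.1 ≠ 0 ∨ K.form r q.2 ≠ 0} := by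
    ext q; simp [hypComp]
  rw [this]
  refine isOpen_iInter_of_finite fun r => ?_
  have hc : Continuous (K.form r.1) := LinearMap.continuous_of_finiteDimensional _
  exact (isOpen_ne_fun (hc.comp continuous_fst) continuous_const).union
    (isOpen_ne_fun (hc.comp continuous_snd) continuous_const)

end Chamber
end

end

section

section
variable {E : Type*} [NormedAddCommGroup E] [NormedSpace ℝ E]
variable {W : Subgroup (E ≃ₗ[ℝ] E)}

/-- An equivariant map to a complexified hyperplane complement, such that the half-turns around
the walls of the base chamber lift. -/
structure WallLifting (K : Chamber W) (Γ X : Type*) [Group Γ] [TopologicalSpace X]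
    [MulAction Γ X] where
  map : C(X, K.hypComp)
  hom : Γ →* (E ≃ₗ[ℝ] E)
  hom_mem : ∀ g, hom g ∈ W
  equivariant : ∀ g x, (map (g • x)).1 = (hom g (map x).1.1, hom g (map x).1.2)
  pt : X
  pt_mem : (map pt).1.1 ∈ K.opn
  lift : ∀ t, K.IsSimple t → ∀ e : ℝ, e ≠ 0 → ∃ g, hom g = t ∧ ∃ δ : Path pt (g • pt),
    ∀ s, (map (δ s)).1 ∈ K.wallSet K.base t e

namespace WallLifting
variable {K : Chamber W} {Γ X : Type*} [Group Γ] [TopologicalSpace X] [MulAction Γ X]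
  (L : WallLifting K Γ X)

/-- The homotopy class `η` lifts, up to a path inside a chamber. -/
def Accessible {u : K.hypComp} (η : Path.Homotopic.Quotient (L.map L.pt) u) : Prop :=
  ∃ (g : Γ) (z : X) (_ : z = g • L.pt) (δ : Path L.pt z) (σ : Path (L.map z) u),
    (∀ s, (σ s).1 ∈ K.chSet (L.hom g K.base)) ∧
      η = (Path.Homotopic.Quotient.mk (δ.map L.map.continuous)).trans
        (Path.Homotopic.Quotient.mk σ)

variable {L}

theorem map_smul_pt_mem (g : Γ) : (L.map (g • L.pt)).1 ∈ K.chSet (L.hom g K.base) := by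
  rw [L.equivariant]
  exact Chamber.smul_mem_chSet (L.hom_mem g) fun r hr => mul_pos (K.base_pos r hr) (L.pt_mem r hr)

theorem accessible_of_chSet (γ : Path (L.map L.pt) (L.map L.pt))
    (hγ : ∀ s, (γ s).1 ∈ K.chSet K.base) : L.Accessible (Path.Homotopic.Quotient.mk γ) :=
  ⟨1, L.pt, (one_smul _ _).symm, Path.refl _, γ, by simpa using hγ, by
    change _ = (Path.Homotopic.Quotient.mk (Path.refl (L.map L.pt))).trans _
    rw [Path.Homotopic.Quotient.mk_refl, Path.Homotopic.Quotient.refl_trans]⟩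

theorem accessible_refl : L.Accessible (Path.Homotopic.Quotient.refl (L.map L.pt)) := by
  rw [← Path.Homotopic.Quotient.mk_refl]
  refine accessible_of_chSet _ fun s => ?_
  simpa using map_smul_pt_mem (L := L) 1

theorem Accessible.trans_of_chSet {u v : K.hypComp}
    {η : Path.Homotopic.Quotient (L.map L.pt) u} (h : L.Accessible η) (f : Path u v) {a : E}
    (hu : u.1 ∈ K.chSet a) (hf : ∀ s, (f s).1 ∈ K.chSet a) :
    L.Accessible (η.trans (Path.Homotopic.Quotient.mk f)) := by
  obtain ⟨g, z, hz, δ, σ, hσ, rfl⟩ := h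
  refine ⟨g, z, hz, δ, σ.trans f, ?_, by
    rw [Path.Homotopic.Quotient.mk_trans, Path.Homotopic.Quotient.trans_assoc]⟩
  have hu' : u.1 ∈ K.chSet (L.hom g K.base) := by simpa using hσ 1
  have hsub : K.chSet a ⊆ K.chSet (L.hom g K.base) := fun q hq r hr => by
    have h1 := hu r hr
    have h2 := hu' r hr
    have h3 := hq r hr
    have h4 : 0 < (K.form r a * K.form r a) * (K.form r u.1.1 * K.form r u.1.1) *
        (K.form r (L.hom g K.base) * K.form r q.1) := by
      have := mul_pos (mul_pos h1 h2) h3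
      calc 0 < _ := this
        _ = _ := by ring
    exact pos_of_mul_pos_right h4 (mul_nonneg (mul_self_nonneg _) (mul_self_nonneg _))
  intro s
  rw [Path.trans_apply]
  split_ifs
  · exact hσ _
  · exact hsub (hf _)

theorem Accessible.trans_of_wallSet [ContinuousConstSMul Γ X] {u v : K.hypComp}
    {η : Path.Homotopic.Quotient (L.map L.pt) u} (h : L.Accessible η) (f : Path u v)
    {t : E ≃ₗ[ℝ] E} (ht : t ∈ reflSet W) {z : E} (hz0 : K.form t z = 0)
    (hz : ∀ r ∈ reflSet W, r ≠ t → 0 < K.form r u.1.1 * K.form r z) {e : ℝ} (he : e ≠ 0)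
    (hf : ∀ s, (f s).1 ∈ K.wallSet u.1.1 t e) (hv : v.1 ∈ K.chSet (t u.1.1)) :
    L.Accessible (η.trans (Path.Homotopic.Quotient.mk f)) := by
  obtain ⟨g, _, rfl, δ, σ, hσ, rfl⟩ := h
  set w := L.hom g with hw
  have hwW : w ∈ W := L.hom_mem g
  have hu : u.1 ∈ K.chSet (w K.base) := by simpa using hσ 1
  have hsq : ∀ r ∈ reflSet W, 0 < K.form r u.1.1 * K.form r u.1.1 := fun r hr =>
    mul_self_pos.2 fun h0 => by simpa [h0] using hu r hr
  have hsign : ∀ r ∈ reflSet W, ∀ y,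
      0 < K.form r u.1.1 * y ↔ 0 < K.form r (w K.base) * y := fun r hr y => by
    have h1 := hu r hr
    have h2 := hsq r hr
    have h3 : 0 < K.form r (w K.base) * K.form r (w K.base) :=
      mul_self_pos.2 fun h0 => by simpa [h0] using hu r hr
    constructor
    · intro h
      have := mul_pos h1 h
      exact pos_of_mul_pos_right (by calc 0 < _ := this
                                      _ = (K.form r u.1.1 * K.form r u.1.1) * _ := by ring) h2.le
    · intro h
      have := mul_pos h1 h
      exact pos_of_mul_pos_right (by calc 0 < _ := this
                                      _ = (K.form r (w K.base) * K.form r (w K.base)) * _ := by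
                                        ring) h3.le
  have hwall : K.wallSet u.1.1 t e = K.wallSet (w K.base) t e := by
    ext q
    refine and_congr ⟨fun h r hr hrt => ?_, fun h r hr hrt => ?_⟩ Iff.rfl
    · exact (hsign r hr _).1 (h r hr hrt)
    · exact (hsign r hr _).2 (h r hr hrt)
  rw [hwall] at hf
  have hz' : ∀ r ∈ reflSet W, r ≠ t → 0 < K.form r (w K.base) * K.form r z :=
    fun r hr hrt => (hsign r hr _).1 (hz r hr hrt)
  set t₀ := w⁻¹ * t * w with ht₀
  have ht₀R : t₀ ∈ reflSet W := reflSet_conj' ht hwW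
  have htt : w * t₀ * w⁻¹ = t := by rw [ht₀]; group
  have hwinv : ∀ y, w⁻¹ (w y) = y := fun y => by
    rw [← LinearEquiv.mul_apply, inv_mul_cancel]; rfl
  have hwinv' : ∀ y, w (w⁻¹ y) = y := fun y => by
    rw [← LinearEquiv.mul_apply, mul_inv_cancel]; rfl
  have ht₀s : K.IsSimple t₀ := by
    refine ⟨ht₀R, w⁻¹ z, ?_, fun r hr hrt => ?_⟩
    · obtain ⟨c, hc, h⟩ := Chamber.form_conj (K := K) ht₀R hwW
      have := h (w⁻¹ z)
      rw [htt, hwinv', hz0] at this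
      exact (mul_eq_zero.1 this.symm).resolve_left hc
    · have h1 := (Chamber.mul_form_pos (K := K) hr (W.inv_mem hwW) (w K.base) z).2
      rw [hwinv, inv_inv] at h1
      refine pos_of_mul_pos_right (h1 (hz' _ (reflSet_conj hr hwW) fun h => hrt ?_))
        (K.base_pos r hr).le
      rw [ht₀, ← h]; group
  obtain ⟨c, hc, hcw⟩ := Chamber.smul_mem_wallSet (K := K) hwW ht₀R
  obtain ⟨g', hg', δ', hδ'⟩ := L.lift t₀ ht₀s (c⁻¹ * e) (mul_ne_zero (inv_ne_zero hc) he)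
  have hcont : Continuous fun x : X => g • x := continuous_const_smul g
  have hgg : L.hom (g * g') K.base = t (w K.base) := by
    rw [map_mul, hg']
    change w (t₀ K.base) = _
    rw [← htt]
    change _ = w (t₀ (w⁻¹ (w K.base)))
    rw [hwinv]
  have hopp : K.chSet (t (w K.base)) ⊆ K.wallSet (w K.base) t e := by
    refine Chamber.chSet_refl_subset_wallSet ht e fun r hr hrt => ?_
    have h1 := Chamber.mul_form_pos (K := K) hr hwW K.base (t₀ K.base)
    have h2 : w (t₀ K.base) = t (w K.base) := by
      rw [← hgg, map_mul, hg']; rfl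
    rw [h2] at h1
    refine h1.2 (mul_pos (K.base_pos _ (reflSet_conj' hr hwW)) ?_)
    refine ht₀s.form_pos (reflSet_conj' hr hwW) (fun h => hrt ?_) fun r hr _ => K.base_pos r hr
    rw [← htt, ← h]; group
  have hv' : v.1 ∈ K.chSet (t (w K.base)) := fun r hr => by
    have h1 := (Chamber.mul_form_pos (K := K) hr ht.1 (w K.base) u.1.1).2
      (hu _ (reflSet_conj' hr ht.1))
    have h2 := hv r hr
    have h3 : 0 < (K.form r (t u.1.1) * K.form r (t u.1.1)) *
        (K.form r (t (w K.base)) * K.form r v.1.1) := by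
      calc 0 < _ := mul_pos h1 h2
        _ = _ := by ring
    exact pos_of_mul_pos_right h3 (mul_self_nonneg _)
  have hmem : (L.map (g • g' • L.pt)).1 ∈ K.chSet (t (w K.base)) := by
    rw [← hgg, ← mul_smul]; exact map_smul_pt_mem _
  obtain ⟨σ', hσ'⟩ := exists_path_of_convex (Chamber.convex_chSet (K := K) (t (w K.base)))
    (Chamber.chSet_subset _) (L.map (g • g' • L.pt)) v hmem hv'
  have hhom : (σ.trans f).Homotopic (((δ'.map hcont).map L.map.continuous).trans σ') := by
    refine homotopic_of_starConvex (Chamber.starConvex_wallSet ht he hz0 hz')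
      (Chamber.wallSet_subset _ _ _) _ _ (fun s => ?_) fun s => ?_
    · rw [Path.trans_apply]
      split_ifs
      · exact Chamber.chSet_subset_wallSet ht e (hσ _)
      · exact hf _
    · rw [Path.trans_apply]
      split_ifs
      · have h1 := hcw _ _ _ (hδ' ⟨2 * (s : ℝ), (unitInterval.mul_pos_mem_iff zero_lt_two).2
          ⟨s.2.1, by assumption⟩⟩)
        rw [htt, mul_inv_cancel_left₀ hc] at h1
        simp only [Path.map_coe, Function.comp_apply]
        rw [L.equivariant]
        exact h1
      · exact hopp (hσ' _)
  refine ⟨g * g', g • g' • L.pt, (mul_smul _ _ _).symm, δ.trans (δ'.map hcont), σ', ?_, ?_⟩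
  · rw [hgg]; exact hσ'
  · have h1 := Path.Homotopic.Quotient.eq.2 hhom
    rw [Path.Homotopic.Quotient.mk_trans, Path.Homotopic.Quotient.mk_trans] at h1
    rw [Path.map_trans, Path.Homotopic.Quotient.mk_trans, Path.Homotopic.Quotient.trans_assoc,
      Path.Homotopic.Quotient.trans_assoc, h1]

end WallLifting
end

end

section

theorem mul_pos_trans {a b c : ℝ} (h : 0 < a * b) (h' : 0 < b * c) : 0 < a * c := by
  refine pos_of_mul_pos_right (b := a * c) (a := b * b) ?_ (mul_self_nonneg _)
  calc 0 < a * b * (b * c) := mul_pos h h'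
    _ = _ := by ring

theorem unitInterval_induction {P : unitInterval → Prop} (h0 : P 0) {δ : ℝ} (hδ : 0 < δ)
    (h : ∀ s t, dist s t < δ → P s → P t) (t : unitInterval) : P t := by
  have hP : IsClopen {t | P t} := by
    refine ⟨⟨Metric.isOpen_iff.2 fun s hs => ⟨δ, hδ, fun t ht hPt => hs (h t s ?_ hPt)⟩⟩,
      Metric.isOpen_iff.2 fun s hs => ⟨δ, hδ, fun t ht => h s t ?_ hs⟩⟩
    · exact ht
    · rw [dist_comm]; exact ht
  have : t ∈ {t | P t} := by
    rw [hP.eq_univ ⟨0, h0⟩]; trivial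
  exact this

section
variable {E : Type*} [NormedAddCommGroup E] [NormedSpace ℝ E]
variable {W : Subgroup (E ≃ₗ[ℝ] E)}

open Filter Topology in
theorem Chamber.exists_near_generic [Finite W] {K : Chamber W} {a : E} (ha : a ∈ K.reg) (q : E × E)
    {ε : ℝ} (hε : 0 < ε) : ∃ v : E × E, v.1 ∈ K.reg ∧ K.Generic a v.1 ∧ dist v q < ε ∧
      (q.1 ∈ K.reg → v ∈ K.chSet q.1) := by
  have := finite_reflSet W
  obtain ⟨e, he, hae⟩ := Chamber.exists_generic_direction ha
  have h1 := Chamber.eventually_generic he hae q.1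
  have h2 : ∀ᶠ s in 𝓝[>] (0 : ℝ), dist (q.1 + s • e, q.2) q < ε := by
    have : Tendsto (fun s : ℝ => dist (q.1 + s • e, q.2) q) (𝓝 0)
        (𝓝 (dist (q.1 + (0 : ℝ) • e, q.2) q)) :=
      Continuous.tendsto (by fun_prop) 0
    exact (this.mono_left nhdsWithin_le_nhds).eventually (gt_mem_nhds (by simpa using hε))
  have h3 : ∀ᶠ s in 𝓝[>] (0 : ℝ), q.1 ∈ K.reg → ∀ r : reflSet W,
      0 < K.form r q.1 * K.form r q.1 + s * (K.form r q.1 * K.form r e) := by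
    by_cases hq : q.1 ∈ K.reg
    · filter_upwards [eventually_all.2 fun r : reflSet W =>
        eventually_add_mul_pos (mul_self_pos.2 (hq r.1 r.2)) (K.form r q.1 * K.form r e)] with s hs _
      exact hs
    · exact Eventually.of_forall fun _ h => absurd h hq
  obtain ⟨s, ⟨⟨hs1, hs2⟩, hs3⟩, hs4⟩ := ((h1.and h2).and h3).exists
  refine ⟨(q.1 + s • e, q.2), hs1, hs2, hs3, fun hq r hr => ?_⟩
  have := hs4 hq ⟨r, hr⟩
  simp only [map_add, map_smul, smul_eq_mul]
  linarith

namespace WallLifting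
variable {K : Chamber W} {Γ X : Type*} [Group Γ] [TopologicalSpace X] [MulAction Γ X]
  {L : WallLifting K Γ X}

open Filter Topology in
theorem Accessible.trans_of_segment [ContinuousConstSMul Γ X] [Finite W] {u v : K.hypComp}
    {η : Path.Homotopic.Quotient (L.map L.pt) u} (h : L.Accessible η) (f : Path u v)
    (hseg : segment ℝ u.1 v.1 ⊆ K.hypComp) (hf : ∀ s, (f s).1 ∈ segment ℝ u.1 v.1)
    (hu : u.1.1 ∈ K.reg) (hv : v.1.1 ∈ K.reg) (hgen : K.Generic u.1.1 v.1.1) :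
    L.Accessible (η.trans (Path.Homotopic.Quotient.mk f)) := by
  have := finite_reflSet W
  let N : E → Set (E ≃ₗ[ℝ] E) := fun y => {r | r ∈ reflSet W ∧ K.form r y * K.form r v.1.1 < 0}
  have hN : ∀ y, (N y).Finite := fun y =>
    Set.Finite.subset (Set.toFinite (reflSet W)) fun r hr => hr.1
  induction hcard : (N u.1.1).ncard using Nat.strong_induction_on generalizing u with
  | _ n ih =>
    have huu : u.1 ∈ K.chSet u.1.1 := fun r hr => mul_self_pos.2 (hu r hr)
    by_cases hsep : ∃ r ∈ reflSet W, K.form r u.1.1 * K.form r v.1.1 < 0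
    swap
    · push Not at hsep
      have hvu : v.1 ∈ K.chSet u.1.1 := fun r hr =>
        lt_of_le_of_ne (hsep r hr) (mul_ne_zero (hu r hr) (hv r hr)).symm
      exact h.trans_of_chSet f huu fun s =>
        (Chamber.convex_chSet _).segment_subset huu hvu (hf s)
    obtain ⟨t, ht, htneg, τ, hτ0, hτ1, hz0, hz⟩ :=
      Chamber.exists_first_crossing hu hgen hsep
    have hev : ∀ᶠ ε in 𝓝[>] (0 : ℝ), (∀ r : reflSet W, r.1 ≠ t →
        0 < K.form r u.1.1 * K.form r (u.1.1 + τ • (v.1.1 - u.1.1)) +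
          ε * (K.form r u.1.1 * K.form r (v.1.1 - u.1.1))) ∧ 0 < 1 - τ + ε * (-1) := by
      refine (eventually_all.2 fun r => ?_).and (eventually_add_mul_pos (sub_pos.2 hτ1) _)
      by_cases hrt : r.1 = t
      · exact Eventually.of_forall fun _ h => absurd hrt h
      · filter_upwards [eventually_add_mul_pos (hz r.1 r.2 hrt) _] with ε hε _ using hε
    obtain ⟨ε, ⟨hε, hε1⟩, hε0⟩ := (hev.and self_mem_nhdsWithin).exists
    have hε0 : 0 < ε := hε0
    set ρ := τ + ε with hρ
    have hρ1 : ρ < 1 := by linarith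
    have hρ0 : 0 < ρ := by linarith
    have hmemseg : ∀ s : ℝ, 0 ≤ s → s ≤ 1 → u.1 + s • (v.1 - u.1) ∈ segment ℝ u.1 v.1 := by
      intro s h0 h1
      rw [segment_eq_image']
      exact ⟨s, ⟨h0, h1⟩, rfl⟩
    set u' : K.hypComp := ⟨u.1 + ρ • (v.1 - u.1), hseg (hmemseg ρ hρ0.le hρ1.le)⟩ with hu'
    have hu'1 : u'.1 ∈ segment ℝ u.1 v.1 := hmemseg ρ hρ0.le hρ1.le
    have hu'f : ∀ r, K.form r u'.1.1
        = K.form r u.1.1 + ρ * (K.form r v.1.1 - K.form r u.1.1) := fun r => by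
      simp [hu']
    have hzf : ∀ r, K.form r (u.1.1 + τ • (v.1.1 - u.1.1))
        = K.form r u.1.1 + τ * (K.form r v.1.1 - K.form r u.1.1) := fun r => by simp
    have hu'pos : ∀ r ∈ reflSet W, r ≠ t → 0 < K.form r u.1.1 * K.form r u'.1.1 := by
      intro r hr hrt
      have := hε ⟨r, hr⟩ hrt
      simp only [hzf, map_sub] at this
      rw [hu'f, hρ]
      linarith
    have hu'neg : K.form t u.1.1 * K.form t u'.1.1 < 0 := by
      have h1 : K.form t u'.1.1 = ε * (K.form t v.1.1 - K.form t u.1.1) := by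
        rw [hzf] at hz0
        rw [hu'f, hρ]; linarith
      rw [h1]
      have := hu t ht
      have : 0 < K.form t u.1.1 * K.form t u.1.1 := mul_self_pos.2 this
      nlinarith
    have hu'reg : u'.1.1 ∈ K.reg := by
      intro r hr h0
      by_cases hrt : r = t
      · rw [hrt] at h0; simp [h0] at hu'neg
      · have := hu'pos r hr hrt
        simp [h0] at this
    set e := K.form t (u.1 + τ • (v.1 - u.1)).2 with he
    have he0 : e ≠ 0 :=
      (hseg (hmemseg τ hτ0.le hτ1.le) t ht).resolve_left (by
        simp only [not_not]
        exact hz0)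
    have hsub1 : segment ℝ u.1 u'.1 ⊆ segment ℝ u.1 v.1 :=
      (convex_segment _ _).segment_subset (left_mem_segment _ _ _) hu'1
    have hsub2 : segment ℝ u'.1 v.1 ⊆ segment ℝ u.1 v.1 :=
      (convex_segment _ _).segment_subset hu'1 (right_mem_segment _ _ _)
    have hwall : segment ℝ u.1 u'.1 ⊆ K.wallSet u.1.1 t e := by
      intro q hq
      refine ⟨fun r hr hrt => ?_, ?_⟩
      · obtain ⟨a, b, ha, hb, hab, rfl⟩ := hq
        have h1 := huu r hr
        have h2 := hu'pos r hr hrt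
        have h3 : K.form r u.1.1 * K.form r (a • u.1 + b • u'.1).1
            = a * (K.form r u.1.1 * K.form r u.1.1)
              + b * (K.form r u.1.1 * K.form r u'.1.1) := by simp; ring
        rw [h3]
        rcases ha.lt_or_eq with h | h
        · have := mul_pos h h1
          have := mul_nonneg hb h2.le
          linarith
        · rw [← h, zero_add] at hab
          rw [← h, hab]; linarith
      · rw [segment_eq_image'] at hq
        obtain ⟨s, hs, rfl⟩ := hq
        change K.form t (u.1 + s • (u'.1 - u.1)).1 ≠ 0 ∨
          0 < e * K.form t (u.1 + s • (u'.1 - u.1)).2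
        by_cases h0 : K.form t (u.1 + s • (u'.1 - u.1)).1 = 0
        · right
          have hd : K.form t v.1.1 - K.form t u.1.1 ≠ 0 := fun h => by
            have h4 : K.form t v.1.1 = K.form t u.1.1 := by linarith
            rw [h4] at htneg
            nlinarith [mul_self_nonneg (K.form t u.1.1)]
          have h1 : u.1 + s • (u'.1 - u.1) = u.1 + (s * ρ) • (v.1 - u.1) := by
            simp [hu', smul_smul]
          rw [h1] at h0 ⊢
          have h2 : (s * ρ - τ) * (K.form t v.1.1 - K.form t u.1.1) = 0 := by
            rw [hzf] at hz0
            simp at h0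
            linarith
          have h3 : s * ρ = τ := by
            have := (mul_eq_zero.1 h2).resolve_right hd
            linarith
          rw [h3, ← he]
          exact mul_self_pos.2 he0
        · exact Or.inl h0
    have hu'ch : u'.1 ∈ K.chSet (t u.1.1) := by
      intro r hr
      by_cases hrt : r = t
      · rw [hrt, Chamber.form_refl ht]; linarith
      · refine mul_pos_trans (b := K.form r u.1.1) ?_ (hu'pos r hr hrt)
        have h1 := hz r hr hrt
        rw [mul_comm] at h1
        refine mul_pos_trans (b := K.form r (u.1.1 + τ • (v.1.1 - u.1.1))) ?_ h1
        have h2 := (Chamber.mul_form_pos (K := K) hr ht.1 u.1.1 (u.1.1 + τ • (v.1.1 - u.1.1))).2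
          (hz _ (reflSet_conj' hr ht.1) fun h => hrt (by
            have : r = t * (t⁻¹ * r * t) * t⁻¹ := by group
            rw [this, h]; group))
        rwa [(Chamber.refl_eq_iff ht _).2 hz0] at h2
    obtain ⟨f₁, hf₁⟩ := exists_path_of_convex (convex_segment u.1 u'.1) (hsub1.trans hseg) u u'
      (left_mem_segment _ _ _) (right_mem_segment _ _ _)
    obtain ⟨f₂, hf₂⟩ := exists_path_of_convex (convex_segment u'.1 v.1) (hsub2.trans hseg) u' v
      (left_mem_segment _ _ _) (right_mem_segment _ _ _)
    have hacc := h.trans_of_wallSet f₁ ht hz0 hz he0 (fun s => hwall (hf₁ s)) hu'ch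
    have hlt : (N u'.1.1).ncard < (N u.1.1).ncard := by
      have hsub : N u'.1.1 ⊆ N u.1.1 \ {t} := by
        rintro r ⟨hr, hneg⟩
        have hrt : r ≠ t := by
          rintro rfl
          have : 0 < K.form r u'.1.1 * K.form r v.1.1 := by
            have h1 : 0 < K.form r u'.1.1 * -K.form r u.1.1 := by linarith
            have h2 : 0 < -K.form r u.1.1 * K.form r v.1.1 := by linarith
            exact mul_pos_trans h1 h2
          linarith
        refine ⟨⟨hr, ?_⟩, hrt⟩
        have h1 := hu'pos r hr hrt
        have h2 : 0 < K.form r u'.1.1 * -K.form r v.1.1 := by linarith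
        have := mul_pos_trans h1 h2
        linarith
      exact (Set.ncard_le_ncard hsub (hN _).sdiff).trans_lt
        (Set.ncard_sdiff_singleton_lt_of_mem ⟨ht, htneg⟩ (hN _))
    have hacc2 := ih _ (hcard ▸ hlt) hacc f₂ (hsub2.trans hseg) hf₂ hu'reg (by
      intro r hr r' hr' hne heq
      refine hgen r hr r' hr' hne ?_
      rw [hu'f, hu'f] at heq
      have : (1 - ρ) * (K.form r u.1.1 * K.form r' v.1.1)
          = (1 - ρ) * (K.form r' u.1.1 * K.form r v.1.1) := by linear_combination heq
      exact mul_left_cancel₀ (by linarith) this) rfl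
    rw [Path.Homotopic.Quotient.trans_assoc, ← Path.Homotopic.Quotient.mk_trans] at hacc2
    have hhom : (f₁.trans f₂).Homotopic f := by
      refine homotopic_of_starConvex ((convex_segment u.1 v.1).starConvex
        (left_mem_segment _ _ _)) hseg _ _ (fun s => ?_) hf
      rw [Path.trans_apply]
      split_ifs
      · exact hsub1 (hf₁ _)
      · exact hsub2 (hf₂ _)
    rwa [Path.Homotopic.Quotient.eq.2 hhom] at hacc2

/-- Every path ending in the orbit of the base point is homotopic to the image of a path. -/
theorem exists_lift [ContinuousConstSMul Γ X] [FiniteDimensional ℝ E] [Finite W]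
    (hW : Subgroup.closure (reflSet W) = W) {w : E ≃ₗ[ℝ] E} (hw : w ∈ W) {u : K.hypComp}
    (hu : u.1 = (w (L.map L.pt).1.1, w (L.map L.pt).1.2)) (γ : Path (L.map L.pt) u) :
    ∃ g, L.hom g = w ∧ ∃ (h : u = L.map (g • L.pt)) (δ : Path L.pt (g • L.pt)),
      ((δ.map L.map.continuous).cast rfl h).Homotopic γ := by
  obtain ⟨ε, hε, hball⟩ : ∃ ε > 0, ∀ s, Metric.ball (γ s).1 ε ⊆ K.hypComp := by
    have hc : IsCompact (Set.range fun s => (γ s).1) := isCompact_range (by fun_prop)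
    obtain ⟨ε, hε, h⟩ := hc.exists_thickening_subset_open Chamber.isOpen_hypComp (by
      rintro _ ⟨s, rfl⟩; exact (γ s).2)
    refine ⟨ε, hε, fun s q hq => h ?_⟩
    rw [Metric.mem_thickening_iff]
    exact ⟨_, ⟨s, rfl⟩, hq⟩
  obtain ⟨δ, hδ, hunif⟩ := Metric.uniformContinuous_iff.1
    (CompactSpace.uniformContinuous_of_continuous γ.continuous) (ε / 2) (half_pos hε)
  have hpt : (L.map L.pt).1.1 ∈ K.reg := fun r hr => (L.pt_mem r hr).ne'
  let η : ∀ s, Path.Homotopic.Quotient (L.map L.pt) (γ s) := fun s =>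
    Path.Homotopic.Quotient.mk ((γ.subpath 0 s).cast γ.source.symm rfl)
  let P : unitInterval → Prop := fun s => ∃ v : K.hypComp, v.1.1 ∈ K.reg ∧
    dist v.1 (γ s).1 < ε / 2 ∧ ∃ f : Path (γ s) v, (∀ s', (f s').1 ∈ Metric.ball (γ s).1 ε) ∧
      L.Accessible ((η s).trans (Path.Homotopic.Quotient.mk f))
  have hP0 : P 0 := by
    refine ⟨L.map L.pt, hpt, by rw [γ.source, dist_self]; exact half_pos hε,
      (Path.refl _).cast γ.source rfl, fun s => ?_, ?_⟩
    · simp [γ.source, hε]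
    · have : (η 0).trans (Path.Homotopic.Quotient.mk ((Path.refl _).cast γ.source rfl))
          = Path.Homotopic.Quotient.refl (L.map L.pt) := by
        rw [← Path.Homotopic.Quotient.mk_trans, ← Path.Homotopic.Quotient.mk_refl]
        congr 1
        refine Path.ext (funext fun s => ?_)
        rw [Path.trans_apply]
        split_ifs <;> simp
      rw [this]
      exact accessible_refl
  have hhalf : ε / 2 ≤ ε := by linarith
  have hP : ∀ s t, dist s t < δ → P s → P t := by
    rintro s t hst ⟨v, hv, hvs, f, hf, hacc⟩
    have hst' : dist (γ s).1 (γ t).1 < ε / 2 := hunif hst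
    obtain ⟨v', hv', hgen, hdist, -⟩ := Chamber.exists_near_generic hv (γ t).1 (half_pos hε)
    have hv't : v' ∈ Metric.ball (γ t).1 ε := Metric.mem_ball.2 (hdist.trans_le hhalf)
    have hv's : v' ∈ Metric.ball (γ s).1 ε := by
      rw [Metric.mem_ball]
      calc dist v' (γ s).1 ≤ dist v' (γ t).1 + dist (γ t).1 (γ s).1 := dist_triangle _ _ _
        _ < ε / 2 + ε / 2 := add_lt_add hdist (by rwa [dist_comm])
        _ = ε := add_halves ε
    have hvs' : v.1 ∈ Metric.ball (γ s).1 ε := Metric.mem_ball.2 (hvs.trans_le hhalf)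
    have hts : (γ t).1 ∈ Metric.ball (γ s).1 ε := by
      rw [Metric.mem_ball, dist_comm]; exact hst'.trans_le hhalf
    set v'' : K.hypComp := ⟨v', hball t hv't⟩ with hv''
    obtain ⟨f₁, hf₁⟩ := exists_path_of_convex (convex_ball (γ t).1 ε) (hball t) (γ t) v''
      (Metric.mem_ball_self hε) hv't
    have hsegb : segment ℝ v.1 v' ⊆ Metric.ball (γ s).1 ε :=
      (convex_ball _ _).segment_subset hvs' hv's
    obtain ⟨f₂, hf₂⟩ := exists_path_of_convex (convex_segment v.1 v') (hsegb.trans (hball s)) v v''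
      (left_mem_segment _ _ _) (right_mem_segment _ _ _)
    have hacc2 := hacc.trans_of_segment f₂ (hsegb.trans (hball s)) hf₂ hv hv' hgen
    refine ⟨v'', hv', hdist, f₁, hf₁, ?_⟩
    -- the two ways around the small loop agree
    obtain ⟨f₁', hf₁'⟩ := exists_path_of_convex
      ((convex_segment (γ t).1 v')) (((convex_ball _ _).segment_subset
        (Metric.mem_ball_self hε) hv't).trans (hball t)) (γ t) v''
      (left_mem_segment _ _ _) (right_mem_segment _ _ _)
    have h1 : f₁.Homotopic f₁' := homotopic_of_starConvex
      ((convex_ball (γ t).1 ε).starConvex (Metric.mem_ball_self hε)) (hball t) _ _ hf₁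
      fun s' => ((convex_ball _ _).segment_subset (Metric.mem_ball_self hε) hv't) (hf₁' s')
    have h2 : (f.trans f₂).Homotopic ((γ.subpath s t).trans f₁') := by
      refine homotopic_of_starConvex
        ((convex_ball (γ s).1 ε).starConvex (Metric.mem_ball_self hε)) (hball s) _ _
        (fun s' => ?_) fun s' => ?_
      · rw [Path.trans_apply]
        split_ifs
        · exact hf _
        · exact hsegb (hf₂ _)
      · rw [Path.trans_apply]
        split_ifs
        · have hmem : ∀ s', γ.subpath s t s' ∈ γ '' Set.uIcc s t := fun s' => by
            rw [← Path.range_subpath]; exact ⟨s', rfl⟩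
          obtain ⟨a, ha, hEq⟩ := hmem ⟨2 * (s' : ℝ), (unitInterval.mul_pos_mem_iff zero_lt_two).2
            ⟨s'.2.1, by assumption⟩⟩
          rw [← hEq, Metric.mem_ball]
          refine LT.lt.trans_le (b := ε / 2) ?_ hhalf
          apply hunif
          refine lt_of_le_of_lt ?_ hst
          rw [dist_comm, Subtype.dist_eq, Subtype.dist_eq]
          have ha' : (a : ℝ) ∈ Set.uIcc (s : ℝ) (t : ℝ) := by
            rcases le_total s t with h | h
            · rw [Set.uIcc_of_le h] at ha
              rw [Set.uIcc_of_le (show (s : ℝ) ≤ t from h)]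
              exact ha
            · rw [Set.uIcc_of_ge h] at ha
              rw [Set.uIcc_of_ge (show (t : ℝ) ≤ s from h)]
              exact ha
          rw [Real.dist_eq, Real.dist_eq, abs_sub_comm (s : ℝ) a, abs_sub_comm (s : ℝ) t]
          exact Set.abs_sub_left_of_mem_uIcc ha'
        · exact ((convex_ball _ _).segment_subset hts hv's) (hf₁' _)
    have h3 : η t = (η s).trans (Path.Homotopic.Quotient.mk (γ.subpath s t)) := by
      rw [← Path.Homotopic.Quotient.mk_trans]
      exact Path.Homotopic.Quotient.eq.2
        (⟨(Path.Homotopy.subpathTransSubpath γ 0 s t).symm.pathCast γ.source.symm rfl⟩)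
    rw [h3, Path.Homotopic.Quotient.eq.2 h1, Path.Homotopic.Quotient.trans_assoc,
      ← Path.Homotopic.Quotient.mk_trans, ← Path.Homotopic.Quotient.eq.2 h2,
      Path.Homotopic.Quotient.mk_trans, ← Path.Homotopic.Quotient.trans_assoc]
    exact hacc2
  obtain ⟨v, hv, hv1, f, hf, hacc⟩ := unitInterval_induction hP0 hδ hP 1
  have hureg : (γ 1).1.1 ∈ K.reg := by
    rw [γ.target, hu]
    exact Chamber.reg_smul hw hpt
  obtain ⟨v', hv', hgen, hdist, hch⟩ := Chamber.exists_near_generic hv (γ 1).1 hε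
  have hch := hch hureg
  have huu : (γ 1).1 ∈ K.chSet (γ 1).1.1 := fun r hr => mul_self_pos.2 (hureg r hr)
  have hvb : v.1 ∈ Metric.ball (γ 1).1 ε := Metric.mem_ball.2 (hv1.trans_le hhalf)
  set v'' : K.hypComp := ⟨v', hball 1 (Metric.mem_ball.2 hdist)⟩ with hv''
  have hsegb : segment ℝ v.1 v' ⊆ Metric.ball (γ 1).1 ε :=
    (convex_ball _ _).segment_subset hvb (Metric.mem_ball.2 hdist)
  obtain ⟨f₂, hf₂⟩ := exists_path_of_convex (convex_segment v.1 v') (hsegb.trans (hball 1)) v v''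
    (left_mem_segment _ _ _) (right_mem_segment _ _ _)
  have hsegc : segment ℝ v' (γ 1).1 ⊆ K.chSet (γ 1).1.1 :=
    (Chamber.convex_chSet _).segment_subset hch huu
  obtain ⟨f₃, hf₃⟩ := exists_path_of_convex (convex_segment v' (γ 1).1)
    (hsegc.trans (Chamber.chSet_subset _)) v'' (γ 1)
    (left_mem_segment _ _ _) (right_mem_segment _ _ _)
  have hacc3 := (hacc.trans_of_segment f₂ (hsegb.trans (hball 1)) hf₂ hv hv' hgen).trans_of_chSet
    f₃ hch fun s => hsegc (hf₃ s)
  have h1 : ((f.trans f₂).trans f₃).Homotopic (Path.refl (γ 1)) := by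
    refine homotopic_of_starConvex
      ((convex_ball (γ 1).1 ε).starConvex (Metric.mem_ball_self hε)) (hball 1) _ _
      (fun s' => ?_) fun s' => ?_
    · rw [Path.trans_apply]
      split_ifs
      · rw [Path.trans_apply]
        split_ifs
        · exact hf _
        · exact hsegb (hf₂ _)
      · exact ((convex_ball _ _).segment_subset (Metric.mem_ball.2 hdist)
          (Metric.mem_ball_self hε)) (hf₃ _)
    · exact Metric.mem_ball_self hε
  have h2 : (((η 1).trans (Path.Homotopic.Quotient.mk f)).trans
      (Path.Homotopic.Quotient.mk f₂)).trans (Path.Homotopic.Quotient.mk f₃) = η 1 := by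
    rw [Path.Homotopic.Quotient.trans_assoc, Path.Homotopic.Quotient.trans_assoc,
      ← Path.Homotopic.Quotient.trans_assoc (Path.Homotopic.Quotient.mk f),
      ← Path.Homotopic.Quotient.mk_trans, ← Path.Homotopic.Quotient.mk_trans,
      Path.Homotopic.Quotient.eq.2 h1, Path.Homotopic.Quotient.mk_refl,
      Path.Homotopic.Quotient.trans_refl]
  rw [h2] at hacc3
  obtain ⟨g, _, rfl, δ', σ, hσ, heq⟩ := hacc3
  have hgw : L.hom g = w := by
    have h3 : u.1 ∈ K.chSet (L.hom g K.base) := by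
      have := hσ 1
      rw [Path.target, γ.target] at this
      exact this
    have h4 : (L.hom g)⁻¹ * w = 1 := by
      refine Chamber.eq_one_of_mem_opn (K := K) (T := {t | K.IsSimple t}) (fun t ht => ht)
        (Chamber.closure_simple hW) L.pt_mem (W.mul_mem (W.inv_mem (L.hom_mem g)) hw) ?_
      intro r hr
      have h5 := (Chamber.mul_form_pos (K := K) hr (W.inv_mem (L.hom_mem g)) (L.hom g K.base)
        u.1.1).2 (h3 _ (reflSet_conj' hr (W.inv_mem (L.hom_mem g))))
      rw [hu, ← LinearEquiv.mul_apply, inv_mul_cancel] at h5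
      exact pos_of_mul_pos_right h5 (K.base_pos r hr).le
    exact (inv_mul_eq_one.1 h4)
  have hend : u = L.map (g • L.pt) := Subtype.ext (by rw [L.equivariant, hgw, hu])
  refine ⟨g, hgw, hend, δ', ?_⟩
  subst hend
  have hσ' : Path.Homotopic (σ.cast rfl γ.target.symm) (Path.refl _) := by
    refine homotopic_of_starConvex (S := K.chSet (L.hom g K.base))
      ((Chamber.convex_chSet _).starConvex (map_smul_pt_mem g)) (Chamber.chSet_subset _) _ _
      (fun s => hσ s) fun s => map_smul_pt_mem g
  have hη : Path.Homotopic ((γ.subpath 0 1).cast γ.source.symm rfl)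
      ((δ'.map L.map.continuous).trans σ) := by
    rw [← Path.Homotopic.Quotient.eq, Path.Homotopic.Quotient.mk_trans]; exact heq
  have hη2 := hη.pathCast rfl γ.target.symm
  have e1 : ((γ.subpath 0 1).cast γ.source.symm rfl).cast rfl γ.target.symm = γ := by
    refine Path.ext (funext fun s => ?_)
    simp
  have e2 : ((δ'.map L.map.continuous).trans σ).cast rfl γ.target.symm
      = (δ'.map L.map.continuous).trans (σ.cast rfl γ.target.symm) := by
    refine Path.ext (funext fun s => ?_)
    simp [Path.trans_apply]
  rw [e1, e2] at hη2
  refine ((hη2.trans ?_)).symm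
  exact ((Path.Homotopic.refl _).hcomp hσ').trans (Path.Homotopic.trans_refl _)

end WallLifting
end

end

section

section Eval

variable {n m : ℕ}

theorem eval_aeval (x : Fin n → ℂ) (q : Fin m → MvPolynomial (Fin n) ℂ)
    (F : MvPolynomial (Fin m) ℂ) : eval x (aeval q F) = eval (pMap q x) F := by
  induction F using MvPolynomial.induction_on with
  | C a => simp
  | add f g hf hg => rw [map_add, map_add, map_add, hf, hg]
  | mul_X f i hf => rw [map_mul, map_mul, map_mul, hf, aeval_X, eval_X, pMap]

theorem eval_matAct (g : Matrix.GeneralLinearGroup (Fin n) ℂ) (f : MvPolynomial (Fin n) ℂ)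
    (x : Fin n → ℂ) :
    eval x (matAct g f) = eval (Matrix.mulVec (↑(g⁻¹) : Matrix (Fin n) (Fin n) ℂ) x) f := by
  rw [matAct, eval_aeval]
  congr 2
  ext i
  simp [pMap, Matrix.mulVec, dotProduct]

theorem inv_mulVec_mulVec (g : Matrix.GeneralLinearGroup (Fin n) ℂ) (x : Fin n → ℂ) :
    Matrix.mulVec (↑(g⁻¹) : Matrix (Fin n) (Fin n) ℂ)
      (Matrix.mulVec (g : Matrix (Fin n) (Fin n) ℂ) x) = x := by
  rw [Matrix.mulVec_mulVec, ← Units.val_mul, inv_mul_cancel, Units.val_one, Matrix.one_mulVec]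

theorem matAct_mul (g h : Matrix.GeneralLinearGroup (Fin n) ℂ) (f : MvPolynomial (Fin n) ℂ) :
    matAct (g * h) f = matAct g (matAct h f) := by
  refine MvPolynomial.funext fun x => ?_
  rw [eval_matAct, eval_matAct, eval_matAct, mul_inv_rev, Units.val_mul, Matrix.mulVec_mulVec]

theorem mem_invariants_iff {G : Subgroup (Matrix.GeneralLinearGroup (Fin n) ℂ)}
    {f : MvPolynomial (Fin n) ℂ} :
    f ∈ invariants G ↔ ∀ g ∈ G, ∀ x,
      eval (Matrix.mulVec (g : Matrix (Fin n) (Fin n) ℂ) x) f = eval x f := by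
  constructor
  · intro h g hg x
    rw [← h g hg, eval_matAct, inv_mulVec_mulVec]
    rw [h g hg]
  · intro h g hg
    refine MvPolynomial.funext fun x => ?_
    rw [eval_matAct]
    exact h _ (G.inv_mem hg) x

theorem constantCoeff_eq_eval_zero (f : MvPolynomial (Fin n) ℂ) :
    constantCoeff f = eval 0 f := by
  rw [MvPolynomial.eval_zero]

end Eval

/-- The derivative of `F` at `q` in the direction `v`. -/
def dirDeriv {n : ℕ} (q v : Fin n → ℂ) : MvPolynomial (Fin n) ℂ →ₗ[ℂ] ℂ :=
  ∑ i, v i • ((aeval q : MvPolynomial (Fin n) ℂ →ₐ[ℂ] ℂ).toLinearMap ∘ₗ (pderiv i).toLinearMap)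

section DirDeriv

variable {n m : ℕ}

theorem dirDeriv_apply (q v : Fin n → ℂ) (F : MvPolynomial (Fin n) ℂ) :
    dirDeriv q v F = ∑ i, v i * eval q (pderiv i F) := by
  simp [dirDeriv, LinearMap.sum_apply, aeval_eq_eval]

@[simp]
theorem dirDeriv_C (q v : Fin n → ℂ) (a : ℂ) : dirDeriv q v (C a) = 0 := by
  simp [dirDeriv_apply]

@[simp]
theorem dirDeriv_X (q v : Fin n → ℂ) (i : Fin n) : dirDeriv q v (X i) = v i := by
  simp [dirDeriv_apply, pderiv_X, Pi.single_apply, apply_ite]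

theorem dirDeriv_mul (q v : Fin n → ℂ) (f g : MvPolynomial (Fin n) ℂ) :
    dirDeriv q v (f * g) = eval q f * dirDeriv q v g + eval q g * dirDeriv q v f := by
  simp only [dirDeriv_apply, pderiv_mul, map_add, map_mul, Finset.mul_sum, ← Finset.sum_add_distrib]
  refine Finset.sum_congr rfl fun i _ => ?_
  ring

theorem dirDeriv_aeval (x τ : Fin n → ℂ) (q : Fin m → MvPolynomial (Fin n) ℂ)
    (F : MvPolynomial (Fin m) ℂ) :
    dirDeriv x τ (aeval q F) = dirDeriv (pMap q x) (fun i => dirDeriv x τ (q i)) F := by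
  induction F using MvPolynomial.induction_on with
  | C a => rw [aeval_C, dirDeriv_C, algebraMap_eq, dirDeriv_C]
  | add f g hf hg => rw [map_add, map_add, map_add, hf, hg]
  | mul_X f i hf =>
    rw [map_mul, aeval_X, dirDeriv_mul, dirDeriv_mul, hf, eval_aeval, dirDeriv_X, eval_X]
    rfl

theorem dirDeriv_matAct (g : Matrix.GeneralLinearGroup (Fin n) ℂ) (f : MvPolynomial (Fin n) ℂ)
    (x τ : Fin n → ℂ) :
    dirDeriv x τ (matAct g f) = dirDeriv (Matrix.mulVec (↑(g⁻¹) : Matrix (Fin n) (Fin n) ℂ) x)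
      (Matrix.mulVec (↑(g⁻¹) : Matrix (Fin n) (Fin n) ℂ) τ) f := by
  rw [matAct, dirDeriv_aeval]
  congr 2 <;> · ext i; simp [pMap, Matrix.mulVec, dotProduct]

theorem dirDeriv_polyAct (M : Fin m → Fin m → ℂ) (f : MvPolynomial (Fin m) ℂ)
    (x τ : Fin m → ℂ) :
    dirDeriv x τ (polyAct M f)
      = dirDeriv (Matrix.mulVec (Matrix.of M) x) (Matrix.mulVec (Matrix.of M) τ) f := by
  rw [polyAct, dirDeriv_aeval]
  congr 2 <;> · ext i; simp [pMap, Matrix.mulVec, dotProduct]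

theorem dirDeriv_add_dir (x τ σ : Fin n → ℂ) (f : MvPolynomial (Fin n) ℂ) :
    dirDeriv x (τ + σ) f = dirDeriv x τ f + dirDeriv x σ f := by
  simp [dirDeriv_apply, add_mul, Finset.sum_add_distrib]

theorem dirDeriv_smul_dir (x τ : Fin n → ℂ) (a : ℂ) (f : MvPolynomial (Fin n) ℂ) :
    dirDeriv x (a • τ) f = a * dirDeriv x τ f := by
  simp [dirDeriv_apply, Finset.mul_sum, mul_assoc]

theorem hasDerivAt_eval (x τ : Fin n → ℂ) (f : MvPolynomial (Fin n) ℂ) (z : ℂ) :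
    HasDerivAt (fun t : ℂ => eval (x + t • τ) f) (dirDeriv (x + z • τ) τ f) z := by
  induction f using MvPolynomial.induction_on with
  | C a => simpa using hasDerivAt_const z a
  | add f g hf hg => simpa using! hf.add hg
  | mul_X f i hf =>
    have h1 : HasDerivAt (fun t : ℂ => x i + t * τ i) (τ i) z := by
      simpa using ((hasDerivAt_id z).mul_const (τ i)).const_add (x i)
    have h2 := hf.mul h1
    simp only [map_mul, eval_X, dirDeriv_mul, dirDeriv_X, Pi.add_apply, Pi.smul_apply, smul_eq_mul]
    refine h2.congr_deriv ?_
    ring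

/-- A polynomial is, to second order, its affine part. -/
theorem mem_ker_eval_sq {x : Fin n → ℂ} {f : MvPolynomial (Fin n) ℂ} (h0 : eval x f = 0)
    (h1 : ∀ τ, dirDeriv x τ f = 0) : f ∈ RingHom.ker (eval x) ^ 2 := by
  have key : ∀ f : MvPolynomial (Fin n) ℂ, f - C (eval x f)
      - ∑ i, C (dirDeriv x (Pi.single i 1) f) * (X i - C (x i)) ∈ RingHom.ker (eval x) ^ 2 := by
    intro f
    induction f using MvPolynomial.induction_on with
    | C a => simp
    | add f g hf hg =>
      have := add_mem hf hg
      simp only [map_add, add_mul, Finset.sum_add_distrib]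
      convert this using 1
      ring
    | mul_X f j hf =>
      have e : f * X j - C (eval x (f * X j))
          - ∑ i, C (dirDeriv x (Pi.single i 1) (f * X j)) * (X i - C (x i))
          = (f - C (eval x f) - ∑ i, C (dirDeriv x (Pi.single i 1) f) * (X i - C (x i))) * X j
            + ∑ i, C (dirDeriv x (Pi.single i 1) f) * ((X i - C (x i)) * (X j - C (x j))) := by
        have e1 : ∑ i, C (dirDeriv x (Pi.single i 1) (f * X j)) * (X i - C (x i))
            = C (eval x f) * (X j - C (x j))
              + C (x j) * ∑ i, C (dirDeriv x (Pi.single i 1) f) * (X i - C (x i)) := by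
          simp only [dirDeriv_mul, dirDeriv_X, eval_X, map_add, map_mul, add_mul,
            Finset.sum_add_distrib, Finset.mul_sum, mul_assoc]
          congr 1
          rw [Finset.sum_eq_single j]
          · simp
          · intro i _ hi
            simp [hi.symm]
          · simp
        have e2 : ∑ i, C (dirDeriv x (Pi.single i 1) f) * ((X i - C (x i)) * (X j - C (x j)))
            = (∑ i, C (dirDeriv x (Pi.single i 1) f) * (X i - C (x i))) * (X j - C (x j)) := by
          simp only [Finset.sum_mul, mul_assoc]
        rw [e1, e2, map_mul, eval_X, C_mul]
        ring
      rw [e]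
      refine add_mem (Ideal.mul_mem_right _ _ hf) (Ideal.sum_mem _ fun i _ =>
        Ideal.mul_mem_left _ _ ?_)
      rw [pow_two]
      exact Ideal.mul_mem_mul (by simp [RingHom.mem_ker]) (by simp [RingHom.mem_ker])
  have := key f
  simpa [h0, h1] using this

end DirDeriv

section Interpolation

variable {n : ℕ}

/-- A linear form separating a point from finitely many others. -/
theorem exists_poly_separating {S : Set (Fin n → ℂ)} (hS : S.Finite) {x : Fin n → ℂ}
    (hx : x ∉ S) : ∃ h : MvPolynomial (Fin n) ℂ, eval x h = 0 ∧ ∀ z ∈ S, eval z h ≠ 0 := by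
  have := hS.to_subtype
  obtain ⟨f, hf⟩ := Module.exists_dual_forall_apply_ne_zero (K := ℂ)
    (fun z : S => (z : Fin n → ℂ) - x) (fun z => sub_ne_zero.2 fun h => hx (h ▸ z.2))
  have hfe : ∀ v, f v = ∑ i, f (Pi.single i 1) * v i := fun v => by
    conv_lhs => rw [← LinearMap.sum_single_apply (fun _ => ℂ) v]
    rw [map_sum]
    refine Finset.sum_congr rfl fun i _ => ?_
    rw [mul_comm, ← smul_eq_mul, ← map_smul, ← Pi.single_smul]
    simp
  refine ⟨∑ i, C (f (Pi.single i 1)) * (X i - C (x i)), by simp, fun z hz => ?_⟩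
  have := hf ⟨z, hz⟩
  rw [hfe] at this
  simpa using this

/-- A polynomial vanishing at finitely many points but not at another given point. -/
theorem exists_poly_vanishing {S : Set (Fin n → ℂ)} (hS : S.Finite) {x : Fin n → ℂ}
    (hx : x ∉ S) : ∃ h : MvPolynomial (Fin n) ℂ, eval x h ≠ 0 ∧ ∀ z ∈ S, eval z h = 0 := by
  obtain ⟨f, hf, hfS⟩ := exists_poly_separating hS hx
  refine ⟨∏ z ∈ hS.toFinset, (f - C (eval z f)), ?_, fun z hz => ?_⟩
  · rw [map_prod, Finset.prod_ne_zero_iff]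
    intro z hz
    simpa [hf] using hfS z (by simpa using hz)
  · rw [map_prod]
    exact Finset.prod_eq_zero (hS.mem_toFinset.2 hz) (by simp)

end Interpolation

end

section

section Invariants

variable {n m : ℕ} {G : Subgroup (Matrix.GeneralLinearGroup (Fin n) ℂ)}

variable (G) in
/-- The sum of the translates of a polynomial under a finite group. -/
def orbitTrace [Fintype G] : MvPolynomial (Fin n) ℂ →ₗ[ℂ] MvPolynomial (Fin n) ℂ :=
  ∑ g : G, (matAct (g : Matrix.GeneralLinearGroup (Fin n) ℂ)).toLinearMap

variable (G) in
/-- The product of the translates of a polynomial under a finite group. -/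
def orbitNorm [Fintype G] (f : MvPolynomial (Fin n) ℂ) : MvPolynomial (Fin n) ℂ :=
  ∏ g : G, matAct (g : Matrix.GeneralLinearGroup (Fin n) ℂ) f

theorem orbitTrace_apply [Fintype G] (f : MvPolynomial (Fin n) ℂ) :
    orbitTrace G f = ∑ g : G, matAct (g : Matrix.GeneralLinearGroup (Fin n) ℂ) f := by
  simp [orbitTrace, LinearMap.sum_apply]

theorem orbitTrace_mem [Fintype G] (f : MvPolynomial (Fin n) ℂ) : orbitTrace G f ∈ invariants G := by
  intro h hh
  rw [orbitTrace_apply, map_sum]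
  simp_rw [← matAct_mul]
  exact Fintype.sum_equiv (Equiv.mulLeft (⟨h, hh⟩ : G))
    (fun g : G => matAct (h * (g : Matrix.GeneralLinearGroup (Fin n) ℂ)) f)
    (fun g : G => matAct (g : Matrix.GeneralLinearGroup (Fin n) ℂ) f)
    fun g => by rw [Equiv.coe_mulLeft, Subgroup.coe_mul]

theorem orbitNorm_mem [Fintype G] (f : MvPolynomial (Fin n) ℂ) : orbitNorm G f ∈ invariants G := by
  intro h hh
  rw [orbitNorm, map_prod]
  simp_rw [← matAct_mul]
  exact Fintype.prod_equiv (Equiv.mulLeft (⟨h, hh⟩ : G))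
    (fun g : G => matAct (h * (g : Matrix.GeneralLinearGroup (Fin n) ℂ)) f)
    (fun g : G => matAct (g : Matrix.GeneralLinearGroup (Fin n) ℂ) f)
    fun g => by rw [Equiv.coe_mulLeft, Subgroup.coe_mul]

theorem orbitTrace_mul_of_mem [Fintype G] {f : MvPolynomial (Fin n) ℂ} (hf : f ∈ invariants G)
    (h : MvPolynomial (Fin n) ℂ) : orbitTrace G (h * f) = orbitTrace G h * f := by
  rw [orbitTrace_apply, orbitTrace_apply, Finset.sum_mul]
  refine Finset.sum_congr rfl fun g _ => ?_
  rw [map_mul, hf g g.2]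

/-- Invariants of a finite group separate its orbits. -/
theorem exists_mulVec_eq_of_eval_eq [Finite G] {x y : Fin n → ℂ}
    (h : ∀ f ∈ invariants G, eval x f = eval y f) :
    ∃ g ∈ G, Matrix.mulVec (g : Matrix (Fin n) (Fin n) ℂ) x = y := by
  have := Fintype.ofFinite G
  by_contra! hne
  have hfin : (Set.range fun g : G =>
      Matrix.mulVec ((g : Matrix.GeneralLinearGroup (Fin n) ℂ) : Matrix (Fin n) (Fin n) ℂ) x).Finite :=
    Set.finite_range _
  obtain ⟨f, hf, hf'⟩ := exists_poly_separating hfin (x := y) (by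
    rintro ⟨g, hg⟩; exact hne g g.2 hg)
  have h1 := (h _ (orbitNorm_mem (G := G) f)).symm
  rw [orbitNorm, map_prod, map_prod, Finset.prod_eq_zero (i := 1) (Finset.mem_univ _) (by
    rw [eval_matAct]; simpa using hf), eq_comm, Finset.prod_eq_zero_iff] at h1
  obtain ⟨g, -, hg⟩ := h1
  rw [eval_matAct] at hg
  exact hf' _ ⟨g⁻¹, rfl⟩ hg

/-- The rest of the orbit of a point. -/
def punctOrbit (G : Subgroup (Matrix.GeneralLinearGroup (Fin n) ℂ)) (x : Fin n → ℂ) :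
    Set (Fin n → ℂ) :=
  {z | ∃ g ∈ G, g ≠ 1 ∧ Matrix.mulVec (g : Matrix (Fin n) (Fin n) ℂ) x = z}

theorem finite_punctOrbit [Finite G] (x : Fin n → ℂ) : (punctOrbit G x).Finite := by
  refine (Set.finite_range fun g : G =>
      Matrix.mulVec ((g : Matrix.GeneralLinearGroup (Fin n) ℂ) : Matrix (Fin n) (Fin n) ℂ) x).subset ?_
  rintro z ⟨g, hg, -, rfl⟩
  exact ⟨⟨g, hg⟩, rfl⟩

/-- Triviality of the stabilizer in `G`. -/
def FreeAt (G : Subgroup (Matrix.GeneralLinearGroup (Fin n) ℂ)) (x : Fin n → ℂ) : Prop :=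
  ∀ g ∈ G, Matrix.mulVec (g : Matrix (Fin n) (Fin n) ℂ) x = x → g = 1

theorem FreeAt.notMem {x : Fin n → ℂ} (hx : FreeAt G x) : x ∉ punctOrbit G x := by
  rintro ⟨g, hg, hg1, h⟩
  exact hg1 (hx g hg h)

theorem eval_orbitTrace_of_vanishing [Fintype G] {x : Fin n → ℂ} {f : MvPolynomial (Fin n) ℂ}
    (hf : ∀ z ∈ punctOrbit G x, eval z f = 0) : eval x (orbitTrace G f) = eval x f := by
  rw [orbitTrace_apply, map_sum, Finset.sum_eq_single 1]
  · rw [eval_matAct]; simp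
  · intro g _ hg
    rw [eval_matAct]
    exact hf _ ⟨g⁻¹, g⁻¹.2, by simpa using hg, rfl⟩
  · simp

/-- The invariant functions have nonzero differential at points with trivial stabilizer. -/
theorem exists_invariant_dirDeriv_ne_zero [Finite G] {x : Fin n → ℂ} (hx : FreeAt G x)
    {τ : Fin n → ℂ} (hτ : τ ≠ 0) : ∃ f ∈ invariants G, dirDeriv x τ f ≠ 0 := by
  have := Fintype.ofFinite G
  obtain ⟨e, he, he'⟩ := exists_poly_vanishing (finite_punctOrbit (G := G) x) hx.notMem
  obtain ⟨i, hi⟩ := Function.ne_iff.1 hτ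
  let f := e * (e * (X i - C (x i)))
  refine ⟨orbitTrace G f, orbitTrace_mem _, ?_⟩
  rw [orbitTrace_apply, map_sum, Finset.sum_eq_single 1]
  · rw [dirDeriv_matAct]
    have : dirDeriv x τ f = eval x e * (eval x e * τ i) := by
      simp [f, dirDeriv_mul]
    simpa [this, he] using hi
  · intro g _ hg
    have h0 := he' _ ⟨g⁻¹, g⁻¹.2, by simpa using hg, rfl⟩
    rw [dirDeriv_matAct]
    simp only [f, dirDeriv_mul, h0, map_mul, zero_mul, add_zero]
  · simp

theorem exists_mul_mem_span_invariants [Finite G] {x : Fin n → ℂ} (hx : FreeAt G x)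
    {b : MvPolynomial (Fin n) ℂ} (hb : eval x b = 0) :
    ∃ e, eval x e ≠ 0 ∧ e * b ∈ Ideal.span {f | f ∈ invariants G ∧ eval x f = 0} := by
  classical
  have := Fintype.ofFinite G
  have key : ∀ b : MvPolynomial (Fin n) ℂ, eval x b = 0 → (∀ z ∈ punctOrbit G x, eval z b ≠ 0) →
      ∃ e, eval x e ≠ 0 ∧ e * b ∈ Ideal.span {f | f ∈ invariants G ∧ eval x f = 0} := by
    intro b hb hb'
    refine ⟨∏ g ∈ Finset.univ.erase (1 : G),
      matAct (g : Matrix.GeneralLinearGroup (Fin n) ℂ) b, ?_, ?_⟩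
    · rw [map_prod, Finset.prod_ne_zero_iff]
      intro g hg
      rw [eval_matAct]
      exact hb' _ ⟨g⁻¹, g⁻¹.2, by simpa using hg, rfl⟩
    · have h1 : matAct ((1 : G) : Matrix.GeneralLinearGroup (Fin n) ℂ) b = b :=
        MvPolynomial.funext fun z => by rw [eval_matAct]; simp
      have h2 : (∏ g ∈ Finset.univ.erase (1 : G),
          matAct (g : Matrix.GeneralLinearGroup (Fin n) ℂ) b) * b = orbitNorm G b := by
        conv_lhs => enter [2]; rw [← h1]
        rw [Finset.prod_erase_mul _ _ (Finset.mem_univ _), orbitNorm]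
      rw [h2]
      refine Ideal.subset_span ⟨orbitNorm_mem b, ?_⟩
      rw [← h2, map_mul, hb, mul_zero]
  obtain ⟨h, hh, hh'⟩ := exists_poly_separating (finite_punctOrbit (G := G) x) hx.notMem
  obtain ⟨a, ha⟩ := (((finite_punctOrbit (G := G) x).image
    fun z => -eval z b / eval z h).union (Set.finite_singleton 0)).exists_notMem
  simp only [Set.mem_union, Set.mem_image, Set.mem_singleton_iff, not_or, not_exists, not_and] at ha
  obtain ⟨e₁, he₁, hm₁⟩ := key (b + C a * h) (by simp [hb, hh]) fun z hz h0 => ha.1 z hz (by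
    have := hh' z hz
    rw [div_eq_iff this]
    simp only [map_add, map_mul, eval_C] at h0
    linear_combination -h0)
  obtain ⟨e₂, he₂, hm₂⟩ := key (-(C a * h)) (by simp [hh]) fun z hz => by
    simpa using ⟨ha.2, hh' z hz⟩
  refine ⟨e₁ * e₂, by simp [he₁, he₂], ?_⟩
  have : e₁ * e₂ * b = e₂ * (e₁ * (b + C a * h)) + e₁ * (e₂ * -(C a * h)) := by ring
  rw [this]
  exact add_mem (Ideal.mul_mem_left _ _ hm₁) (Ideal.mul_mem_left _ _ hm₂)

/-- At points with trivial stabilizer, a point derivation of the invariant algebra kills the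
invariants vanishing to second order. -/
theorem pointDerivation_eq_zero [Finite G] {x : Fin n → ℂ} (hx : FreeAt G x)
    (D : invariants G →ₗ[ℂ] ℂ)
    (hD : ∀ a b : invariants G, D (a * b) = eval x a.1 * D b + eval x b.1 * D a)
    {u : invariants G} (hu : u.1 ∈ RingHom.ker (eval x) ^ 2) : D u = 0 := by
  have := Fintype.ofFinite G
  set N : Ideal (MvPolynomial (Fin n) ℂ) := Ideal.span {f | f ∈ invariants G ∧ eval x f = 0}
    with hN
  have h1 : ∀ f ∈ RingHom.ker (eval x) ^ 2, ∃ e, eval x e ≠ 0 ∧ e * f ∈ N * N := by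
    intro f hf
    rw [pow_two] at hf
    refine Submodule.mul_induction_on hf (fun a ha b hb => ?_) fun a b ha hb => ?_
    · obtain ⟨e₁, he₁, hm₁⟩ := exists_mul_mem_span_invariants hx ha
      obtain ⟨e₂, he₂, hm₂⟩ := exists_mul_mem_span_invariants hx hb
      refine ⟨e₁ * e₂, by simp [he₁, he₂], ?_⟩
      rw [mul_mul_mul_comm]
      exact Ideal.mul_mem_mul hm₁ hm₂
    · obtain ⟨e₁, he₁, hm₁⟩ := ha
      obtain ⟨e₂, he₂, hm₂⟩ := hb
      refine ⟨e₁ * e₂, by simp [he₁, he₂], ?_⟩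
      have : e₁ * e₂ * (a + b) = e₂ * (e₁ * a) + e₁ * (e₂ * b) := by ring
      rw [this]
      exact add_mem (Ideal.mul_mem_left _ _ hm₁) (Ideal.mul_mem_left _ _ hm₂)
  let T : MvPolynomial (Fin n) ℂ →ₗ[ℂ] ℂ :=
    D ∘ₗ (orbitTrace G).codRestrict (Subalgebra.toSubmodule (invariants G)) orbitTrace_mem
  have hT : ∀ f (hf : f ∈ invariants G) h, T (h * f)
      = eval x (orbitTrace G h) * D ⟨f, hf⟩ + eval x f * T h := by
    intro f hf h
    refine Eq.trans ?_ (hD ⟨orbitTrace G h, orbitTrace_mem h⟩ ⟨f, hf⟩)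
    exact congrArg D (Subtype.ext (orbitTrace_mul_of_mem hf h))
  have h2 : ∀ f ∈ N * N, ∀ h, T (h * f) = 0 := by
    intro f hf
    rw [hN, Ideal.span_mul_span'] at hf
    refine Submodule.span_induction (fun q hq h => ?_) (by simp) (fun a b _ _ ha hb h => ?_)
      (fun c f _ hc h => ?_) hf
    · obtain ⟨a, ⟨ha, ha0⟩, b, ⟨hb, hb0⟩, rfl⟩ := Set.mem_mul.1 hq
      rw [hT _ (mul_mem ha hb)]
      have := hD ⟨a, ha⟩ ⟨b, hb⟩
      simp only [ha0, hb0, zero_mul, add_zero] at this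
      have e : (⟨a * b, mul_mem ha hb⟩ : invariants G) = ⟨a, ha⟩ * ⟨b, hb⟩ := rfl
      rw [e, this]
      simp [ha0]
    · rw [mul_add, map_add, ha, hb, add_zero]
    · rw [smul_eq_mul, ← mul_assoc]; exact hc _
  obtain ⟨e, he, hm⟩ := h1 _ hu
  obtain ⟨h, hh, hh'⟩ := exists_poly_vanishing (finite_punctOrbit (G := G) x) hx.notMem
  have h3 := h2 _ hm h
  have hu0 : eval x u.1 = 0 := Ideal.pow_le_self two_ne_zero hu
  rw [← mul_assoc, hT _ u.2, hu0, zero_mul, add_zero,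
    eval_orbitTrace_of_vanishing (fun z hz => by rw [map_mul, hh' z hz, zero_mul]), map_mul] at h3
  exact (mul_eq_zero.1 h3).resolve_left (mul_ne_zero hh he)

end Invariants

end

section

section Generators

variable {n m : ℕ} {G : Subgroup (Matrix.GeneralLinearGroup (Fin n) ℂ)}
  {q : Fin m → MvPolynomial (Fin n) ℂ}

/-- The differential of `pMap`. -/
def dpMap (q : Fin m → MvPolynomial (Fin n) ℂ) (x τ : Fin n → ℂ) : Fin m → ℂ :=
  fun i => dirDeriv x τ (q i)

theorem exists_aeval_eq (hq : Algebra.adjoin ℂ (Set.range q) = invariants G)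
    {f : MvPolynomial (Fin n) ℂ} (hf : f ∈ invariants G) : ∃ F : MvPolynomial (Fin m) ℂ, aeval q F = f := by
  rw [← hq, Algebra.adjoin_range_eq_range_aeval] at hf
  exact hf

theorem aeval_mem_invariants (hq : Algebra.adjoin ℂ (Set.range q) = invariants G)
    (F : MvPolynomial (Fin m) ℂ) : aeval q F ∈ invariants G := by
  rw [← hq, Algebra.adjoin_range_eq_range_aeval]
  exact ⟨F, rfl⟩

theorem exists_mulVec_eq_of_pMap_eq [Finite G]
    (hq : Algebra.adjoin ℂ (Set.range q) = invariants G) {x y : Fin n → ℂ}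
    (h : pMap q x = pMap q y) : ∃ g ∈ G, Matrix.mulVec (g : Matrix (Fin n) (Fin n) ℂ) x = y := by
  refine exists_mulVec_eq_of_eval_eq fun f hf => ?_
  obtain ⟨F, rfl⟩ := exists_aeval_eq hq hf
  rw [eval_aeval, eval_aeval, h]

theorem dpMap_ne_zero [Finite G] (hq : Algebra.adjoin ℂ (Set.range q) = invariants G)
    {x τ : Fin n → ℂ} (hx : FreeAt G x) (hτ : τ ≠ 0) : dpMap q x τ ≠ 0 := by
  obtain ⟨f, hf, hf'⟩ := exists_invariant_dirDeriv_ne_zero hx hτ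
  obtain ⟨F, rfl⟩ := exists_aeval_eq hq hf
  intro h
  rw [dirDeriv_aeval, show (fun i => dirDeriv x τ (q i)) = 0 from h, dirDeriv_apply] at hf'
  simp at hf'

end Generators

section Setup

variable {n m : ℕ} {Wt : Subgroup (Matrix.GeneralLinearGroup (Fin n) ℂ)}
  {p : Fin m → MvPolynomial (Fin n) ℂ} {c : ↥Wt → Fin m → Fin m → ℂ}

theorem pMap_mulVec (h : ∀ (w : ↥Wt) (i), matAct (w : Matrix.GeneralLinearGroup (Fin n) ℂ) (p i)
      = ∑ j, c w i j • p j) (w : ↥Wt) (x : Fin n → ℂ) :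
    pMap p (Matrix.mulVec (matOf w) x) = Matrix.mulVec (qMat c w) (pMap p x) := by
  ext i
  have h1 := congrArg (eval x) (h w⁻¹ i)
  rw [eval_matAct] at h1
  simp only [InvMemClass.coe_inv, inv_inv] at h1
  rw [pMap, matOf, h1]
  simp [qMat, Matrix.mulVec, dotProduct, pMap]

theorem dpMap_mulVec (h : ∀ (w : ↥Wt) (i), matAct (w : Matrix.GeneralLinearGroup (Fin n) ℂ) (p i)
      = ∑ j, c w i j • p j) (w : ↥Wt) (x τ : Fin n → ℂ) :
    dpMap p (Matrix.mulVec (matOf w) x) (Matrix.mulVec (matOf w) τ)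
      = Matrix.mulVec (qMat c w) (dpMap p x τ) := by
  ext i
  have h1 := congrArg (dirDeriv x τ) (h w⁻¹ i)
  rw [dirDeriv_matAct] at h1
  simp only [InvMemClass.coe_inv, inv_inv] at h1
  rw [dpMap, matOf, h1]
  simp [qMat, Matrix.mulVec, dotProduct, dpMap]

variable {G : Subgroup (Matrix.GeneralLinearGroup (Fin n) ℂ)} {d : Fin m → ℕ}

namespace QuotSetup

theorem finite_G (h : QuotSetup Wt G p d c) : Finite G := (h.finite.subset h.le).to_subtype

theorem finite_Wt (h : QuotSetup Wt G p d c) : Finite Wt := h.finite.to_subtype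

theorem eq_zero_of_dotProduct (h : QuotSetup Wt G p d c) {a : Fin m → ℂ}
    (ha : ∀ x, a ⬝ᵥ pMap p x = 0) : a = 0 := by
  refine h.minimal a ?_
  convert zero_mem (sqSpan G)
  refine MvPolynomial.funext fun x => ?_
  simpa [dotProduct, pMap] using ha x

theorem matrix_ext (h : QuotSetup Wt G p d c) {A B : Matrix (Fin m) (Fin m) ℂ}
    (hAB : ∀ x, A.mulVec (pMap p x) = B.mulVec (pMap p x)) : A = B := by
  ext i j
  have := h.eq_zero_of_dotProduct (a := A i - B i) fun x => by
    rw [sub_dotProduct]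
    exact sub_eq_zero.2 (congrFun (hAB x) i)
  exact sub_eq_zero.1 (congrFun this j)

/-- The linear action of `Wt` on `V`. -/
def qHom (h : QuotSetup Wt G p d c) : ↥Wt →* Matrix (Fin m) (Fin m) ℂ where
  toFun := qMat c
  map_one' := h.matrix_ext fun x => by
    rw [← pMap_mulVec h.equivar]; simp [matOf]
  map_mul' a b := h.matrix_ext fun x => by
    rw [← pMap_mulVec h.equivar, ← Matrix.mulVec_mulVec, ← pMap_mulVec h.equivar,
      ← pMap_mulVec h.equivar]
    simp [matOf]

theorem qMat_eq_one (h : QuotSetup Wt G p d c) {w : ↥Wt} (hw : (w : Matrix.GeneralLinearGroup (Fin n) ℂ) ∈ G) : qMat c w = 1 := by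
  refine h.matrix_ext fun x => ?_
  rw [← pMap_mulVec h.equivar, Matrix.one_mulVec]
  ext i
  have h1 : p i ∈ invariants G := h.gen ▸ Algebra.subset_adjoin ⟨i, rfl⟩
  exact mem_invariants_iff.1 h1 _ hw x

theorem exists_mulVec_eq (h : QuotSetup Wt G p d c) {x y : Fin n → ℂ}
    (hxy : pMap p x = pMap p y) :
    ∃ g ∈ G, Matrix.mulVec (g : Matrix (Fin n) (Fin n) ℂ) x = y :=
  have := h.finite_G
  exists_mulVec_eq_of_pMap_eq h.gen hxy

theorem mem_of_qMat_eq_one (h : QuotSetup Wt G p d c) {w : ↥Wt} (hw : qMat c w = 1) :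
    (w : Matrix.GeneralLinearGroup (Fin n) ℂ) ∈ G := by
  have := h.finite_G
  by_contra hwG
  obtain ⟨x, hx⟩ := Submodule.exists_forall_notMem_of_forall_ne_top (K := ℂ)
    (fun g : G => LinearMap.ker (Matrix.toLin'
      ((g : Matrix.GeneralLinearGroup (Fin n) ℂ) : Matrix (Fin n) (Fin n) ℂ)
        - Matrix.toLin' (matOf w))) (fun g htop => by
      rw [LinearMap.ker_eq_top, sub_eq_zero] at htop
      have h1 := Matrix.toLin'.injective htop
      exact hwG (Units.ext h1 ▸ g.2))
  obtain ⟨g, hg, hgx⟩ := h.exists_mulVec_eq (x := x) (y := Matrix.mulVec (matOf w) x)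
    (by rw [pMap_mulVec h.equivar, hw, Matrix.one_mulVec])
  refine hx ⟨g, hg⟩ ?_
  rw [LinearMap.mem_ker, LinearMap.sub_apply, Matrix.toLin'_apply, Matrix.toLin'_apply, hgx,
    sub_self]

theorem pMap_zero (h : QuotSetup Wt G p d c) : pMap p 0 = 0 := by
  ext i
  rw [pMap, ← constantCoeff_eq_eval_zero]
  by_contra h0
  have := (h.homog i) (d := 0) (by simpa [constantCoeff_eq] using h0)
  simp at this
  exact (h.dpos i).ne this

open Filter Topology in
/-- Near the origin, anti-invariant tangent vectors of `V` at invariant points of the image of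
`p` are tangent to it. -/
theorem eventually_dirDeriv_eq_zero (htc : TrivialConormal Wt p c) (w : ↥Wt) :
    ∀ᶠ q in 𝓝 (0 : Fin m → ℂ), ∀ v, (∀ f ∈ relIdeal p, eval q f = 0) →
      Matrix.mulVec (Matrix.of (c w)) q = q → Matrix.mulVec (Matrix.of (c w)) v = -v →
      ∀ f ∈ relIdeal p, dirDeriv q v f = 0 := by
  obtain ⟨s, hs⟩ := (isNoetherianRing_iff_ideal_fg _).1 inferInstance (relIdeal p)
  have hmem : ∀ f : s, (f : MvPolynomial (Fin m) ℂ) ∈ relIdeal p := fun f =>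
    hs ▸ Ideal.subset_span f.2
  have h1 : ∀ f : s, ∃ a : s → MvPolynomial (Fin m) ℂ, (∀ g, a g ∈ idealPlus ℂ m) ∧
      polyAct (c w) f - f = ∑ g, a g * g := by
    intro f
    have h2 := htc w f (hmem f)
    rw [← hs, ← smul_eq_mul, Ideal.span, ← Subtype.range_coe (s := (s : Set (MvPolynomial (Fin m) ℂ))),
      Submodule.mem_ideal_smul_span_iff_exists_sum] at h2
    obtain ⟨a, ha, ha'⟩ := h2
    refine ⟨a, ha, ?_⟩
    rw [← ha', Finsupp.sum_fintype _ _ (by simp)]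
    rfl
  choose a ha ha' using h1
  have h0 : ∀ f g, eval 0 (a f g) = 0 := fun f g => by
    have h2 : idealPlus ℂ m ≤ RingHom.ker (eval (0 : Fin m → ℂ)) := by
      rw [idealPlus, Ideal.span_le]
      rintro _ ⟨i, rfl⟩
      simp [RingHom.mem_ker]
    exact h2 (ha f g)
  have hsmall : ∀ᶠ q in 𝓝 (0 : Fin m → ℂ), ∀ f, ∑ g, ‖eval q (a f g)‖ < 1 := by
    rw [eventually_all]
    intro f
    have hc : Continuous fun q : Fin m → ℂ => ∑ g, ‖eval q (a f g)‖ := by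
      refine continuous_finsetSum _ fun g _ => (MvPolynomial.continuous_eval _).norm
    refine hc.continuousAt.eventually (gt_mem_nhds ?_)
    simp only [h0, norm_zero, Finset.sum_const_zero, zero_lt_one]
  filter_upwards [hsmall] with q hq v hI hqw hv
  have hy : ∀ f : s, dirDeriv q v (f : MvPolynomial (Fin m) ℂ) = 0 := by
    rcases isEmpty_or_nonempty s with h | h
    · exact fun f => (IsEmpty.false f).elim
    obtain ⟨f₀, hf₀⟩ := Finite.exists_max fun f : s => ‖dirDeriv q v (f : MvPolynomial (Fin m) ℂ)‖
    have h2 : -2 * dirDeriv q v (f₀ : MvPolynomial (Fin m) ℂ)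
        = ∑ g, eval q (a f₀ g) * dirDeriv q v (g : MvPolynomial (Fin m) ℂ) := by
      have h3 := congrArg (dirDeriv q v) (ha' f₀)
      rw [map_sub, dirDeriv_polyAct, hqw, hv, map_sum, ← neg_one_smul ℂ v,
        dirDeriv_smul_dir] at h3
      rw [show (-2 : ℂ) * dirDeriv q v (f₀ : MvPolynomial (Fin m) ℂ)
        = -1 * dirDeriv q v (f₀ : MvPolynomial (Fin m) ℂ) - dirDeriv q v f₀ by ring, h3]
      refine Finset.sum_congr rfl fun g _ => ?_
      rw [dirDeriv_mul, hI g (hmem g), zero_mul, add_zero]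
    have h3 : 2 * ‖dirDeriv q v (f₀ : MvPolynomial (Fin m) ℂ)‖
        ≤ (∑ g, ‖eval q (a f₀ g)‖) * ‖dirDeriv q v (f₀ : MvPolynomial (Fin m) ℂ)‖ := by
      calc 2 * ‖dirDeriv q v (f₀ : MvPolynomial (Fin m) ℂ)‖
          = ‖-2 * dirDeriv q v (f₀ : MvPolynomial (Fin m) ℂ)‖ := by simp
        _ ≤ ∑ g, ‖eval q (a f₀ g) * dirDeriv q v (g : MvPolynomial (Fin m) ℂ)‖ := by
          rw [h2]; exact norm_sum_le _ _
        _ ≤ _ := by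
          rw [Finset.sum_mul]
          refine Finset.sum_le_sum fun g _ => ?_
          rw [norm_mul]
          exact mul_le_mul_of_nonneg_left (hf₀ g) (norm_nonneg _)
    have h4 : ‖dirDeriv q v (f₀ : MvPolynomial (Fin m) ℂ)‖ ≤ 0 := by
      nlinarith [hq f₀, norm_nonneg (dirDeriv q v (f₀ : MvPolynomial (Fin m) ℂ))]
    exact fun f => norm_le_zero_iff.1 ((hf₀ f).trans h4)
  intro f hf
  rw [← hs] at hf
  have h5 : ∀ f ∈ Ideal.span (s : Set (MvPolynomial (Fin m) ℂ)), dirDeriv q v f = 0 := by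
    intro f hf
    refine Submodule.span_induction (p := fun f _ => dirDeriv q v f = 0) (fun f hf => hy ⟨f, hf⟩)
      (map_zero _) (fun a b _ _ ha hb => by rw [map_add, ha, hb, add_zero])
      (fun b f hf hb => ?_) hf
    rw [smul_eq_mul, dirDeriv_mul, hb, hI f (hs ▸ hf), mul_zero, zero_mul, add_zero]
  exact h5 f hf

open Filter Topology in
/-- A reflection of `Wt` outside `G` acts on `V` as a reflection. -/
theorem exists_qMat_eq (h : QuotSetup Wt G p d c) (htc : TrivialConormal Wt p c) {s : ↥Wt}
    (hs : s * s = 1) (hsG : (s : Matrix.GeneralLinearGroup (Fin n) ℂ) ∉ G) {x ρ : Fin n → ℂ} (hx : FreeAt G x)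
    (hsx : (matOf s).mulVec x = x)
    (hdec : ∀ τ, ∃ a : ℂ, (matOf s).mulVec (τ - a • ρ) = τ - a • ρ) :
    ∃ a ℓ : Fin m → ℂ, qMat c s = 1 - Matrix.vecMulVec a ℓ := by
  have := h.finite_G
  set Q := qMat c s with hQ
  have hQQ : Q * Q = 1 := by
    have := (map_mul h.qHom s s).symm
    rwa [hs, map_one] at this
  -- rescale to a point near the origin
  obtain ⟨x, hx, hsx, hsmall⟩ : ∃ x, FreeAt G x ∧ (matOf s).mulVec x = x ∧
      ∀ v, (∀ f ∈ relIdeal p, eval (pMap p x) f = 0) →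
      Matrix.mulVec (Matrix.of (c s⁻¹)) (pMap p x) = pMap p x →
      Matrix.mulVec (Matrix.of (c s⁻¹)) v = -v →
      ∀ f ∈ relIdeal p, dirDeriv (pMap p x) v f = 0 := by
    have hc : Tendsto (fun t : ℂ => pMap p (t • x)) (𝓝[≠] 0) (𝓝 0) := by
      have : Continuous fun t : ℂ => pMap p (t • x) := continuous_pi fun i =>
        (MvPolynomial.continuous_eval (p i)).comp (by fun_prop)
      have h1 := this.tendsto 0
      simp only [zero_smul, h.pMap_zero] at h1
      exact h1.mono_left nhdsWithin_le_nhds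
    obtain ⟨t, ht, ht0⟩ := ((hc.eventually (eventually_dirDeriv_eq_zero htc s⁻¹)).and
      self_mem_nhdsWithin).exists
    refine ⟨t • x, fun g hg hgx => hx g hg ?_, by rw [Matrix.mulVec_smul, hsx], ht⟩
    rw [Matrix.mulVec_smul] at hgx
    exact smul_right_injective _ ht0 hgx
  have hI : ∀ f ∈ relIdeal p, eval (pMap p x) f = 0 := fun f hf => by
    rw [← eval_aeval, show aeval p f = 0 from hf, map_zero]
  have hpx : Q.mulVec (pMap p x) = pMap p x := by
    rw [hQ, ← pMap_mulVec h.equivar, hsx]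
  obtain ⟨σ, hσ⟩ : ∃ σ : invariants G →ₗ[ℂ] MvPolynomial (Fin m) ℂ,
      ∀ b, aeval p (σ b) = b.1 := by
    let φ : MvPolynomial (Fin m) ℂ →ₗ[ℂ] invariants G :=
      ((aeval p : MvPolynomial (Fin m) ℂ →ₐ[ℂ] MvPolynomial (Fin n) ℂ).toLinearMap).codRestrict
        (Subalgebra.toSubmodule (invariants G)) (aeval_mem_invariants h.gen)
    obtain ⟨σ, hσ⟩ := φ.exists_rightInverse_of_surjective (LinearMap.range_eq_top.2 fun b => by
      obtain ⟨F, hF⟩ := exists_aeval_eq h.gen b.2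
      exact ⟨F, Subtype.ext hF⟩)
    exact ⟨σ, fun b => congrArg Subtype.val (LinearMap.congr_fun hσ b)⟩
  have hkey : ∀ ℓ : Fin m → ℂ, Matrix.vecMul ℓ Q = -ℓ → ℓ ⬝ᵥ dpMap p x ρ = 0 → ℓ = 0 := by
    intro ℓ hℓ hℓρ
    have hanti : ∀ v, Q.mulVec v = v → ℓ ⬝ᵥ v = 0 := fun v hv => by
      have h1 : ℓ ⬝ᵥ v = -(ℓ ⬝ᵥ v) := by
        conv_lhs => rw [← hv, Matrix.dotProduct_mulVec, hℓ, neg_dotProduct]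
      linear_combination h1 / 2
    have hu : aeval p (∑ i, ℓ i • X i : MvPolynomial (Fin m) ℂ) ∈ RingHom.ker (eval x) ^ 2 := by
      refine mem_ker_eval_sq ?_ fun τ => ?_
      · rw [eval_aeval]
        simpa [dotProduct] using hanti _ hpx
      · obtain ⟨a, ha⟩ := hdec τ
        have h1 : ℓ ⬝ᵥ dpMap p x (τ - a • ρ) = 0 := hanti _ (by
          rw [hQ, ← dpMap_mulVec h.equivar, hsx, ha])
        have h2 : dpMap p x τ = dpMap p x (τ - a • ρ) + a • dpMap p x ρ := by
          ext i
          conv_lhs => rw [← sub_add_cancel τ (a • ρ), dpMap, dirDeriv_add_dir, dirDeriv_smul_dir]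
          rfl
        rw [dirDeriv_aeval, map_sum]
        have h3 : ℓ ⬝ᵥ dpMap p x τ = 0 := by
          rw [h2, dotProduct_add, h1, dotProduct_smul, hℓρ, smul_zero, add_zero]
        simpa [dotProduct, dpMap] using h3
    have hv0 : ∀ v, Q.mulVec v = -v → ℓ ⬝ᵥ v = 0 := by
      intro v hv
      have hD0 := hsmall v hI hpx hv
      have hD1 : ∀ F F', aeval p F = aeval p F' →
          dirDeriv (pMap p x) v F = dirDeriv (pMap p x) v F' := fun F F' hF => by
        rw [← sub_eq_zero, ← map_sub]
        exact hD0 _ (by rw [relIdeal, RingHom.mem_ker, map_sub, hF, sub_self])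
      have h1 := pointDerivation_eq_zero hx (dirDeriv (pMap p x) v ∘ₗ σ) (fun a b => by
        simp only [LinearMap.comp_apply]
        rw [hD1 (σ (a * b)) (σ a * σ b) (by rw [map_mul (aeval p), hσ, hσ, hσ]; rfl), dirDeriv_mul,
          ← eval_aeval, ← eval_aeval, hσ, hσ])
        (u := ⟨_, aeval_mem_invariants h.gen (∑ i, ℓ i • X i)⟩) hu
      rw [LinearMap.comp_apply, hD1 _ (∑ i, ℓ i • X i) (hσ _)] at h1
      simpa [dotProduct] using h1
    have h2 : ∀ v, ℓ ⬝ᵥ v = 0 := fun v => by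
      have h3 := hv0 (v - Q.mulVec v) (by
        rw [Matrix.mulVec_sub, Matrix.mulVec_mulVec, hQQ, Matrix.one_mulVec, neg_sub])
      rw [dotProduct_sub, Matrix.dotProduct_mulVec, hℓ, neg_dotProduct] at h3
      linear_combination h3 / 2
    ext i
    simpa using h2 (Pi.single i 1)
  have hN : ∀ i, Matrix.vecMul ((Q - 1) i) Q = -(Q - 1) i := fun i => by
    have h1 : (Q - 1) * Q = -(Q - 1) := by rw [sub_mul, hQQ, one_mul, neg_sub]
    have h2 := congrFun h1 i
    rw [Matrix.mul_apply_eq_vecMul] at h2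
    exact h2
  have hne : Q ≠ 1 := fun h1 => hsG (h.mem_of_qMat_eq_one h1)
  obtain ⟨j, hj⟩ := Function.ne_iff.1 (sub_ne_zero.2 hne)
  have hj' : (Q - 1) j ⬝ᵥ dpMap p x ρ ≠ 0 := fun h0 => hj (hkey _ (hN j) h0)
  refine ⟨fun i => -((Q - 1) i ⬝ᵥ dpMap p x ρ) / ((Q - 1) j ⬝ᵥ dpMap p x ρ), (Q - 1) j, ?_⟩
  ext i k
  have h1 := hkey (((Q - 1) j ⬝ᵥ dpMap p x ρ) • (Q - 1) i
    - ((Q - 1) i ⬝ᵥ dpMap p x ρ) • (Q - 1) j) (by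
      rw [Matrix.sub_vecMul, Matrix.smul_vecMul, Matrix.smul_vecMul, hN, hN]
      module) (by
      rw [sub_dotProduct, smul_dotProduct, smul_dotProduct, smul_eq_mul, smul_eq_mul]
      ring)
  have h2 := congrFun h1 k
  simp only [Pi.sub_apply, Pi.smul_apply, smul_eq_mul, Pi.zero_apply] at h2
  rw [Matrix.sub_apply, Matrix.vecMulVec_apply]
  have h3 : (Q - 1) i k = Q i k - (1 : Matrix (Fin m) (Fin m) ℂ) i k := rfl
  field_simp
  linear_combination h2 - ((Q - 1) j ⬝ᵥ dpMap p x ρ) * h3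

end QuotSetup
end Setup

end

section

section Graded

variable {n m : ℕ} {G : Subgroup (Matrix.GeneralLinearGroup (Fin n) ℂ)}

theorem matAct_isHomogeneous (g : Matrix.GeneralLinearGroup (Fin n) ℂ) {f : MvPolynomial (Fin n) ℂ}
    {a : ℕ} (hf : f.IsHomogeneous a) : (matAct g f).IsHomogeneous a := by
  have h1 := hf.aeval (n := 1)
    (fun i => ∑ j, ((↑(g⁻¹) : Matrix (Fin n) (Fin n) ℂ) i j) • (X j : MvPolynomial (Fin n) ℂ))
    fun i => IsHomogeneous.sum _ _ _ fun j _ => by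
      rw [smul_eq_C_mul]; exact isHomogeneous_C_mul_X _ _
  rwa [one_mul] at h1

theorem homogeneousComponent_matAct (g : Matrix.GeneralLinearGroup (Fin n) ℂ)
    (f : MvPolynomial (Fin n) ℂ) (a : ℕ) :
    homogeneousComponent a (matAct g f) = matAct g (homogeneousComponent a f) := by
  conv_lhs => rw [← sum_homogeneousComponent f, map_sum, map_sum]
  have h1 : ∀ i, homogeneousComponent a (matAct g (homogeneousComponent i f))
      = if a = i then matAct g (homogeneousComponent i f) else 0 := fun i =>
    homogeneousComponent_of_mem (matAct_isHomogeneous g (homogeneousComponent_isHomogeneous i f))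
  rw [Finset.sum_congr rfl fun i _ => h1 i, Finset.sum_ite_eq]
  split_ifs with h
  · rfl
  · rw [homogeneousComponent_eq_zero a f (by simpa using h), map_zero]

theorem homogeneousComponent_mem_invariants {f : MvPolynomial (Fin n) ℂ} (hf : f ∈ invariants G)
    (a : ℕ) : homogeneousComponent a f ∈ invariants G := fun g hg => by
  rw [← homogeneousComponent_matAct, hf g hg]

theorem homogeneousComponent_mul_eq_sum (u v : MvPolynomial (Fin n) ℂ) (a : ℕ) :
    homogeneousComponent a (u * v) = ∑ i ∈ Finset.range (u.totalDegree + 1),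
      ∑ j ∈ Finset.range (v.totalDegree + 1), if a = i + j then
        homogeneousComponent i u * homogeneousComponent j v else 0 := by
  conv_lhs => rw [← sum_homogeneousComponent u, ← sum_homogeneousComponent v,
    Finset.sum_mul_sum, map_sum]
  refine Finset.sum_congr rfl fun i _ => ?_
  rw [map_sum]
  exact Finset.sum_congr rfl fun j _ => homogeneousComponent_of_mem
    ((homogeneousComponent_isHomogeneous i u).mul (homogeneousComponent_isHomogeneous j v))

theorem constantCoeff_homogeneousComponent {f : MvPolynomial (Fin n) ℂ}
    (hf : constantCoeff f = 0) (a : ℕ) : constantCoeff (homogeneousComponent a f) = 0 := by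
  rw [constantCoeff_eq, coeff_homogeneousComponent]
  rw [constantCoeff_eq] at hf
  simp [hf]

theorem mul_mem_sqSpan {u v : MvPolynomial (Fin n) ℂ} (hu : u ∈ invariants G)
    (hv : v ∈ invariants G) (hu0 : constantCoeff u = 0) (hv0 : constantCoeff v = 0) :
    u * v ∈ sqSpan G := Submodule.subset_span ⟨u, hu, v, hv, hu0, hv0, rfl⟩

theorem sqSpan_induction {P : MvPolynomial (Fin n) ℂ → Prop} (h0 : P 0)
    (hadd : ∀ f g, P f → P g → P (f + g)) (hsmul : ∀ (a : ℂ) f, P f → P (a • f))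
    (hmul : ∀ u ∈ invariants G, ∀ v ∈ invariants G, constantCoeff u = 0 → constantCoeff v = 0 →
      P (u * v)) {f : MvPolynomial (Fin n) ℂ} (hf : f ∈ sqSpan G) : P f := by
  refine Submodule.span_induction (p := fun f _ => P f) ?_ h0 (fun f g _ _ => hadd f g)
    (fun a f _ => hsmul a f) hf
  rintro _ ⟨u, hu, v, hv, hu0, hv0, rfl⟩
  exact hmul u hu v hv hu0 hv0

theorem constantCoeff_of_mem_sqSpan {f : MvPolynomial (Fin n) ℂ} (hf : f ∈ sqSpan G) :
    constantCoeff f = 0 :=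
  sqSpan_induction (P := fun f => constantCoeff f = 0) (map_zero _)
    (fun f g hf hg => by rw [map_add, hf, hg, add_zero])
    (fun a f hf => by rw [constantCoeff_smul, hf, smul_zero])
    (fun u _ v _ hu _ => by rw [map_mul, hu, zero_mul]) hf

theorem homogeneousComponent_mem_sqSpan {f : MvPolynomial (Fin n) ℂ} (hf : f ∈ sqSpan G)
    (a : ℕ) : homogeneousComponent a f ∈ sqSpan G := by
  refine sqSpan_induction (P := fun f => homogeneousComponent a f ∈ sqSpan G)
    (by rw [map_zero]; exact zero_mem _) (fun f g hf hg => by rw [map_add]; exact add_mem hf hg)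
    (fun b f hf => by rw [map_smul]; exact Submodule.smul_mem _ _ hf)
    (fun u hu v hv hu0 hv0 => ?_) hf
  rw [homogeneousComponent_mul_eq_sum]
  refine sum_mem fun i _ => sum_mem fun j _ => ?_
  split_ifs
  · exact mul_mem_sqSpan (homogeneousComponent_mem_invariants hu i)
      (homogeneousComponent_mem_invariants hv j) (constantCoeff_homogeneousComponent hu0 i)
      (constantCoeff_homogeneousComponent hv0 j)
  · exact zero_mem _

theorem adjoin_eq_invariants {q : Fin m → MvPolynomial (Fin n) ℂ} {d : Fin m → ℕ}
    (hq : ∀ i, q i ∈ invariants G) (hd : ∀ i, (q i).IsHomogeneous (d i))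
    (hspan : ∀ f ∈ invariants G, constantCoeff f = 0 →
      ∃ a : Fin m → ℂ, f - ∑ i, a i • q i ∈ sqSpan G) :
    Algebra.adjoin ℂ (Set.range q) = invariants G := by
  refine le_antisymm (Algebra.adjoin_le (by rintro _ ⟨i, rfl⟩; exact hq i)) fun f hf => ?_
  have key : ∀ a : ℕ, ∀ f ∈ invariants G, f.IsHomogeneous a →
      f ∈ Algebra.adjoin ℂ (Set.range q) := by
    intro a
    induction a using Nat.strong_induction_on with
    | _ a IH =>
    intro f hf hfa
    rcases Nat.eq_zero_or_pos a with rfl | ha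
    · rw [← homogeneousComponent_eq_self hfa, homogeneousComponent_zero]
      exact Subalgebra.algebraMap_mem _ _
    have hf0 : constantCoeff f = 0 := by
      rw [constantCoeff_eq]
      exact hfa.coeff_eq_zero (by simpa using ha.ne)
    obtain ⟨b, hb⟩ := hspan f hf hf0
    have hs : ∀ s ∈ sqSpan G, homogeneousComponent a s ∈ Algebra.adjoin ℂ (Set.range q) := by
      intro s hs
      refine sqSpan_induction
        (P := fun f => homogeneousComponent a f ∈ Algebra.adjoin ℂ (Set.range q))
        (by rw [map_zero]; exact zero_mem _)
        (fun f g hf hg => by rw [map_add]; exact add_mem hf hg)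
        (fun b f hf => by rw [map_smul]; exact Subalgebra.smul_mem _ hf _)
        (fun u hu v hv hu0 hv0 => ?_) hs
      rw [homogeneousComponent_mul_eq_sum]
      refine sum_mem fun i _ => sum_mem fun j _ => ?_
      split_ifs with hij
      · rcases Nat.eq_zero_or_pos i with rfl | hi
        · rw [homogeneousComponent_zero, ← constantCoeff_eq, hu0, C_0, zero_mul]
          exact zero_mem _
        rcases Nat.eq_zero_or_pos j with rfl | hj
        · rw [homogeneousComponent_zero, ← constantCoeff_eq, hv0, C_0, mul_zero]
          exact zero_mem _
        exact mul_mem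
          (IH i (by lia) _ (homogeneousComponent_mem_invariants hu i)
            (homogeneousComponent_isHomogeneous i u))
          (IH j (by lia) _ (homogeneousComponent_mem_invariants hv j)
            (homogeneousComponent_isHomogeneous j v))
      · exact zero_mem _
    have h1 : f = homogeneousComponent a (f - ∑ i, b i • q i)
        + ∑ i, b i • homogeneousComponent a (q i) := by
      simp only [map_sub, map_sum, map_smul, homogeneousComponent_eq_self hfa, sub_add_cancel]
    rw [h1]
    refine add_mem (hs _ hb) (sum_mem fun i _ => Subalgebra.smul_mem _ ?_ _)
    rw [homogeneousComponent_of_mem (hd i)]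
    split_ifs
    · exact Algebra.subset_adjoin ⟨i, rfl⟩
    · exact zero_mem _
  rw [← sum_homogeneousComponent f]
  exact sum_mem fun i _ => key i _ (homogeneousComponent_mem_invariants hf i)
    (homogeneousComponent_isHomogeneous i f)

theorem exists_sub_sum_mem_sqSpan {q : Fin m → MvPolynomial (Fin n) ℂ}
    (hq : Algebra.adjoin ℂ (Set.range q) = invariants G) (hq0 : ∀ i, constantCoeff (q i) = 0)
    {f : MvPolynomial (Fin n) ℂ} (hf : f ∈ invariants G) (hf0 : constantCoeff f = 0) :
    ∃ a : Fin m → ℂ, f - ∑ i, a i • q i ∈ sqSpan G := by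
  have hqi : ∀ i, q i ∈ invariants G := fun i => hq ▸ Algebra.subset_adjoin ⟨i, rfl⟩
  have key : ∀ F : MvPolynomial (Fin m) ℂ, ∃ (b : ℂ) (a : Fin m → ℂ),
      aeval q F - C b - ∑ i, a i • q i ∈ sqSpan G := by
    intro F
    induction F using MvPolynomial.induction_on with
    | C b =>
      refine ⟨b, 0, ?_⟩
      convert zero_mem (sqSpan G)
      rw [algHom_C]
      simp [algebraMap_eq]
    | add F F' h h' =>
      obtain ⟨b, a, h⟩ := h
      obtain ⟨b', a', h'⟩ := h'
      refine ⟨b + b', a + a', ?_⟩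
      convert add_mem h h' using 1
      simp only [map_add (aeval q), C_add, Pi.add_apply, add_smul, Finset.sum_add_distrib]
      ring
    | mul_X F i h =>
      obtain ⟨b, a, h⟩ := h
      refine ⟨0, Pi.single i b, ?_⟩
      have h1 : aeval q F - C b ∈ invariants G :=
        sub_mem (aeval_mem_invariants hq F) (Subalgebra.algebraMap_mem _ b)
      have h2 : constantCoeff (aeval q F - C b) = 0 := by
        have := constantCoeff_of_mem_sqSpan h
        rw [map_sub, map_sum, Finset.sum_eq_zero, sub_zero] at this
        · exact this
        · intro j _
          rw [constantCoeff_smul, hq0, smul_zero]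
      convert mul_mem_sqSpan h1 (hqi i) h2 (hq0 i) using 1
      rw [map_mul (aeval q), aeval_X, Finset.sum_eq_single i (fun j _ hj => by simp [hj])
        (by simp), Pi.single_eq_same, smul_eq_C_mul, C_0]
      ring
  obtain ⟨F, rfl⟩ := exists_aeval_eq hq hf
  obtain ⟨b, a, h⟩ := key F
  have hb : b = 0 := by
    have := constantCoeff_of_mem_sqSpan h
    rw [map_sub, map_sub, hf0, map_sum, Finset.sum_eq_zero] at this
    · simpa using this
    · intro j _
      rw [constantCoeff_smul, hq0, smul_zero]
  rw [hb, C_0, sub_zero] at h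
  exact ⟨a, h⟩

end Graded

end

section

section Conj

variable {n m : ℕ}

/-- Complex conjugation of the coefficients. -/
def cj : MvPolynomial (Fin n) ℂ →+* MvPolynomial (Fin n) ℂ := MvPolynomial.map (starRingEnd ℂ)

theorem cj_smul (a : ℂ) (f : MvPolynomial (Fin n) ℂ) : cj (a • f) = starRingEnd ℂ a • cj f := by
  rw [smul_eq_C_mul, smul_eq_C_mul, map_mul, cj, map_C]

theorem cj_sum_smul (a : Fin m → ℂ) (q : Fin m → MvPolynomial (Fin n) ℂ) :
    cj (∑ i, a i • q i) = ∑ i, starRingEnd ℂ (a i) • cj (q i) := by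
  simp only [map_sum, cj_smul]

theorem cj_cj (f : MvPolynomial (Fin n) ℂ) : cj (cj f) = f := by
  rw [cj, map_map, show (starRingEnd ℂ).comp (starRingEnd ℂ) = RingHom.id ℂ by ext; simp, map_id]

theorem eval_cj (x : Fin n → ℂ) (f : MvPolynomial (Fin n) ℂ) :
    eval x (cj f) = starRingEnd ℂ (eval (fun i => starRingEnd ℂ (x i)) f) := by
  induction f using MvPolynomial.induction_on with
  | C a => simp [cj]
  | add f g hf hg => simp only [map_add, hf, hg]
  | mul_X f i hf => rw [map_mul, map_mul, map_mul, map_mul, hf]; simp [cj]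

/-- A real vector as a complex vector. -/
def cplx (x : Fin n → ℝ) : Fin n → ℂ := fun i => x i

theorem eval_cplx_cj (x : Fin n → ℝ) (f : MvPolynomial (Fin n) ℂ) :
    eval (cplx x) (cj f) = starRingEnd ℂ (eval (cplx x) f) := by
  rw [eval_cj]
  congr 3
  ext i
  exact Complex.conj_ofReal _

theorem dirDeriv_cplx_cj (x τ : Fin n → ℝ) (f : MvPolynomial (Fin n) ℂ) :
    dirDeriv (cplx x) (cplx τ) (cj f) = starRingEnd ℂ (dirDeriv (cplx x) (cplx τ) f) := by
  induction f using MvPolynomial.induction_on with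
  | C a => rw [cj, map_C, dirDeriv_C, dirDeriv_C, map_zero]
  | add f g hf hg => simp only [map_add, hf, hg]
  | mul_X f i hf =>
    rw [map_mul, dirDeriv_mul, dirDeriv_mul, hf, eval_cplx_cj]
    simp [cj, dirDeriv_X, cplx]

theorem constantCoeff_cj (f : MvPolynomial (Fin n) ℂ) :
    constantCoeff (cj f) = starRingEnd ℂ (constantCoeff f) := by
  rw [cj, constantCoeff_map]

theorem matAct_cj {g : Matrix.GeneralLinearGroup (Fin n) ℂ}
    (hg : ∀ i j, ((↑(g⁻¹) : Matrix (Fin n) (Fin n) ℂ) i j).im = 0) (f : MvPolynomial (Fin n) ℂ) :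
    matAct g (cj f) = cj (matAct g f) := by
  refine MvPolynomial.funext fun x => ?_
  rw [eval_matAct, eval_cj, eval_cj, eval_matAct]
  congr 3
  ext i
  simp only [Matrix.mulVec, dotProduct, map_sum, map_mul]
  exact Finset.sum_congr rfl fun j _ => by rw [Complex.conj_eq_iff_im.2 (hg i j)]

variable {G : Subgroup (Matrix.GeneralLinearGroup (Fin n) ℂ)}

theorem cj_mem_invariants (hG : ∀ g ∈ G, ∀ i j,
    ((g : Matrix.GeneralLinearGroup (Fin n) ℂ) i j).im = 0)
    {f : MvPolynomial (Fin n) ℂ} (hf : f ∈ invariants G) : cj f ∈ invariants G := fun g hg => by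
  rw [matAct_cj (hG _ (G.inv_mem hg)), hf g hg]

theorem cj_mem_sqSpan (hG : ∀ g ∈ G, ∀ i j,
    ((g : Matrix.GeneralLinearGroup (Fin n) ℂ) i j).im = 0)
    {f : MvPolynomial (Fin n) ℂ} (hf : f ∈ sqSpan G) : cj f ∈ sqSpan G := by
  refine sqSpan_induction (P := fun f => cj f ∈ sqSpan G)
    (by rw [map_zero]; exact zero_mem _) (fun f g hf hg => by rw [map_add]; exact add_mem hf hg)
    (fun b f hf => by rw [cj_smul]; exact Submodule.smul_mem _ _ hf)
    (fun u hu v hv hu0 hv0 => ?_) hf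
  rw [map_mul]
  exact mul_mem_sqSpan (cj_mem_invariants hG hu) (cj_mem_invariants hG hv)
    (by rw [constantCoeff_cj, hu0, map_zero]) (by rw [constantCoeff_cj, hv0, map_zero])

theorem constantCoeff_matAct (g : Matrix.GeneralLinearGroup (Fin n) ℂ)
    (f : MvPolynomial (Fin n) ℂ) : constantCoeff (matAct g f) = constantCoeff f := by
  rw [constantCoeff_eq_eval_zero, eval_matAct, Matrix.mulVec_zero, constantCoeff_eq_eval_zero]

theorem matAct_mem_sqSpan {w : Matrix.GeneralLinearGroup (Fin n) ℂ}
    (hw : ∀ g ∈ G, w⁻¹ * g * w ∈ G)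
    {f : MvPolynomial (Fin n) ℂ} (hf : f ∈ sqSpan G) : matAct w f ∈ sqSpan G := by
  have hinv : ∀ f ∈ invariants G, matAct w f ∈ invariants G := fun f hf g hg => by
    rw [← matAct_mul, show g * w = w * (w⁻¹ * g * w) by group, matAct_mul, hf _ (hw g hg)]
  refine sqSpan_induction (P := fun f => matAct w f ∈ sqSpan G)
    (by rw [map_zero]; exact zero_mem _) (fun f g hf hg => by rw [map_add]; exact add_mem hf hg)
    (fun b f hf => by rw [map_smul]; exact Submodule.smul_mem _ _ hf)
    (fun u hu v hv hu0 hv0 => ?_) hf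
  rw [map_mul]
  exact mul_mem_sqSpan (hinv u hu) (hinv v hv) (by rw [constantCoeff_matAct, hu0])
    (by rw [constantCoeff_matAct, hv0])

end Conj

section LinAlg

variable {m : ℕ}

theorem exists_real_det_ne_zero (K : Matrix (Fin m) (Fin m) ℂ) :
    ∃ t : ℝ, (((1 + t * Complex.I : ℂ) • (1 : Matrix (Fin m) (Fin m) ℂ))
      + (1 - t * Complex.I : ℂ) • K).det ≠ 0 := by
  let M : Matrix (Fin m) (Fin m) (Polynomial ℂ) :=
    (1 + Polynomial.X * Polynomial.C Complex.I) • 1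
      + (1 - Polynomial.X * Polynomial.C Complex.I) • K.map Polynomial.C
  have hM : ∀ z : ℂ, M.det.eval z = (((1 + z * Complex.I : ℂ) • (1 : Matrix (Fin m) (Fin m) ℂ))
      + (1 - z * Complex.I : ℂ) • K).det := by
    intro z
    rw [← Polynomial.coe_evalRingHom, RingHom.map_det]
    congr 1
    ext i j
    simp only [M, RingHom.mapMatrix_apply, Matrix.map_apply, Matrix.add_apply, Matrix.smul_apply,
      Polynomial.coe_evalRingHom, Polynomial.eval_add, smul_eq_mul, Polynomial.eval_mul,
      Polynomial.eval_sub, Polynomial.eval_one, Polynomial.eval_X, Polynomial.eval_C,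
      Matrix.one_apply]
    split_ifs <;> simp
  have h0 : M.det ≠ 0 := fun h => by
    have h1 := hM (-Complex.I)
    rw [h, Polynomial.eval_zero, show (1 - -Complex.I * Complex.I : ℂ) = 0 by simp, zero_smul,
      add_zero, Matrix.det_smul, Matrix.det_one, mul_one] at h1
    have h2 : (1 + -Complex.I * Complex.I : ℂ) ≠ 0 := by norm_num
    exact pow_ne_zero _ h2 h1.symm
  by_contra hall
  push Not at hall
  refine h0 (Polynomial.eq_zero_of_infinite_isRoot _ ?_)
  refine (Set.infinite_range_of_injective Complex.ofReal_injective).mono ?_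
  rintro _ ⟨t, rfl⟩
  exact (hM t).trans (hall t)

end LinAlg

section RealForm

variable {n m : ℕ} {Wt G : Subgroup (Matrix.GeneralLinearGroup (Fin n) ℂ)}
  {p : Fin m → MvPolynomial (Fin n) ℂ} {c : ↥Wt → Fin m → Fin m → ℂ} {d : Fin m → ℕ}

namespace QuotSetup

theorem matrix_eq_of_sub_mem (h : QuotSetup Wt G p d c) {A B : Matrix (Fin m) (Fin m) ℂ}
    (hAB : ∀ i, ∑ j, A i j • p j - ∑ j, B i j • p j ∈ sqSpan G) : A = B := by
  ext i j
  have h1 := h.minimal (fun j => A i j - B i j) (by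
    simpa only [sub_smul, Finset.sum_sub_distrib] using hAB i)
  exact sub_eq_zero.1 (congrFun h1 j)

theorem constantCoeff_p (h : QuotSetup Wt G p d c) (i : Fin m) : constantCoeff (p i) = 0 := by
  rw [constantCoeff_eq_eval_zero]
  exact congrFun h.pMap_zero i

theorem p_mem (h : QuotSetup Wt G p d c) (i : Fin m) : p i ∈ invariants G :=
  h.gen ▸ Algebra.subset_adjoin ⟨i, rfl⟩

/-- The matrix of complex conjugation on the space spanned by the `p i` modulo decomposables. -/
theorem exists_conjMatrix (h : QuotSetup Wt G p d c) (hreal : ∀ g ∈ Wt, ∀ i j,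
      ((g : Matrix.GeneralLinearGroup (Fin n) ℂ) i j).im = 0) :
    ∃ K : Matrix (Fin m) (Fin m) ℂ, (∀ i j, d j ≠ d i → K i j = 0) ∧
      ∀ i, cj (p i) - ∑ j, K i j • p j ∈ sqSpan G := by
  have hG := fun g hg => hreal g (h.le hg)
  have h1 : ∀ i, ∃ a : Fin m → ℂ, cj (p i) - ∑ j, a j • p j ∈ sqSpan G := fun i =>
    exists_sub_sum_mem_sqSpan h.gen h.constantCoeff_p (cj_mem_invariants hG (h.p_mem i))
      (by rw [constantCoeff_cj, h.constantCoeff_p, map_zero])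
  choose a ha using h1
  refine ⟨fun i j => if d j = d i then a i j else 0, fun i j hij => if_neg hij, fun i => ?_⟩
  have h2 := homogeneousComponent_mem_sqSpan (ha i) (d i)
  rw [map_sub, homogeneousComponent_eq_self (p := cj (p i)) ((h.homog i).map _), map_sum] at h2
  convert h2 using 2
  refine Finset.sum_congr rfl fun j _ => ?_
  rw [map_smul, homogeneousComponent_of_mem (h.homog j)]
  beta_reduce
  by_cases hij : d j = d i
  · rw [if_pos hij, if_pos hij.symm]
  · rw [if_neg hij, if_neg (Ne.symm hij), zero_smul, smul_zero]

theorem sum_smul_mem (B : Matrix (Fin m) (Fin m) ℂ) {q r : Fin m → MvPolynomial (Fin n) ℂ}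
    (hqr : ∀ i, q i - r i ∈ sqSpan G) (i : Fin m) :
    ∑ j, B i j • q j - ∑ j, B i j • r j ∈ sqSpan G := by
  rw [← Finset.sum_sub_distrib]
  exact sum_mem fun j _ => by rw [← smul_sub]; exact Submodule.smul_mem _ _ (hqr j)

theorem sum_smul_sum_smul (A B : Matrix (Fin m) (Fin m) ℂ)
    (q : Fin m → MvPolynomial (Fin n) ℂ) (i : Fin m) :
    ∑ j, A i j • ∑ l, B j l • q l = ∑ l, (A * B) i l • q l := by
  simp only [Finset.smul_sum, smul_smul, Matrix.mul_apply, Finset.sum_smul]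
  exact Finset.sum_comm

theorem exists_real_form (h : QuotSetup Wt G p d c) (hreal : ∀ g ∈ Wt, ∀ i j,
      ((g : Matrix.GeneralLinearGroup (Fin n) ℂ) i j).im = 0) :
    ∃ (P P' : Matrix (Fin m) (Fin m) ℂ) (q : Fin m → MvPolynomial (Fin n) ℂ)
      (A : ↥Wt → Matrix (Fin m) (Fin m) ℝ), P * P' = 1 ∧ P' * P = 1 ∧
      Algebra.adjoin ℂ (Set.range q) = invariants G ∧
      (∀ w, P * qMat c w = (A w).map Complex.ofReal * P) ∧
      (∀ (x : Fin n → ℝ) i, eval (cplx x) (q i) = ((P.mulVec (pMap p (cplx x)) i).re : ℂ)) ∧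
      ∀ (x τ : Fin n → ℝ) i, dirDeriv (cplx x) (cplx τ) (q i)
        = ((P.mulVec (dpMap p (cplx x) (cplx τ)) i).re : ℂ) := by
  have hG := fun g hg => hreal g (h.le hg)
  obtain ⟨K, hKd, hK⟩ := h.exists_conjMatrix hreal
  set σ := starRingEnd ℂ with hσ
  have hcjcj : ∀ (B : Matrix (Fin m) (Fin m) ℂ) i, cj (∑ j, B i j • p j)
      - ∑ j, (B.map σ * K) i j • p j ∈ sqSpan G := fun B i => by
    rw [cj_sum_smul, ← sum_smul_sum_smul]
    exact sum_smul_mem (B.map σ) hK i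
  have hKK : K.map σ * K = 1 := by
    refine h.matrix_eq_of_sub_mem fun i => ?_
    have h1 := hcjcj K i
    have h2 := cj_mem_sqSpan hG (hK i)
    rw [map_sub, cj_cj] at h2
    have h3 : ∑ j, (1 : Matrix (Fin m) (Fin m) ℂ) i j • p j = p i := by
      simp [Matrix.one_apply]
    rw [h3]
    have h4 := neg_mem (add_mem h1 h2)
    convert h4 using 1
    ring
  have hKc : ∀ w : ↥Wt, (Matrix.of (c w)).map σ * K = K * Matrix.of (c w) := by
    intro w
    refine h.matrix_eq_of_sub_mem fun i => ?_
    have h1 := hcjcj (Matrix.of (c w)) i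
    simp only [Matrix.of_apply] at h1
    rw [← h.equivar, ← matAct_cj (hreal _ (Wt.inv_mem w.2))] at h1
    have h2 := matAct_mem_sqSpan (w := w) (fun g hg => by
      have := h.normal _ (Wt.inv_mem w.2) g hg
      rwa [inv_inv] at this) (hK i)
    rw [map_sub, map_sum] at h2
    simp only [map_smul, h.equivar] at h2
    have h3 := sum_smul_sum_smul K (Matrix.of (c w)) p i
    simp only [Matrix.of_apply] at h3
    rw [h3] at h2
    have h4 := sub_mem h2 h1
    convert h4 using 1
    ring
  obtain ⟨t, ht⟩ := exists_real_det_ne_zero K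
  set P : Matrix (Fin m) (Fin m) ℂ :=
    (1 + t * Complex.I : ℂ) • (1 : Matrix (Fin m) (Fin m) ℂ) + (1 - t * Complex.I : ℂ) • K with hP
  have hu : IsUnit P.det := isUnit_iff_ne_zero.2 ht
  have hPP := Matrix.mul_nonsing_inv P hu
  have hPP' := Matrix.nonsing_inv_mul P hu
  have hPd : ∀ i j, d j ≠ d i → P i j = 0 := fun i j hij => by
    have : i ≠ j := fun h => hij (h ▸ rfl)
    simp [hP, hKd i j hij, this]
  have hmapmul : ∀ A B : Matrix (Fin m) (Fin m) ℂ, (A * B).map σ = A.map σ * B.map σ :=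
    fun A B => Matrix.map_mul
  have hPK : P.map σ * K = P := by
    have h1 : P.map σ = (1 - t * Complex.I : ℂ) • (1 : Matrix (Fin m) (Fin m) ℂ)
        + (1 + t * Complex.I : ℂ) • K.map σ := by
      ext i j
      simp [hP, Matrix.one_apply, hσ]
      split_ifs <;> simp [sub_eq_add_neg]
    rw [h1, add_mul, smul_mul_assoc, smul_mul_assoc, hKK, one_mul, hP, add_comm]
  have hPσ : P.map σ * P⁻¹.map σ = 1 := by
    rw [← hmapmul, hPP, Matrix.map_one _ (map_zero σ) (map_one σ)]
  have hPσ' : P⁻¹.map σ * P.map σ = 1 := by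
    rw [← hmapmul, hPP', Matrix.map_one _ (map_zero σ) (map_one σ)]
  have hcreal : ∀ w, (P * qMat c w * P⁻¹).map σ = P * qMat c w * P⁻¹ := by
    intro w
    have h1 : (qMat c w).map σ * K = K * qMat c w := hKc w⁻¹
    rw [hmapmul, hmapmul]
    calc P.map σ * (qMat c w).map σ * P⁻¹.map σ
        = P.map σ * ((qMat c w).map σ * K) * (K.map σ * P⁻¹.map σ) := by
          have hKK' : K * K.map σ = 1 := mul_eq_one_comm.1 hKK
          simp only [Matrix.mul_assoc]
          rw [← Matrix.mul_assoc K, hKK', Matrix.one_mul]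
      _ = (P.map σ * K) * qMat c w * (K.map σ * P⁻¹.map σ) := by
          rw [h1]; simp only [Matrix.mul_assoc]
      _ = P * qMat c w * P⁻¹ := by
          rw [hPK]
          congr 1
          rw [← hmapmul]
          have h2 : (K * P⁻¹) * P.map σ = 1 := by
            rw [← mul_eq_one_comm, ← Matrix.mul_assoc, hPK, hPP]
          calc (K * P⁻¹).map σ = (K * P⁻¹).map σ * (P * P⁻¹) := by rw [hPP, mul_one]
            _ = ((K * P⁻¹) * P.map σ).map σ * P⁻¹ := by
              rw [hmapmul _ (P.map σ), ← Matrix.mul_assoc]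
              congr 2
              ext i j; simp [hσ]
            _ = P⁻¹ := by
              rw [h2, Matrix.map_one _ (map_zero σ) (map_one σ), one_mul]
  let p2 : Fin m → MvPolynomial (Fin n) ℂ := fun i => ∑ j, P i j • p j
  have hp2 : ∀ i, p2 i ∈ invariants G := fun i =>
    sum_mem fun j _ => Subalgebra.smul_mem _ (h.p_mem j) _
  have hp2d : ∀ i, (p2 i).IsHomogeneous (d i) := fun i => by
    refine IsHomogeneous.sum _ _ _ fun j _ => ?_
    by_cases hij : d j = d i
    · rw [smul_eq_C_mul, ← hij]; exact (h.homog j).C_mul _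
    · rw [hPd i j hij, zero_smul]; exact isHomogeneous_zero _ _ _
  have hp2c : ∀ i, cj (p2 i) - p2 i ∈ sqSpan G := fun i => by
    have h1 := hcjcj P i
    rwa [hPK] at h1
  let q : Fin m → MvPolynomial (Fin n) ℂ := fun i => (2⁻¹ : ℂ) • (p2 i + cj (p2 i))
  have hq2 : ∀ i, p2 i - q i ∈ sqSpan G := fun i => by
    have h1 := Submodule.smul_mem _ (-2⁻¹ : ℂ) (hp2c i)
    convert h1 using 1
    simp only [q]
    module
  refine ⟨P, P⁻¹, q, fun w => (P * qMat c w * P⁻¹).map Complex.re, hPP, hPP', ?_, ?_, ?_, ?_⟩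
  · refine adjoin_eq_invariants (d := d) (fun i => ?_) (fun i => ?_) fun f hf hf0 => ?_
    · exact Subalgebra.smul_mem _ (add_mem (hp2 i) (cj_mem_invariants hG (hp2 i))) _
    · simp only [q, smul_eq_C_mul]
      exact ((hp2d i).add ((hp2d i).map _)).C_mul _
    · obtain ⟨a, ha⟩ := exists_sub_sum_mem_sqSpan h.gen h.constantCoeff_p hf hf0
      refine ⟨Matrix.vecMul a P⁻¹, ?_⟩
      have h1 : ∑ i, Matrix.vecMul a P⁻¹ i • p2 i = ∑ i, a i • p i := by
        simp only [p2, Finset.smul_sum, smul_smul]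
        rw [Finset.sum_comm]
        refine Finset.sum_congr rfl fun j _ => ?_
        rw [← Finset.sum_smul]
        congr 1
        have h2 : Matrix.vecMul (Matrix.vecMul a P⁻¹) P j = a j := by
          rw [Matrix.vecMul_vecMul, hPP', Matrix.vecMul_one]
        exact h2
      have h2 : ∑ i, Matrix.vecMul a P⁻¹ i • (p2 i - q i) ∈ sqSpan G :=
        sum_mem fun i _ => Submodule.smul_mem _ _ (hq2 i)
      simp only [smul_sub, Finset.sum_sub_distrib, h1] at h2
      convert add_mem ha h2 using 1
      ring
  · intro w
    have h1 : ((P * qMat c w * P⁻¹).map Complex.re).map Complex.ofReal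
        = P * qMat c w * P⁻¹ := by
      ext i j
      have h2 := congrFun (congrFun (hcreal w) i) j
      exact Complex.conj_eq_iff_re.1 h2
    rw [h1, Matrix.mul_assoc, hPP', mul_one]
  · intro x i
    have h1 : eval (cplx x) (p2 i) = P.mulVec (pMap p (cplx x)) i := by
      simp [p2, Matrix.mulVec, dotProduct, pMap]
    simp only [q]
    rw [smul_eval, map_add, eval_cplx_cj, h1, Complex.add_conj]
    push_cast
    ring
  · intro x τ i
    have h1 : dirDeriv (cplx x) (cplx τ) (p2 i) = P.mulVec (dpMap p (cplx x) (cplx τ)) i := by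
      simp [p2, Matrix.mulVec, dotProduct, dpMap]
    simp only [q]
    rw [map_smul, map_add, dirDeriv_cplx_cj, h1, Complex.add_conj, smul_eq_mul]
    push_cast
    ring

end QuotSetup
end RealForm

end

section

section RankOne

variable {n : ℕ}

theorem isReflection_iff {k : Type} [Field k] {M : Matrix (Fin n) (Fin n) k} :
    IsReflection M ↔ IsOfFinOrder M ∧ M ≠ 1 ∧ ∃ a ℓ : Fin n → k, M = 1 - Matrix.vecMulVec a ℓ := by
  set T := Matrix.toLin' M - LinearMap.id with hT
  have hdim := T.finrank_range_add_finrank_ker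
  rw [Module.finrank_fin_fun] at hdim
  have hTv : ∀ v, T v = M.mulVec v - v := fun v => by simp [hT]
  refine and_congr_right fun _ => ?_
  change Module.finrank k (LinearMap.ker T) + 1 = n ↔ _
  refine ⟨fun h => ⟨?_, ?_⟩, ?_⟩
  · rintro rfl
    have : T = 0 := by ext; simp [hT]
    rw [this, LinearMap.ker_zero, finrank_top, Module.finrank_fin_fun] at h
    lia
  · have h1 : Module.finrank k (LinearMap.range T) = 1 := by lia
    obtain ⟨a, -, ha⟩ := finrank_eq_one_iff'.1 h1
    choose ℓ hℓ using fun j => ha ⟨T (Pi.single j 1), ⟨_, rfl⟩⟩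
    refine ⟨-a.1, ℓ, ?_⟩
    ext i j
    have h2 := congrFun (congrArg Subtype.val (hℓ j)) i
    simp only [hTv, Submodule.coe_smul, Pi.smul_apply, smul_eq_mul, Pi.sub_apply,
      Matrix.mulVec_single_one, Matrix.col_apply, Pi.single_apply] at h2
    rw [Matrix.sub_apply, Matrix.vecMulVec_apply, Matrix.one_apply, Pi.neg_apply]
    linear_combination -h2
  · rintro ⟨hM, a, ℓ, h⟩
    have hTa : ∀ v, T v = -(ℓ ⬝ᵥ v) • a := fun v => by
      rw [hTv, h, Matrix.sub_mulVec, Matrix.one_mulVec, Matrix.vecMulVec_mulVec]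
      ext i
      simp [mul_comm]
    have h1 : Module.finrank k (LinearMap.range T) ≤ 1 := by
      refine (Submodule.finrank_mono (t := k ∙ a) ?_).trans
        ((finrank_span_le_card {a}).trans (by simp))
      rintro _ ⟨v, rfl⟩
      rw [hTa]
      exact Submodule.smul_mem _ _ (Submodule.mem_span_singleton_self a)
    have h2 : Module.finrank k (LinearMap.range T) ≠ 0 := fun h0 => by
      rw [Submodule.finrank_eq_zero, LinearMap.range_eq_bot, hT, sub_eq_zero] at h0
      exact hM (Matrix.toLin'.injective (h0.trans Matrix.toLin'_one.symm))
    lia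

theorem exists_real_vecMulVec {A : Matrix (Fin n) (Fin n) ℝ} {a ℓ : Fin n → ℂ}
    (h : A.map Complex.ofReal = 1 - Matrix.vecMulVec a ℓ) :
    ∃ x f : Fin n → ℝ, A = 1 - Matrix.vecMulVec x f := by
  by_cases hA : A = 1
  · exact ⟨0, 0, by simp [hA]⟩
  obtain ⟨i₀, j₀, hij⟩ : ∃ i j, A i j ≠ (1 : Matrix (Fin n) (Fin n) ℝ) i j := by
    by_contra! hall
    exact hA (Matrix.ext hall)
  let B : Matrix (Fin n) (Fin n) ℝ := 1 - A
  have hB : ∀ i j, (B i j : ℂ) = a i * ℓ j := fun i j => by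
    have h1 := congrFun (congrFun h i) j
    rw [Matrix.map_apply, Matrix.sub_apply, Matrix.vecMulVec_apply] at h1
    simp only [B, Matrix.sub_apply, Complex.ofReal_sub]
    rw [h1, Matrix.one_apply, Matrix.one_apply]
    split_ifs <;> push_cast <;> ring
  have hB0 : B i₀ j₀ ≠ 0 := fun h0 => hij (sub_eq_zero.1 h0).symm
  refine ⟨fun i => B i j₀ / B i₀ j₀, fun j => B i₀ j, ?_⟩
  ext i j
  have h1 : B i j * B i₀ j₀ = B i j₀ * B i₀ j := by
    apply Complex.ofReal_injective
    push_cast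
    rw [hB, hB, hB, hB]
    ring
  have h2 : B i j = (1 : Matrix (Fin n) (Fin n) ℝ) i j - A i j := rfl
  rw [Matrix.sub_apply, Matrix.vecMulVec_apply]
  field_simp
  linear_combination -h1 + B i₀ j₀ * h2

end RankOne

section MatEquiv

variable {n : ℕ} {Γ : Type*} [Group Γ]

/-- The representation by linear equivalences defined by a matrix representation. -/
def matEquiv (A : Γ →* Matrix (Fin n) (Fin n) ℝ) : Γ →* ((Fin n → ℝ) ≃ₗ[ℝ] (Fin n → ℝ)) where
  toFun g := LinearEquiv.ofLinearMap (Matrix.toLin' (A g)) (Matrix.toLin' (A g⁻¹))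
    (by rw [← Matrix.toLin'_mul, ← map_mul, mul_inv_cancel, map_one, Matrix.toLin'_one])
    (by rw [← Matrix.toLin'_mul, ← map_mul, inv_mul_cancel, map_one, Matrix.toLin'_one])
  map_one' := by
    ext v : 1
    change Matrix.toLin' (A 1) v = v
    rw [map_one, Matrix.toLin'_one, LinearMap.id_apply]
  map_mul' g h := by
    ext v : 1
    change Matrix.toLin' (A (g * h)) v = Matrix.toLin' (A g) (Matrix.toLin' (A h) v)
    rw [map_mul, Matrix.toLin'_mul, LinearMap.comp_apply]

theorem matEquiv_apply (A : Γ →* Matrix (Fin n) (Fin n) ℝ) (g : Γ) (v : Fin n → ℝ) :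
    matEquiv A g v = (A g).mulVec v := Matrix.toLin'_apply _ _

theorem matEquiv_eq_one_iff {A : Γ →* Matrix (Fin n) (Fin n) ℝ} {g : Γ} :
    matEquiv A g = 1 ↔ A g = 1 := by
  refine ⟨fun h => Matrix.toLin'.injective ?_, fun h => ?_⟩
  · rw [Matrix.toLin'_one]
    exact LinearMap.ext fun w => by rw [Matrix.toLin'_apply, ← matEquiv_apply, h]; rfl
  · ext v : 1
    rw [matEquiv_apply, h, Matrix.one_mulVec]; rfl

theorem isRealRefl_matEquiv_iff [Finite Γ] {A : Γ →* Matrix (Fin n) (Fin n) ℝ} {g : Γ} :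
    IsRealRefl (matEquiv A g) ↔ A g ≠ 1 ∧ ∃ x f : Fin n → ℝ, A g = 1 - Matrix.vecMulVec x f := by
  constructor
  · rintro ⟨f, x, hfx, h⟩
    refine ⟨fun h1 => ?_, x, fun j => f (Pi.single j 1), ?_⟩
    · have h2 := h x
      rw [matEquiv_eq_one_iff.2 h1, hfx] at h2
      have h3 : (2 : ℝ) • x = 0 := sub_eq_self.1 h2.symm
      have h4 : x = 0 := (smul_eq_zero.1 h3).resolve_left two_ne_zero
      rw [h4, map_zero] at hfx
      norm_num at hfx
    · ext i j
      have h2 := congrFun (h (Pi.single j 1)) i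
      rw [matEquiv_apply] at h2
      simp only [Matrix.mulVec_single_one, Matrix.col_apply, Pi.sub_apply, Pi.single_apply,
        Pi.smul_apply, smul_eq_mul] at h2
      rw [h2, Matrix.sub_apply, Matrix.vecMulVec_apply, Matrix.one_apply, mul_comm]
  · rintro ⟨hne, x, f, h⟩
    have hv : ∀ v, (A g).mulVec v = v - (f ⬝ᵥ v) • x := fun v => by
      rw [h, Matrix.sub_mulVec, Matrix.one_mulVec, Matrix.vecMulVec_mulVec]
      ext i
      simp [mul_comm]
    obtain ⟨N, hN, hN1⟩ := isOfFinOrder_iff_pow_eq_one.1 (isOfFinOrder_of_finite g)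
    have hAN : (A g) ^ N = 1 := by rw [← map_pow, hN1, map_one]
    have hx0 : x ≠ 0 := fun h0 => hne (by rw [h, h0]; simp)
    have hpow : ∀ N : ℕ, ((A g) ^ N).mulVec x = (1 - f ⬝ᵥ x) ^ N • x := by
      intro N
      induction N with
      | zero => simp
      | succ N ih =>
        rw [pow_succ, ← Matrix.mulVec_mulVec, hv, Matrix.mulVec_sub, Matrix.mulVec_smul, ih,
          pow_succ]
        module
    have h1 : (1 - f ⬝ᵥ x) ^ N = 1 := by
      have h2 := hpow N
      rw [hAN, Matrix.one_mulVec] at h2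
      have h3 : ((1 - f ⬝ᵥ x) ^ N - 1) • x = 0 := by rw [sub_smul, ← h2, one_smul, sub_self]
      exact sub_eq_zero.1 ((smul_eq_zero.1 h3).resolve_right hx0)
    have h2 : f ⬝ᵥ x ≠ 0 := by
      intro h0
      have hpow' : ∀ (N : ℕ) v, ((A g) ^ N).mulVec v = v - ((N : ℝ) * (f ⬝ᵥ v)) • x := by
        intro N
        induction N with
        | zero => simp
        | succ N ih =>
          intro v
          rw [pow_succ, ← Matrix.mulVec_mulVec, hv, ih, dotProduct_sub, dotProduct_smul, h0]
          push_cast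
          module
      refine hne ?_
      rw [h]
      have hf : f = 0 := by
        ext j
        have h3 := hpow' N (Pi.single j 1)
        rw [hAN, Matrix.one_mulVec] at h3
        have h4 : ((N : ℝ) * (f ⬝ᵥ Pi.single j 1)) • x = 0 :=
          sub_eq_self.1 h3.symm
        have h5 := (smul_eq_zero.1 h4).resolve_right hx0
        simpa [hN.ne'] using h5
      simp [hf]
    have h3 : |1 - f ⬝ᵥ x| = 1 := by
      have := congrArg abs h1
      rw [abs_pow, abs_one] at this
      exact (pow_eq_one_iff_of_nonneg (abs_nonneg _) hN.ne').1 this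
    refine ⟨dotProductBilin ℝ ℝ f, x, ?_, fun v => ?_⟩
    · rcases abs_eq (by norm_num : (0:ℝ) ≤ 1) |>.1 h3 with h4 | h4
      · exact absurd (by linarith) h2
      · change f ⬝ᵥ x = 2
        linarith
    · rw [matEquiv_apply, hv]; rfl

end MatEquiv

end

section

section RealFormSection

variable {n : ℕ} {Γ : Type*} [Group Γ]

/-- The points moved by all elements acting as reflections. -/
def reflCompl (ψ : Γ →* Matrix (Fin n) (Fin n) ℂ) : Set (Fin n → ℂ) :=
  {v | ∀ g, IsReflection (ψ g) → (ψ g).mulVec v ≠ v}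

/-- A real form of a complex representation: the matrix `P` conjugates it to the
complexification of `A`. -/
structure RealForm (ψ : Γ →* Matrix (Fin n) (Fin n) ℂ) where
  P : Matrix (Fin n) (Fin n) ℂ
  P' : Matrix (Fin n) (Fin n) ℂ
  A : Γ →* Matrix (Fin n) (Fin n) ℝ
  mul_inv : P * P' = 1
  inv_mul : P' * P = 1
  comm : ∀ g, P * ψ g = (A g).map Complex.ofReal * P

theorem map_ofReal_injective :
    Function.Injective fun A : Matrix (Fin n) (Fin n) ℝ => A.map Complex.ofReal :=
  fun A B h => by
    ext i j
    exact Complex.ofReal_injective (congrFun (congrFun h i) j)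

/-- Construct a real form from a family of real matrices. -/
def RealForm.mk' {ψ : Γ →* Matrix (Fin n) (Fin n) ℂ} (P P' : Matrix (Fin n) (Fin n) ℂ)
    (A : Γ → Matrix (Fin n) (Fin n) ℝ) (h : P * P' = 1) (h' : P' * P = 1)
    (hA : ∀ g, P * ψ g = (A g).map Complex.ofReal * P) : RealForm ψ where
  P := P
  P' := P'
  A :=
    { toFun := A
      map_one' := map_ofReal_injective (by
        change (A 1).map Complex.ofReal = (1 : Matrix (Fin n) (Fin n) ℝ).map Complex.ofReal
        rw [← mul_one ((A 1).map _), ← h, ← mul_assoc, ← hA, map_one, mul_one, h,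
          Matrix.map_one _ Complex.ofReal_zero Complex.ofReal_one])
      map_mul' := fun a b => map_ofReal_injective (by
        change (A (a * b)).map Complex.ofRealHom = (A a * A b).map Complex.ofRealHom
        rw [Matrix.map_mul]
        change (A (a * b)).map Complex.ofReal = (A a).map Complex.ofReal * (A b).map Complex.ofReal
        rw [← mul_one ((A (a * b)).map _), ← h, ← mul_assoc, ← hA, map_mul, ← mul_assoc, hA,
          mul_assoc ((A a).map _), hA, mul_assoc, mul_assoc, h, mul_one]) }
  mul_inv := h
  inv_mul := h'
  comm := hA

theorem mulVec_cplx (A : Matrix (Fin n) (Fin n) ℝ) (v : Fin n → ℝ) :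
    (A.map Complex.ofReal).mulVec (cplx v) = cplx (A.mulVec v) := by
  ext i
  simp [Matrix.mulVec, dotProduct, cplx]

namespace RealForm

variable {ψ : Γ →* Matrix (Fin n) (Fin n) ℂ} (R : RealForm ψ)

/-- The real group of a real form. -/
def group : Subgroup ((Fin n → ℝ) ≃ₗ[ℝ] (Fin n → ℝ)) := (matEquiv R.A).range

instance [Finite Γ] : Finite R.group := (Set.finite_range (matEquiv R.A)).to_subtype

theorem mem_group (g : Γ) : matEquiv R.A g ∈ R.group := ⟨g, rfl⟩

/-- The real and imaginary parts with respect to a real form. -/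
def coords : (Fin n → ℂ) ≃ₜ (Fin n → ℝ) × (Fin n → ℝ) where
  toFun v := (fun i => (R.P.mulVec v i).re, fun i => (R.P.mulVec v i).im)
  invFun q := R.P'.mulVec (fun i => ⟨q.1 i, q.2 i⟩)
  left_inv v := by
    change R.P'.mulVec (R.P.mulVec v) = v
    rw [Matrix.mulVec_mulVec, R.inv_mul, Matrix.one_mulVec]
  right_inv q := by
    simp only [Matrix.mulVec_mulVec, R.mul_inv, Matrix.one_mulVec]
  continuous_toFun := by fun_prop
  continuous_invFun := by
    simp only [Complex.mk_eq_add_mul_I]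
    fun_prop

theorem coords_apply (v : Fin n → ℂ) :
    R.coords v = (fun i => (R.P.mulVec v i).re, fun i => (R.P.mulVec v i).im) := rfl

theorem coords_add (v w : Fin n → ℂ) : R.coords (v + w) = R.coords v + R.coords w := by
  rw [coords_apply, Matrix.mulVec_add]; rfl

theorem coords_smul (a : ℝ) (v : Fin n → ℂ) : R.coords ((a : ℂ) • v) = a • R.coords v := by
  rw [coords_apply, Matrix.mulVec_smul]
  ext i <;> simp [coords_apply]

theorem coords_I_smul (v : Fin n → ℂ) :
    R.coords (Complex.I • v) = (-(R.coords v).2, (R.coords v).1) := by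
  rw [coords_apply, Matrix.mulVec_smul]
  ext i <;> simp [coords_apply]

theorem coords_mulVec (g : Γ) (v : Fin n → ℂ) : R.coords ((ψ g).mulVec v)
    = (matEquiv R.A g (R.coords v).1, matEquiv R.A g (R.coords v).2) := by
  rw [coords_apply, Matrix.mulVec_mulVec, R.comm, ← Matrix.mulVec_mulVec, matEquiv_apply,
    matEquiv_apply]
  ext i <;> simp [Matrix.mulVec, dotProduct, coords_apply]

theorem eq_of_matEquiv_eq_one {g : Γ} (h : matEquiv R.A g = 1) : ψ g = 1 := by
  rw [matEquiv_eq_one_iff] at h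
  rw [← one_mul (ψ g), ← R.inv_mul, mul_assoc, R.comm, h,
    Matrix.map_one _ Complex.ofReal_zero Complex.ofReal_one, one_mul]

theorem matEquiv_eq_one_of_eq {g : Γ} (h : ψ g = 1) : matEquiv R.A g = 1 := by
  rw [matEquiv_eq_one_iff]
  refine map_ofReal_injective ?_
  beta_reduce
  rw [← mul_one ((R.A g).map _), ← R.mul_inv, ← mul_assoc, ← R.comm, h, mul_one,
    R.mul_inv, Matrix.map_one _ Complex.ofReal_zero Complex.ofReal_one]

theorem isReflection_iff [Finite Γ] (g : Γ) : IsReflection (ψ g) ↔ IsRealRefl (matEquiv R.A g) := by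
  have h1 : R.A g = 1 ↔ ψ g = 1 :=
    matEquiv_eq_one_iff.symm.trans ⟨R.eq_of_matEquiv_eq_one, R.matEquiv_eq_one_of_eq⟩
  rw [ReflQuot.isReflection_iff, isRealRefl_matEquiv_iff, Ne, Ne, h1]
  constructor
  · rintro ⟨-, hne, a, ℓ, h⟩
    refine ⟨hne, exists_real_vecMulVec (a := R.P.mulVec a) (ℓ := Matrix.vecMul ℓ R.P') ?_⟩
    rw [← mul_one ((R.A g).map _), ← R.mul_inv, ← mul_assoc, ← R.comm, h, mul_sub, mul_one,
      sub_mul, R.mul_inv, Matrix.mul_vecMulVec, Matrix.vecMulVec_mul]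
  · rintro ⟨hne, x, f, h⟩
    refine ⟨ψ.isOfFinOrder (isOfFinOrder_of_finite g), hne, R.P'.mulVec (cplx x),
      Matrix.vecMul (cplx f) R.P, ?_⟩
    rw [← one_mul (ψ g), ← R.inv_mul, mul_assoc, R.comm, h]
    have h2 : (1 - Matrix.vecMulVec x f).map Complex.ofReal
        = 1 - Matrix.vecMulVec (cplx x) (cplx f) := by
      ext i j
      simp only [Matrix.map_apply, Matrix.sub_apply, Matrix.vecMulVec_apply, Matrix.one_apply, cplx]
      split_ifs <;> push_cast <;> rfl
    rw [h2, sub_mul, mul_sub, one_mul, Matrix.vecMulVec_mul, Matrix.mul_vecMulVec]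

theorem mem_reflCompl_iff [Finite Γ] (K : Chamber R.group) (v : Fin n → ℂ) :
    v ∈ reflCompl ψ ↔ R.coords v ∈ K.hypComp := by
  have key : ∀ g, matEquiv R.A g ∈ reflSet R.group → ((ψ g).mulVec v ≠ v ↔
      K.form (matEquiv R.A g) (R.coords v).1 ≠ 0 ∨ K.form (matEquiv R.A g) (R.coords v).2 ≠ 0) := by
    intro g hg
    rw [← R.coords.injective.ne_iff, R.coords_mulVec]
    have h1 : ∀ u, matEquiv R.A g u = u ↔ K.form (matEquiv R.A g) u = 0 := fun u =>
      Chamber.refl_eq_iff hg u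
    rw [Ne, Prod.ext_iff, h1, h1]
    tauto
  constructor
  · rintro h _ ⟨⟨g, rfl⟩, hg⟩
    exact (key g ⟨⟨g, rfl⟩, hg⟩).1 (h g ((R.isReflection_iff g).2 hg))
  · intro h g hg
    have hg' : matEquiv R.A g ∈ reflSet R.group := ⟨⟨g, rfl⟩, (R.isReflection_iff g).1 hg⟩
    exact (key g hg').2 (h _ hg')

end RealForm
end RealFormSection

end

section

section
variable {E : Type*} [NormedAddCommGroup E] [NormedSpace ℝ E]

theorem one_notMem_reflSet (W : Subgroup (E ≃ₗ[ℝ] E)) : 1 ∉ reflSet W := by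
  rintro ⟨-, f, x, hfx, h⟩
  have h1 := congrArg f (h x)
  rw [map_sub, map_smul, smul_eq_mul, hfx, LinearEquiv.coe_one, id, hfx] at h1
  norm_num at h1

theorem Chamber.convex_opn {W : Subgroup (E ≃ₗ[ℝ] E)} (K : Chamber W) : Convex ℝ K.opn := by
  intro u hu v hv a b ha hb hab s hs
  rw [map_add, map_smul, map_smul, smul_eq_mul, smul_eq_mul]
  rcases ha.eq_or_lt with rfl | ha'
  · have : b = 1 := by linarith
    simpa [this] using hv s hs
  · exact add_pos_of_pos_of_nonneg (mul_pos ha' (hu s hs)) (mul_nonneg hb (hv s hs).le)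

/-- The stabilizer of a regular vector in a finite reflection group is trivial. -/
theorem eq_one_of_apply_eq {W : Subgroup (E ≃ₗ[ℝ] E)} [Finite W]
    (hW : Subgroup.closure (reflSet W) = W) {x : E} (hx : ∀ r ∈ reflSet W, r x ≠ x)
    {w : E ≃ₗ[ℝ] E} (hw : w ∈ W) (hwx : w x = x) : w = 1 := by
  obtain ⟨K, rfl⟩ := exists_chamber W x hx
  exact Chamber.eq_one_of_mem_opn (fun _ h => h) (K.closure_simple hW) K.base_mem_opn hw
    (hwx.symm ▸ K.base_mem_opn)

open Filter Topology in
theorem Chamber.eq_one_of_mem_hypComp {W : Subgroup (E ≃ₗ[ℝ] E)} [Finite W] (K : Chamber W)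
    (hW : Subgroup.closure (reflSet W) = W) {q : E × E} (hq : q ∈ K.hypComp)
    {w : E ≃ₗ[ℝ] E} (hw : w ∈ W) (h1 : w q.1 = q.1) (h2 : w q.2 = q.2) : w = 1 := by
  have := finite_reflSet W
  have hev : ∀ᶠ ε in 𝓝[>] (0 : ℝ), ∀ r : reflSet W, K.form r q.1 + ε * K.form r q.2 ≠ 0 := by
    refine eventually_all.2 fun r => ?_
    by_cases hr : K.form r q.2 = 0
    · have := (hq r r.2).resolve_right (not_not.2 hr)
      simpa [hr] using this
    · exact eventually_add_mul_ne _ hr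
  obtain ⟨ε, hε⟩ := hev.exists
  refine eq_one_of_apply_eq hW (x := q.1 + ε • q.2) (fun r hr h => hε ⟨r, hr⟩ ?_) hw ?_
  · simpa using (Chamber.refl_eq_iff (K := K) hr _).1 h
  · rw [map_add, map_smul, h1, h2]

/-- Real points of the quotient of a reflection group `κt` by a normal subgroup, mapped by `f`
to a representation `κ` of the quotient. -/
structure RealQuot (Γ Et E : Type*) [Group Γ] [NormedAddCommGroup Et] [NormedSpace ℝ Et]
    [NormedAddCommGroup E] [NormedSpace ℝ E] where
  κt : Γ →* (Et ≃ₗ[ℝ] Et)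
  κ : Γ →* (E ≃ₗ[ℝ] E)
  f : Et → E
  injective : Function.Injective κt
  closure_refl : Subgroup.closure (reflSet κt.range) = κt.range
  continuous : Continuous f
  equivariant : ∀ g x, f (κt g x) = κ g (f x)
  fiber : ∀ x y, f x = f y → ∃ g, κ g = 1 ∧ κt g x = y
  refl : ∀ s z, κt s ∈ reflSet κt.range → κ s ≠ 1 → κt s z = z →
    (∀ g, κ g = 1 → κt g z = z → g = 1) → IsRealRefl (κ s)

namespace RealQuot

variable {Γ Et : Type*} [Group Γ] [NormedAddCommGroup Et] [NormedSpace ℝ Et]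
variable (D : RealQuot Γ Et E)

instance [Finite Γ] : Finite D.κt.range := (Set.finite_range D.κt).to_subtype

theorem exists_of_κ_apply_eq {w : Γ} {x : Et} (h : D.κ w (D.f x) = D.f x) :
    ∃ g, D.κ g = 1 ∧ D.κt (g⁻¹ * w) x = x := by
  rw [← D.equivariant] at h
  obtain ⟨g, hg, hgx⟩ := D.fiber _ _ h.symm
  refine ⟨g, hg, ?_⟩
  rw [map_mul, LinearEquiv.mul_apply, ← hgx, ← LinearEquiv.mul_apply, ← map_mul, inv_mul_cancel,
    map_one]
  rfl

variable [Finite Γ]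

theorem refl_f_ne {x : Et} (hx : ∀ r ∈ reflSet D.κt.range, r x ≠ x) :
    ∀ r ∈ reflSet D.κ.range, r (D.f x) ≠ D.f x := by
  rintro r hr hrx
  obtain ⟨w, rfl⟩ := hr.1
  obtain ⟨g, hg, hgx⟩ := D.exists_of_κ_apply_eq hrx
  have h1 := eq_one_of_apply_eq D.closure_refl hx ⟨_, rfl⟩ hgx
  rw [← map_one D.κt] at h1
  have h2 := inv_mul_eq_one.1 (D.injective h1)
  rw [← h2, hg] at hr
  exact one_notMem_reflSet _ hr

variable [FiniteDimensional ℝ E] {D} {Kt : Chamber D.κt.range} {K : Chamber D.κ.range}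

theorem f_mem_opn (hb : K.base = D.f Kt.base) {x : Et} (hx : x ∈ Kt.opn) : D.f x ∈ K.opn := by
  intro r hr
  have hconv := Kt.convex_opn
  by_contra hneg
  have hc : Continuous fun y => K.form r (D.f y) :=
    (LinearMap.continuous_of_finiteDimensional (K.form r)).comp D.continuous
  obtain ⟨y, hy, hy0⟩ := hconv.isPreconnected.intermediate_value hx Kt.base_mem_opn
    hc.continuousOn ⟨not_lt.1 hneg, (hb ▸ K.base_pos r hr).le⟩
  exact D.refl_f_ne (fun r' hr' h => (hy r' hr').ne' ((Chamber.refl_eq_iff hr' y).1 h)) r hr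
    ((Chamber.refl_eq_iff hr _).2 hy0)

open Filter Topology in
theorem f_mem_face (hb : K.base = D.f Kt.base) {s : Γ} (hs : Kt.IsSimple (D.κt s))
    (hs1 : D.κ s ≠ 1) {z : Et} (hz : z ∈ Kt.face (D.κt s)) :
    D.κ s ∈ reflSet D.κ.range ∧ D.f z ∈ K.face (D.κ s) := by
  have hstab : ∀ g, D.κt g z = z → g = 1 ∨ g = s := by
    intro g hg
    refine (Chamber.eq_one_or_eq_of_mem_face (fun _ h => h) (Kt.closure_simple D.closure_refl)
      hs hz ⟨g, rfl⟩ hg).imp (fun h => D.injective (h.trans (map_one _).symm))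
      (fun h => D.injective h)
  have hsz : D.κt s z = z := (Chamber.refl_eq_iff hs.1 z).2 hz.1
  have hmem : D.κ s ∈ reflSet D.κ.range := ⟨⟨s, rfl⟩, D.refl s z hs.1 hs1 hsz fun g hg hgz =>
    (hstab g hgz).resolve_right fun h => hs1 (h ▸ hg)⟩
  refine ⟨hmem, (Chamber.refl_eq_iff hmem _).1 (by rw [← D.equivariant, hsz]), fun r hr hrs => ?_⟩
  refine lt_of_le_of_ne ?_ fun h0 => ?_
  · have hev : ∀ᶠ ε in 𝓝[>] (0 : ℝ), 0 ≤ K.form r (D.f (z + ε • Kt.base)) := by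
      filter_upwards [self_mem_nhdsWithin] with ε hε
      refine (f_mem_opn hb (fun r' hr' => ?_) r hr).le
      rw [map_add, map_smul, smul_eq_mul]
      refine add_pos_of_nonneg_of_pos ?_ (mul_pos hε (Kt.base_pos r' hr'))
      by_cases h : r' = D.κt s
      · rw [h, hz.1]
      · exact (hz.2 r' hr' h).le
    have hc : Continuous fun ε : ℝ => K.form r (D.f (z + ε • Kt.base)) :=
      (LinearMap.continuous_of_finiteDimensional (K.form r)).comp
        (D.continuous.comp (by fun_prop))
    have h0 := hc.tendsto 0
    rw [zero_smul, add_zero] at h0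
    exact ge_of_tendsto (h0.mono_left nhdsWithin_le_nhds) hev
  · obtain ⟨w, rfl⟩ := hr.1
    obtain ⟨g, hg, hgz⟩ := D.exists_of_κ_apply_eq ((Chamber.refl_eq_iff hr _).2 h0.symm)
    rcases hstab _ hgz with h | h
    · rw [← inv_mul_eq_one.1 h, hg] at hr
      exact one_notMem_reflSet _ hr
    · apply hrs
      rw [← h, map_mul, map_inv, hg, inv_one, one_mul]

theorem exists_simple_lifts (hb : K.base = D.f Kt.base) :
    Subgroup.closure (reflSet D.κ.range) = D.κ.range ∧
    ∀ t, K.IsSimple t → ∃ s, D.κ s = t ∧ Kt.IsSimple (D.κt s) := by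
  set T : Set (E ≃ₗ[ℝ] E) := {t | ∃ s, D.κ s = t ∧ Kt.IsSimple (D.κt s) ∧ D.κ s ≠ 1}
  have hT : ∀ t ∈ T, K.IsSimple t := by
    rintro _ ⟨s, rfl, hs, hs1⟩
    obtain ⟨z, hz⟩ := hs.2
    have := f_mem_face hb hs hs1 hz
    exact ⟨this.1, _, this.2⟩
  have htop : Subgroup.closure {s | Kt.IsSimple (D.κt s)} = ⊤ := by
    refine Subgroup.map_injective D.injective ?_
    rw [MonoidHom.map_closure, ← MonoidHom.range_eq_map]
    refine Eq.trans (congrArg _ ?_) (Kt.closure_simple D.closure_refl)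
    ext t
    constructor
    · rintro ⟨s, hs, rfl⟩; exact hs
    · intro ht
      obtain ⟨s, rfl⟩ := ht.1.1
      exact ⟨s, ht, rfl⟩
  have hgen : Subgroup.closure T = D.κ.range := by
    refine le_antisymm ((Subgroup.closure_le _).2 fun t ht => (hT t ht).1.1) ?_
    rw [MonoidHom.range_eq_map, ← htop, MonoidHom.map_closure, Subgroup.closure_le]
    rintro _ ⟨s, hs, rfl⟩
    by_cases hs1 : D.κ s = 1
    · rw [hs1]; exact Subgroup.one_mem _
    · exact Subgroup.subset_closure ⟨s, rfl, hs, hs1⟩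
  constructor
  · refine le_antisymm ((Subgroup.closure_le _).2 fun t ht => ht.1) ?_
    conv_lhs => rw [← hgen]
    exact Subgroup.closure_mono fun t ht => (hT t ht).1
  · intro t ht
    obtain ⟨s, h1, h2, -⟩ := Chamber.IsSimple.mem_of_generating hT hgen ht
    exact ⟨s, h1, h2⟩

end RealQuot
end

end

section

section RealStructure

variable {n m : ℕ} {Wt G : Subgroup (Matrix.GeneralLinearGroup (Fin n) ℂ)}
  {p : Fin m → MvPolynomial (Fin n) ℂ} {d : Fin m → ℕ} {c : ↥Wt → Fin m → Fin m → ℂ}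

variable (Wt) in
/-- The tautological matrix representation. -/
def matHom : ↥Wt →* Matrix (Fin n) (Fin n) ℂ where
  toFun := matOf
  map_one' := rfl
  map_mul' _ _ := rfl

theorem mem_ker_toLin'_sub_id {A : Matrix (Fin n) (Fin n) ℂ} {v : Fin n → ℂ} :
    v ∈ LinearMap.ker (Matrix.toLin' A - LinearMap.id) ↔ A.mulVec v = v := by
  rw [LinearMap.mem_ker, LinearMap.sub_apply, Matrix.toLin'_apply, LinearMap.id_apply, sub_eq_zero]

theorem mem_bigMt_iff {x : Fin n → ℂ} : x ∈ bigMt Wt ↔ x ∈ reflCompl (matHom Wt) := by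
  constructor
  · intro h g hg hgx
    exact h _ ⟨g, g.2, hg, rfl⟩ (mem_ker_toLin'_sub_id.2 hgx)
  · rintro h _ ⟨g, hg, hgr, rfl⟩ hx
    exact h ⟨g, hg⟩ hgr (mem_ker_toLin'_sub_id.1 hx)

theorem mem_bigMV_iff (h : QuotSetup Wt G p d c) {v : Fin m → ℂ} :
    v ∈ bigMV c ↔ v ∈ reflCompl h.qHom := by
  constructor
  · intro hv g hg hgx
    exact hv _ ⟨g, hg, rfl⟩ (mem_ker_toLin'_sub_id.2 hgx)
  · rintro hv _ ⟨g, hgr, rfl⟩ hx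
    exact hv g hgr (mem_ker_toLin'_sub_id.1 hx)

/-- The real form of a group of real matrices. -/
def tautForm (hreal : ∀ g ∈ Wt, ∀ i j,
    ((g : Matrix.GeneralLinearGroup (Fin n) ℂ) i j).im = 0) : RealForm (matHom Wt) :=
  RealForm.mk' 1 1 (fun w => (matOf w).map Complex.re) (one_mul 1) (one_mul 1) fun w => by
    rw [one_mul, mul_one]
    ext i j
    exact Complex.ext rfl (hreal w w.2 i j)

variable (p) in
/-- Real structures on `Ṽ` and `V` compatible with the quotient map. -/
structure RealStr (h : QuotSetup Wt G p d c) where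
  real : ∀ g ∈ Wt, ∀ i j, ((g : Matrix.GeneralLinearGroup (Fin n) ℂ) i j).im = 0
  form : RealForm h.qHom
  gens : Fin m → MvPolynomial (Fin n) ℂ
  adjoin_gens : Algebra.adjoin ℂ (Set.range gens) = invariants G
  eval_gens : ∀ x : Fin n → ℝ, pMap gens (cplx x) = cplx (form.coords (pMap p (cplx x))).1
  dirDeriv_gens : ∀ x τ : Fin n → ℝ,
    dpMap gens (cplx x) (cplx τ) = cplx (form.coords (dpMap p (cplx x) (cplx τ))).1

theorem QuotSetup.nonempty_realStr (h : QuotSetup Wt G p d c) (hreal : ∀ g ∈ Wt, ∀ i j,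
    ((g : Matrix.GeneralLinearGroup (Fin n) ℂ) i j).im = 0) : Nonempty (RealStr p h) := by
  obtain ⟨P, P', q, A, h1, h2, h3, h4, h5, h6⟩ := h.exists_real_form hreal
  exact ⟨⟨hreal, RealForm.mk' P P' A h1 h2 h4, q, h3, fun x => funext (h5 x),
    fun x τ => funext (h6 x τ)⟩⟩

theorem cplx_injective : Function.Injective (cplx : (Fin n → ℝ) → Fin n → ℂ) := fun _ _ h =>
  funext fun i => Complex.ofReal_injective (congrFun h i)

theorem continuous_cplx : Continuous (cplx : (Fin n → ℝ) → Fin n → ℂ) :=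
  continuous_pi fun i => Complex.continuous_ofReal.comp (continuous_apply i)

theorem continuous_pMap (q : Fin m → MvPolynomial (Fin n) ℂ) : Continuous (pMap q) :=
  continuous_pi fun i => MvPolynomial.continuous_eval (q i)

namespace RealStr

variable {h : QuotSetup Wt G p d c} (S : RealStr p h)

theorem coords_tautForm (x : Fin n → ℂ) :
    (tautForm S.real).coords x = (fun i => (x i).re, fun i => (x i).im) := by
  rw [RealForm.coords_apply]
  simp [tautForm, RealForm.mk']

theorem cplx_tautForm (w : ↥Wt) (x : Fin n → ℝ) :
    cplx (matEquiv (tautForm S.real).A w x) = (matOf w).mulVec (cplx x) := by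
  have h1 := (tautForm S.real).comm w
  rw [matEquiv_apply, ← mulVec_cplx]
  simp only [tautForm, RealForm.mk', one_mul, mul_one] at h1 ⊢
  rw [← h1]; rfl

theorem tautForm_injective : Function.Injective (matEquiv (tautForm S.real).A) :=
  (injective_iff_map_eq_one _).2 fun _ hw =>
    Subtype.ext (Units.ext ((tautForm S.real).eq_of_matEquiv_eq_one hw))

theorem closure_reflSet_tautForm :
    Subgroup.closure (reflSet (matEquiv (tautForm S.real).A).range)
      = (matEquiv (tautForm S.real).A).range := by
  have := h.finite_Wt
  have htop : Subgroup.closure {w : ↥Wt | IsReflection (matOf w)} = ⊤ := by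
    refine Subgroup.map_injective Wt.subtype_injective ?_
    rw [MonoidHom.map_closure, ← MonoidHom.range_eq_map, Subgroup.range_subtype]
    refine Eq.trans (congrArg _ ?_) h.reflGroup
    ext g
    constructor
    · rintro ⟨w, hw, rfl⟩; exact ⟨w.2, hw⟩
    · rintro ⟨hg, hr⟩; exact ⟨⟨g, hg⟩, hr, rfl⟩
  refine le_antisymm ((Subgroup.closure_le _).2 fun t ht => ht.1) ?_
  conv_lhs => rw [MonoidHom.range_eq_map, ← htop, MonoidHom.map_closure]
  refine Subgroup.closure_mono ?_
  rintro _ ⟨w, hw, rfl⟩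
  exact ⟨⟨w, rfl⟩, ((tautForm S.real).isReflection_iff w).1 hw⟩

theorem coords_pMap_mulVec (w : ↥Wt) (x : Fin n → ℂ) :
    S.form.coords (pMap p ((matOf w).mulVec x)) = (matEquiv S.form.A w (S.form.coords (pMap p x)).1,
      matEquiv S.form.A w (S.form.coords (pMap p x)).2) := by
  rw [pMap_mulVec h.equivar]
  exact S.form.coords_mulVec w _

theorem matEquiv_eq_one_iff_mem (w : ↥Wt) :
    matEquiv S.form.A w = 1 ↔ (w : Matrix.GeneralLinearGroup (Fin n) ℂ) ∈ G :=
  ⟨fun hw => h.mem_of_qMat_eq_one (S.form.eq_of_matEquiv_eq_one hw),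
    fun hw => S.form.matEquiv_eq_one_of_eq (h.qMat_eq_one hw)⟩

theorem eq_cplx_add (τ : Fin n → ℂ) :
    τ = cplx (fun i => (τ i).re) + Complex.I • cplx (fun i => (τ i).im) := by
  ext i
  simp [cplx, mul_comm Complex.I, Complex.re_add_im]

/-- The real points of the quotient map. -/
def realQuot (htc : TrivialConormal Wt p c) : RealQuot ↥Wt (Fin n → ℝ) (Fin m → ℝ) where
  κt := matEquiv (tautForm S.real).A
  κ := matEquiv S.form.A
  f x := (S.form.coords (pMap p (cplx x))).1
  injective := S.tautForm_injective
  closure_refl := S.closure_reflSet_tautForm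
  continuous := continuous_fst.comp
    (S.form.coords.continuous.comp ((continuous_pMap p).comp continuous_cplx))
  equivariant g x := by
    rw [S.cplx_tautForm, coords_pMap_mulVec]
  fiber x y hxy := by
    have := h.finite_G
    obtain ⟨g, hg, hgx⟩ := exists_mulVec_eq_of_pMap_eq S.adjoin_gens (x := cplx x) (y := cplx y)
      (by rw [S.eval_gens, S.eval_gens, hxy])
    refine ⟨⟨g, h.le hg⟩, (S.matEquiv_eq_one_iff_mem _).2 hg, cplx_injective ?_⟩
    rw [S.cplx_tautForm]
    exact hgx
  refl s z hs hs1 hsz hfree := by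
    have := h.finite_Wt
    have hss : s * s = 1 := S.tautForm_injective (by rw [map_mul, hs.2.mul_self, map_one])
    obtain ⟨-, f, x, hfx, hfr⟩ := hs
    have hfr' : ∀ u, (matOf s).mulVec (cplx u) = cplx u - (f u : ℂ) • cplx x := fun u => by
      rw [← S.cplx_tautForm, hfr]
      ext i
      simp [cplx]
    obtain ⟨a, ℓ, hal⟩ := h.exists_qMat_eq htc hss (x := cplx z) (ρ := cplx x)
      (fun hsG => hs1 ((S.matEquiv_eq_one_iff_mem s).2 hsG))
      (fun g hg hgz => by
        have := hfree ⟨g, h.le hg⟩ ((S.matEquiv_eq_one_iff_mem _).2 hg)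
          (cplx_injective ((S.cplx_tautForm _ _).trans hgz))
        exact congrArg Subtype.val this)
      (by rw [← cplx_tautForm S, hsz])
      (fun τ => by
        refine ⟨((f fun i => (τ i).re : ℝ) + Complex.I * (f fun i => (τ i).im : ℝ)) / 2, ?_⟩
        have hτ : (matOf s).mulVec τ = τ - ((f fun i => (τ i).re : ℝ)
            + Complex.I * (f fun i => (τ i).im : ℝ)) • cplx x := by
          nth_rw 1 2 [eq_cplx_add τ]
          rw [Matrix.mulVec_add, Matrix.mulVec_smul, hfr', hfr']
          module
        rw [Matrix.mulVec_sub, Matrix.mulVec_smul, hτ, hfr', hfx]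
        push_cast
        module)
    refine (S.form.isReflection_iff s).1 (isReflection_iff.2
      ⟨(QuotSetup.qHom h).isOfFinOrder (isOfFinOrder_of_finite s), fun hs2 => hs1 ?_, a, ℓ, hal⟩)
    exact S.form.matEquiv_eq_one_of_eq hs2

end RealStr
end RealStructure

end

section

section Actions

variable {n m : ℕ} {Wt G : Subgroup (Matrix.GeneralLinearGroup (Fin n) ℂ)}
  {p : Fin m → MvPolynomial (Fin n) ℂ} {d : Fin m → ℕ} {c : ↥Wt → Fin m → Fin m → ℂ}

theorem mulVec_mem_reflCompl {Γ : Type*} [Group Γ] {ψ : Γ →* Matrix (Fin n) (Fin n) ℂ} (w : Γ)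
    {x : Fin n → ℂ} (hx : x ∈ reflCompl ψ) : (ψ w).mulVec x ∈ reflCompl ψ := by
  intro g hg hgx
  obtain ⟨h1, h2, a, ℓ, h3⟩ := isReflection_iff.1 hg
  have e1 : ψ w⁻¹ * ψ w = 1 := by rw [← map_mul, inv_mul_cancel, map_one]
  have e2 : ψ w * ψ w⁻¹ = 1 := by rw [← map_mul, mul_inv_cancel, map_one]
  refine hx (w⁻¹ * g * w) (isReflection_iff.2 ⟨?_, ?_, (ψ w⁻¹).mulVec a,
    Matrix.vecMul ℓ (ψ w), ?_⟩) ?_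
  · refine IsConj.isOfFinOrder ⟨⟨ψ w⁻¹, ψ w, e1, e2⟩, ?_⟩ h1
    change ψ w⁻¹ * ψ g = ψ (w⁻¹ * g * w) * ψ w⁻¹
    rw [← map_mul, ← map_mul, mul_assoc, mul_inv_cancel, mul_one]
  · intro h
    apply h2
    rw [map_mul, map_mul] at h
    calc ψ g = ψ w * (ψ w⁻¹ * ψ g * ψ w) * ψ w⁻¹ := by
          simp only [mul_assoc, e2, mul_one]; rw [← mul_assoc, e2, one_mul]
      _ = 1 := by rw [h, mul_one, e2]
  · rw [map_mul, map_mul, h3, mul_sub, mul_one, sub_mul, e1, Matrix.mul_vecMulVec,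
      Matrix.vecMulVec_mul]
  · rw [map_mul, map_mul, ← Matrix.mulVec_mulVec, ← Matrix.mulVec_mulVec, hgx,
      Matrix.mulVec_mulVec, e1, Matrix.one_mulVec]

/-- The action on the complement of the reflecting hyperplanes. -/
abbrev reflComplAction {Γ : Type*} [Group Γ] (ψ : Γ →* Matrix (Fin n) (Fin n) ℂ)
    {X : Set (Fin n → ℂ)} (hX : ∀ w, ∀ x ∈ X, (ψ w).mulVec x ∈ X) : MulAction Γ X where
  smul w x := ⟨(ψ w).mulVec x, hX w x x.2⟩
  one_smul x := Subtype.ext (by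
    change (ψ 1).mulVec x.1 = x.1
    rw [map_one, Matrix.one_mulVec])
  mul_smul a b x := Subtype.ext (by
    change (ψ (a * b)).mulVec x.1 = (ψ a).mulVec ((ψ b).mulVec x.1)
    rw [map_mul, Matrix.mulVec_mulVec])

instance : MulAction ↥Wt ↥(bigMt Wt) := reflComplAction (matHom Wt) fun w _ hx =>
  mem_bigMt_iff.2 (mulVec_mem_reflCompl w (mem_bigMt_iff.1 hx))

theorem smul_bigMt_val (w : ↥Wt) (x : ↥(bigMt Wt)) : (w • x).1 = (matOf w).mulVec x.1 := rfl

instance : ContinuousConstSMul ↥Wt ↥(bigMt Wt) where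
  continuous_const_smul _ := Continuous.subtype_mk
    (Continuous.matrix_mulVec continuous_const continuous_subtype_val) _

end Actions

section LocalStructure

variable {m : ℕ}

theorem RealForm.exists_complexification {Γ : Type*} [Group Γ] {ψ : Γ →* Matrix (Fin m) (Fin m) ℂ}
    (R : RealForm ψ) (f : Module.Dual ℝ (Fin m → ℝ)) :
    ∃ L : (Fin m → ℂ) →ₗ[ℂ] ℂ, ∀ u, L u = ⟨f (R.coords u).1, f (R.coords u).2⟩ :=
  ⟨{ toFun := fun u => ⟨f (R.coords u).1, f (R.coords u).2⟩
     map_add' := fun u v => by rw [R.coords_add]; apply Complex.ext <;> simp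
     map_smul' := fun a u => by
      conv_lhs => rw [← Complex.re_add_im a, add_smul, mul_smul, R.coords_add, R.coords_smul,
        R.coords_smul, R.coords_I_smul]
      apply Complex.ext <;> simp [sub_eq_add_neg] }, fun _ => rfl⟩

open Filter Topology ComplexConjugate in
/-- Near a simple zero, the values of a holomorphic function follow their argument. -/
theorem eventually_re_mul_conj_pos {F : ℂ → ℂ} {A : ℂ} (hF : HasDerivAt F A 0) (h0 : F 0 = 0)
    (hA : A.re ≠ 0) : ∀ᶠ ζ in 𝓝[≠] (0 : ℂ), 0 < A.re * (F ζ * conj ζ).re := by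
  have h1 := hF.tendsto_slope_zero
  have h2 : Tendsto (fun ζ => A.re * (ζ⁻¹ • (F (0 + ζ) - F 0)).re) (𝓝[≠] 0) (𝓝 (A.re * A.re)) :=
    ((Complex.continuous_re.tendsto A).comp h1).const_mul A.re
  filter_upwards [h2.eventually (lt_mem_nhds (mul_self_pos.2 hA)), self_mem_nhdsWithin] with ζ hζ h
  have h3 : F ζ * conj ζ = (Complex.normSq ζ : ℂ) * (ζ⁻¹ * F ζ) := by
    rw [Complex.normSq_eq_conj_mul_self]
    field_simp [show ζ ≠ 0 from h]
  rw [h3, Complex.re_ofReal_mul]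
  rw [zero_add, h0, sub_zero, smul_eq_mul] at hζ
  calc 0 < Complex.normSq ζ * (A.re * (ζ⁻¹ * F ζ).re) := mul_pos (Complex.normSq_pos.2 h) hζ
    _ = _ := by ring

end LocalStructure

end

section

namespace RealStr

variable {n m : ℕ} {Wt G : Subgroup (Matrix.GeneralLinearGroup (Fin n) ℂ)}
  {p : Fin m → MvPolynomial (Fin n) ℂ} {d : Fin m → ℕ} {c : ↥Wt → Fin m → Fin m → ℂ}
  {h : QuotSetup Wt G p d c}


theorem mem_bigMt_iff_coords (S : RealStr p h) (Kt : Chamber (tautForm S.real).group) (x : Fin n → ℂ) :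
    x ∈ bigMt Wt ↔ ((fun i => (x i).re, fun i => (x i).im) : (Fin n → ℝ) × (Fin n → ℝ)) ∈ Kt.hypComp := by
  have := h.finite_Wt
  rw [mem_bigMt_iff, (tautForm S.real).mem_reflCompl_iff Kt, S.coords_tautForm]

theorem mem_bigMV_iff_coords (S : RealStr p h) (K : Chamber S.form.group) (v : Fin m → ℂ) :
    v ∈ bigMV c ↔ S.form.coords v ∈ K.hypComp := by
  have := h.finite_Wt
  rw [mem_bigMV_iff h, S.form.mem_reflCompl_iff K]

/-- The group acts freely on the complement of its reflecting hyperplanes. -/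
theorem eq_one_of_mulVec_eq (S : RealStr p h) {x : Fin n → ℂ} (hx : x ∈ bigMt Wt) {w : ↥Wt}
    (hw : (matOf w).mulVec x = x) : w = 1 := by
  have := h.finite_Wt
  have : Finite (tautForm S.real).group := inferInstance
  obtain ⟨b, hb⟩ := exists_moved_by_all (tautForm S.real).group
  obtain ⟨Kt, -⟩ := exists_chamber _ b hb
  have h1 := (tautForm S.real).coords_mulVec w x
  change (tautForm S.real).coords ((matOf w).mulVec x) = _ at h1
  rw [hw] at h1
  have h2 := congrArg Prod.fst h1
  have h3 := congrArg Prod.snd h1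
  refine S.tautForm_injective ((Kt.eq_one_of_mem_hypComp S.closure_reflSet_tautForm (q := (tautForm S.real).coords x)
    ?_ ⟨w, rfl⟩ h2.symm h3.symm).trans (map_one _).symm)
  rw [S.coords_tautForm]
  exact (S.mem_bigMt_iff_coords Kt x).1 hx

theorem pMap_mem_bigMV (S : RealStr p h) {x : Fin n → ℂ} (hx : x ∈ bigMt Wt) : pMap p x ∈ bigMV c := by
  rw [mem_bigMV_iff h]
  intro w hw hwx
  change (qMat c w).mulVec (pMap p x) = pMap p x at hwx
  rw [← pMap_mulVec h.equivar] at hwx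
  obtain ⟨g, hg, hgx⟩ := h.exists_mulVec_eq hwx.symm
  have h1 : (⟨g, h.le hg⟩ : ↥Wt)⁻¹ * w = 1 := by
    refine S.eq_one_of_mulVec_eq hx ?_
    have h2 := congrArg (matOf (⟨g, h.le hg⟩ : ↥Wt)⁻¹).mulVec hgx
    rw [Matrix.mulVec_mulVec] at h2
    change _ = (matHom Wt _).mulVec ((matHom Wt w).mulVec x) at h2
    change (matHom Wt _).mulVec x = x
    rw [map_mul, ← Matrix.mulVec_mulVec, ← h2]
    change (matHom Wt _ * matHom Wt ⟨g, h.le hg⟩).mulVec x = x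
    rw [← map_mul, inv_mul_cancel, map_one, Matrix.one_mulVec]
  have h3 : w = ⟨g, h.le hg⟩ := (inv_mul_eq_one.1 h1).symm
  exact (isReflection_iff.1 hw).2.1 (h.qMat_eq_one (w := w) (h3 ▸ hg))


section HalfTurn

variable {S : RealStr p h} {Kt : Chamber (tautForm S.real).group} {K : Chamber S.form.group}

open Filter Topology ComplexConjugate

theorem eventually_half_turn (htc : TrivialConormal Wt p c)
    (hb : K.base = (S.realQuot htc).f Kt.base) {s : ↥Wt}
    (hs : Kt.IsSimple (matEquiv (tautForm S.real).A s)) (hs1 : matEquiv S.form.A s ≠ 1)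
    {z : Fin n → ℝ} (hz : z ∈ Kt.face (matEquiv (tautForm S.real).A s)) {ρ : Fin n → ℝ}
    (hρ : Kt.form (matEquiv (tautForm S.real).A s) ρ = 2)
    (hsρ : matEquiv (tautForm S.real).A s ρ = -ρ) :
    ∃ A : ℝ, A ≠ 0 ∧ ∀ᶠ ζ in 𝓝[≠] (0 : ℂ), cplx z + ζ • cplx ρ ∈ bigMt Wt ∧
      (∀ r ∈ reflSet S.form.group, r ≠ matEquiv S.form.A s →
        0 < K.form r (S.form.coords (pMap p (cplx z + ζ • cplx ρ))).1) ∧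
      0 < A * (K.form (matEquiv S.form.A s) (S.form.coords (pMap p (cplx z + ζ • cplx ρ))).1 * ζ.re
        + K.form (matEquiv S.form.A s) (S.form.coords (pMap p (cplx z + ζ • cplx ρ))).2 * ζ.im) := by
  have := h.finite_Wt
  have := h.finite_G
  have : Finite (tautForm S.real).group := inferInstance
  have : Finite S.form.group := inferInstance
  obtain ⟨htR, hface⟩ := (S.realQuot htc).f_mem_face (Kt := Kt) (K := K) hb hs hs1 hz
  change matEquiv S.form.A s ∈ reflSet S.form.group at htR
  change (S.form.coords (pMap p (cplx z))).1 ∈ K.face (matEquiv S.form.A s) at hface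
  set t := matEquiv S.form.A s with ht
  have hsz : matEquiv (tautForm S.real).A s z = z := (Chamber.refl_eq_iff hs.1 z).2 hz.1
  have hsz' : (matOf s).mulVec (cplx z) = cplx z := by rw [← S.cplx_tautForm, hsz]
  have hneg : cplx (-ρ) = -cplx ρ := by ext i; simp [cplx]
  have hsρ' : (matOf s).mulVec (cplx ρ) = -cplx ρ := by rw [← S.cplx_tautForm, hsρ, hneg]
  have hfree : FreeAt G (cplx z) := by
    intro g hg hgz
    have h1 : matEquiv (tautForm S.real).A ⟨g, h.le hg⟩ z = z :=
      cplx_injective ((S.cplx_tautForm _ _).trans hgz)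
    rcases Chamber.eq_one_or_eq_of_mem_face (fun _ h => h)
      (Kt.closure_simple S.closure_reflSet_tautForm) hs hz ⟨_, rfl⟩ h1 with h2 | h2
    · exact congrArg Subtype.val (S.tautForm_injective (h2.trans (map_one _).symm))
    · refine absurd ((S.matEquiv_eq_one_iff_mem s).2 ?_) hs1
      rw [← S.tautForm_injective h2]
      exact hg
  obtain ⟨L, hL⟩ := S.form.exists_complexification (K.form t)
  set F : ℂ → ℂ := fun ζ => L (pMap p (cplx z + ζ • cplx ρ)) with hF
  have hderiv : HasDerivAt F (L (dpMap p (cplx z) (cplx ρ))) 0 := by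
    have h1 : HasDerivAt (fun ζ : ℂ => pMap p (cplx z + ζ • cplx ρ)) (dpMap p (cplx z) (cplx ρ)) 0 := by
      rw [hasDerivAt_pi]
      intro i
      have := hasDerivAt_eval (cplx z) (cplx ρ) (p i) 0
      rwa [zero_smul, add_zero] at this
    exact ((LinearMap.toContinuousLinearMap L).hasFDerivAt.comp_hasDerivAt 0 h1)
  have hF0 : F 0 = 0 := by
    rw [hF]
    beta_reduce
    rw [zero_smul, add_zero, hL]
    have h1 := S.coords_pMap_mulVec s (cplx z)
    rw [hsz'] at h1
    rw [(Chamber.refl_eq_iff htR _).1 (congrArg Prod.fst h1).symm,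
      (Chamber.refl_eq_iff htR _).1 (congrArg Prod.snd h1).symm]
    rfl
  have hA : (L (dpMap p (cplx z) (cplx ρ))).re ≠ 0 := by
    rw [hL]
    intro h0
    change K.form t _ = 0 at h0
    have h1 := (Chamber.refl_eq_iff htR _).2 h0
    have h2 := dpMap_mulVec h.equivar s (cplx z) (cplx ρ)
    have h3 : dpMap p (cplx z) (-cplx ρ) = ((-1 : ℝ) : ℂ) • dpMap p (cplx z) (cplx ρ) := by
      ext i
      have := dirDeriv_smul_dir (cplx z) (cplx ρ) (-1) (p i)
      simpa [dpMap] using this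
    have h4 := congrArg Prod.fst (S.form.coords_mulVec s (dpMap p (cplx z) (cplx ρ)))
    change (S.form.coords ((qMat c s).mulVec _)).1 = _ at h4
    rw [← h2, hsz', hsρ', h3, S.form.coords_smul] at h4
    change _ = t _ at h4
    rw [h1] at h4
    have h5 : (S.form.coords (dpMap p (cplx z) (cplx ρ))).1 = 0 := by
      ext i
      have := congrFun h4 i
      simp at this
      simp; linarith
    have hρ0 : cplx ρ ≠ 0 := fun h0 => by
      have : ρ = 0 := cplx_injective (h0.trans (by ext i; simp [cplx]))
      rw [this, map_zero] at hρ
      norm_num at hρ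
    refine dpMap_ne_zero S.adjoin_gens hfree hρ0 ?_
    rw [S.dirDeriv_gens, h5]
    ext i; simp [cplx]
  refine ⟨_, hA, ?_⟩
  have hcont : Continuous fun ζ : ℂ => cplx z + ζ • cplx ρ :=
    continuous_const.add (continuous_id.smul continuous_const)
  have e1 : ∀ᶠ ζ in 𝓝 (0 : ℂ), ∀ r : reflSet (tautForm S.real).group,
      r.1 ≠ matEquiv (tautForm S.real).A s → 0 < Kt.form r.1 (fun i => ((cplx z + ζ • cplx ρ) i).re) := by
    have := finite_reflSet (tautForm S.real).group
    refine eventually_all.2 fun r => ?_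
    by_cases hr : r.1 = matEquiv (tautForm S.real).A s
    · exact Eventually.of_forall fun _ h => absurd hr h
    have hc : Continuous fun ζ : ℂ => Kt.form r.1 (fun i => ((cplx z + ζ • cplx ρ) i).re) :=
      (LinearMap.continuous_of_finiteDimensional (Kt.form r.1)).comp
        (continuous_pi fun i => Complex.continuous_re.comp ((continuous_apply i).comp hcont))
    filter_upwards [hc.continuousAt.eventually (lt_mem_nhds (a := 0) (by
      simpa [cplx] using hz.2 r r.2 hr))] with ζ hζ _ using hζ
  have e2 : ∀ᶠ ζ in 𝓝 (0 : ℂ), ∀ r : reflSet S.form.group, r.1 ≠ t →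
      0 < K.form r.1 (S.form.coords (pMap p (cplx z + ζ • cplx ρ))).1 := by
    have := finite_reflSet S.form.group
    refine eventually_all.2 fun r => ?_
    by_cases hr : r.1 = t
    · exact Eventually.of_forall fun _ h => absurd hr h
    have hc : Continuous fun ζ : ℂ => K.form r.1 (S.form.coords (pMap p (cplx z + ζ • cplx ρ))).1 :=
      (LinearMap.continuous_of_finiteDimensional (K.form r.1)).comp
        (continuous_fst.comp (S.form.coords.continuous.comp ((continuous_pMap p).comp hcont)))
    filter_upwards [hc.continuousAt.eventually (lt_mem_nhds (a := 0) (by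
      simpa using hface.2 r r.2 hr))] with ζ hζ _ using hζ
  filter_upwards [nhdsWithin_le_nhds e1, nhdsWithin_le_nhds e2,
    eventually_re_mul_conj_pos hderiv hF0 hA, self_mem_nhdsWithin] with ζ h1 h2 h3 h4
  refine ⟨(S.mem_bigMt_iff_coords Kt _).2 fun r hr => ?_, fun r hr hrt => h2 ⟨r, hr⟩ hrt, ?_⟩
  · by_cases hrs : r = matEquiv (tautForm S.real).A s
    · have hre : (fun i => ((cplx z + ζ • cplx ρ) i).re) = z + ζ.re • ρ := by
        ext i; simp [cplx]
      have him : (fun i => ((cplx z + ζ • cplx ρ) i).im) = ζ.im • ρ := by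
        ext i; simp [cplx]
      rw [hre, him, hrs, map_add, map_smul, map_smul, hz.1, hρ, zero_add, smul_eq_mul, smul_eq_mul]
      by_contra! hcon
      exact h4 (Complex.ext (by simpa using hcon.1) (by simpa using hcon.2))
    · exact Or.inl (h1 ⟨r, hr⟩ hrs).ne'
  · rw [hF] at h3
    beta_reduce at h3
    rw [hL (pMap p (cplx z + ζ • cplx ρ)), Complex.mul_re] at h3
    simpa using h3

end HalfTurn
end RealStr

end

section

namespace RealStr

variable {n m : ℕ} {Wt G : Subgroup (Matrix.GeneralLinearGroup (Fin n) ℂ)}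
  {p : Fin m → MvPolynomial (Fin n) ℂ} {d : Fin m → ℕ} {c : ↥Wt → Fin m → Fin m → ℂ}
  {h : QuotSetup Wt G p d c}
  {S : RealStr p h} {Kt : Chamber (tautForm S.real).group} {K : Chamber S.form.group}

open Filter Topology

theorem cplx_mem_bigMt (S : RealStr p h) {Kt : Chamber (tautForm S.real).group} {x : Fin n → ℝ} (hx : x ∈ Kt.opn) : cplx x ∈ bigMt Wt :=
  (S.mem_bigMt_iff_coords Kt _).2 fun r hr => Or.inl (by simpa [cplx] using (hx r hr).ne')

/-- Segments in the base chamber. -/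
theorem exists_segment (S : RealStr p h) {Kt : Chamber (tautForm S.real).group}
    {a b : ↥(bigMt Wt)} {x y : Fin n → ℝ} (hx : x ∈ Kt.opn) (hy : y ∈ Kt.opn)
    (ha : a.1 = cplx x) (hb : b.1 = cplx y) :
    ∃ f : Path a b, ∀ u, ∃ v ∈ Kt.opn, (f u).1 = cplx v := by
  have hmem : ∀ u : unitInterval, AffineMap.lineMap x y (u : ℝ) ∈ Kt.opn := fun u =>
    Kt.convex_opn.lineMap_mem hx hy u.2
  refine ⟨⟨⟨fun u => ⟨cplx (AffineMap.lineMap x y (u : ℝ)), cplx_mem_bigMt S (hmem u)⟩, ?_⟩, ?_, ?_⟩,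
    fun u => ⟨_, hmem u, rfl⟩⟩
  · refine Continuous.subtype_mk (continuous_cplx.comp ?_) _
    exact (AffineMap.lineMap_continuous).comp continuous_subtype_val
  · exact Subtype.ext (by simp [ha])
  · exact Subtype.ext (by simp [hb])

/-- The half-circle of radius `ε` from `ε` to `-ε`. -/
def halfCircle (ε σ : ℝ) (u : ℝ) : ℂ := ⟨ε * Real.cos (Real.pi * u), ε * σ * Real.sin (Real.pi * u)⟩

theorem continuous_halfCircle (ε σ : ℝ) : Continuous (halfCircle ε σ) := by
  have : halfCircle ε σ = fun u => ((ε * Real.cos (Real.pi * u) : ℝ) : ℂ)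
      + ((ε * σ * Real.sin (Real.pi * u) : ℝ) : ℂ) * Complex.I := by
    ext u
    apply Complex.ext <;> simp only [halfCircle, Complex.add_re, Complex.add_im, Complex.ofReal_re,
      Complex.ofReal_im, Complex.re_ofReal_mul, Complex.im_ofReal_mul, Complex.I_re,
      Complex.I_im] <;> ring
  rw [this]
  fun_prop

theorem norm_halfCircle {ε σ : ℝ} (hε : 0 < ε) (hσ : σ * σ = 1) (u : ℝ) :
    ‖halfCircle ε σ u‖ = ε := by
  have h1 : ‖halfCircle ε σ u‖ ^ 2 = ε ^ 2 := by
    rw [← Complex.normSq_eq_norm_sq, Complex.normSq_apply]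
    change ε * _ * (ε * _) + ε * σ * _ * (ε * σ * _) = _
    linear_combination (ε ^ 2 * Real.sin (Real.pi * u) ^ 2) * hσ +
      ε ^ 2 * Real.sin_sq_add_cos_sq (Real.pi * u)
  exact (pow_left_inj₀ (norm_nonneg _) hε.le two_ne_zero).1 h1

theorem exists_half_turn (htc : TrivialConormal Wt p c)
    (hb : K.base = (S.realQuot htc).f Kt.base) {s : ↥Wt}
    (hs : Kt.IsSimple (matEquiv (tautForm S.real).A s)) (hs1 : matEquiv S.form.A s ≠ 1)
    {e : ℝ} (he : e ≠ 0) {x : ↥(bigMt Wt)} (hx : x.1 = cplx Kt.base) :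
    ∃ δ : Path x (s • x), ∀ u,
      S.form.coords (pMap p (δ u).1) ∈ K.wallSet K.base (matEquiv S.form.A s) e := by
  have := h.finite_Wt
  have : Finite (tautForm S.real).group := inferInstance
  have : Finite S.form.group := inferInstance
  obtain ⟨z, hz⟩ := hs.2
  obtain ⟨htR, hface⟩ := (S.realQuot htc).f_mem_face (Kt := Kt) (K := K) hb hs hs1 hz
  change matEquiv S.form.A s ∈ reflSet S.form.group at htR
  set t := matEquiv S.form.A s with ht
  set st := matEquiv (tautForm S.real).A s with hst
  have hst2 := Kt.form_root st hs.1
  have hsρ : st (Kt.root st) = -Kt.root st := by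
    rw [Kt.refl_apply st hs.1, hst2]; module
  set ρ := Kt.root st with hρ
  obtain ⟨A, hA, hev⟩ := eventually_half_turn htc hb hs hs1 hz hst2 hsρ
  obtain ⟨R, hR, hball⟩ := Metric.mem_nhdsWithin_iff.1 hev
  have hRf := finite_reflSet (tautForm S.real).group
  have hopn : ∀ᶠ ε in 𝓝[>] (0 : ℝ), ∀ r : reflSet (tautForm S.real).group,
      0 < Kt.form r.1 (z + ε • ρ) := by
    refine eventually_all.2 fun r => ?_
    by_cases hr : r.1 = st
    · filter_upwards [self_mem_nhdsWithin] with ε hε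
      rw [hr, map_add, map_smul, hz.1, hst2, zero_add, smul_eq_mul]
      exact mul_pos hε two_pos
    · filter_upwards [eventually_add_mul_pos (hz.2 r r.2 hr) (Kt.form r.1 ρ)] with ε hε
      rwa [map_add, map_smul, smul_eq_mul]
  obtain ⟨ε, hε, hεR, hε0⟩ := (hopn.and ((Ioo_mem_nhdsGT hR))).exists
  obtain ⟨σ, hσ, hσe⟩ : ∃ σ : ℝ, σ * σ = 1 ∧ 0 < e * A * σ := by
    rcases lt_or_gt_of_ne (mul_ne_zero he hA) with h | h
    · exact ⟨-1, by norm_num, by linarith⟩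
    · exact ⟨1, by norm_num, by linarith⟩
  have harc : ∀ u : ℝ, halfCircle ε σ u ≠ 0 ∧ ‖halfCircle ε σ u‖ < R := fun u => by
    rw [← norm_pos_iff, norm_halfCircle hεR hσ]
    exact ⟨hεR, hε0⟩
  have hP := fun u : ℝ => hball (⟨mem_ball_zero_iff.2 (harc u).2, (harc u).1⟩ :
    halfCircle ε σ u ∈ Metric.ball 0 R ∩ {0}ᶜ)
  have hmem : z + ε • ρ ∈ Kt.opn := fun r hr => hε ⟨r, hr⟩
  set a : ↥(bigMt Wt) := ⟨cplx (z + ε • ρ), cplx_mem_bigMt S hmem⟩ with ha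
  obtain ⟨f, hf⟩ := exists_segment S (Kt := Kt) Kt.base_mem_opn hmem hx (b := a) rfl
  have hcs : ∀ τ : ℝ, cplx (z + τ • ρ) = cplx z + (τ : ℂ) • cplx ρ := fun τ => by
    ext i; simp [cplx]
  have hsa : (s • a).1 = cplx z + ((-ε : ℝ) : ℂ) • cplx ρ := by
    rw [smul_bigMt_val, ha]
    change (matOf s).mulVec (cplx _) = _
    rw [← S.cplx_tautForm, ← hcs, map_add, map_smul]
    change cplx (st z + ε • st ρ) = _
    rw [(Chamber.refl_eq_iff hs.1 z).2 hz.1, hsρ, smul_neg, neg_smul]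
  let arc : Path a (s • a) := ⟨⟨fun u => ⟨cplx z + halfCircle ε σ u • cplx ρ, (hP u).1⟩,
    Continuous.subtype_mk (continuous_const.add
      (((continuous_halfCircle ε σ).comp continuous_subtype_val).smul continuous_const)) _⟩,
    Subtype.ext (by
      rw [ha]
      dsimp only
      rw [hcs]
      congr 2
      apply Complex.ext <;> simp [halfCircle]),
    Subtype.ext (by
      rw [hsa]
      dsimp only
      congr 2
      apply Complex.ext <;> simp [halfCircle])⟩
  have htS : K.IsSimple t := ⟨htR, _, hface⟩
  have hchamber : ∀ v ∈ Kt.opn, S.form.coords (pMap p (cplx v)) ∈ K.chSet K.base := fun v hv r hr =>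
    mul_pos (K.base_pos r hr) ((S.realQuot htc).f_mem_opn (Kt := Kt) (K := K) hb hv r hr)
  refine ⟨(f.trans arc).trans (f.symm.map (continuous_const_smul s)), fun u => ?_⟩
  have hseg : ∀ u, S.form.coords (pMap p (f u).1) ∈ K.wallSet K.base t e := fun u => by
    obtain ⟨v, hv, hfv⟩ := hf u
    rw [hfv]
    exact Chamber.chSet_subset_wallSet htR e (hchamber v hv)
  have hseg' : ∀ u, S.form.coords (pMap p (s • f u).1) ∈ K.wallSet K.base t e := fun u => by
    obtain ⟨v, hv, hfv⟩ := hf u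
    rw [smul_bigMt_val, hfv, S.coords_pMap_mulVec]
    refine Chamber.chSet_refl_subset_wallSet htR e (a' := t K.base) (fun r hr hrt => ?_)
      (Chamber.smul_mem_chSet htR.1 (hchamber v hv))
    exact mul_pos (K.base_pos r hr) (htS.form_pos hr hrt fun r hr _ => K.base_pos r hr)
  have harcw : ∀ u, S.form.coords (pMap p (arc u).1) ∈ K.wallSet K.base t e := fun u => by
    obtain ⟨-, h2, h3⟩ := hP u
    refine ⟨fun r hr hrt => mul_pos (K.base_pos r hr) (h2 r hr hrt), or_iff_not_imp_left.2 fun h0 => ?_⟩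
    rw [not_not] at h0
    change K.form t (S.form.coords (pMap p (cplx z + halfCircle ε σ u • cplx ρ))).1 = 0 at h0
    change 0 < e * K.form t (S.form.coords (pMap p (cplx z + halfCircle ε σ u • cplx ρ))).2
    rw [h0, zero_mul, zero_add] at h3
    have hsin : 0 ≤ Real.sin (Real.pi * u) := Real.sin_nonneg_of_nonneg_of_le_pi
      (mul_nonneg Real.pi_pos.le u.2.1) (by nlinarith [u.2.2, Real.pi_pos])
    have h4 := mul_pos hσe h3
    set y := K.form t (S.form.coords (pMap p (cplx z + halfCircle ε σ u • cplx ρ))).2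
    change 0 < e * A * σ * (A * (y * (ε * σ * Real.sin (Real.pi * u)))) at h4
    refine pos_of_mul_pos_right (b := e * y) (a := A * A * ε * Real.sin (Real.pi * u)) ?_
      (mul_nonneg (mul_nonneg (mul_self_nonneg A) hεR.le) hsin)
    calc 0 < _ := h4
      _ = (σ * σ) * (A * A * ε * Real.sin (Real.pi * u) * (e * y)) := by ring
      _ = _ := by rw [hσ, one_mul]
  rw [Path.trans_apply]
  split_ifs
  · rw [Path.trans_apply]
    split_ifs
    · exact hseg _
    · exact harcw _
  · exact hseg' _

end RealStr

end

section

section OrbitSpaces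

variable {Γ X Y : Type*} [Group Γ] [MulAction Γ X] [MulAction Γ Y]

theorem quot_mk_eq_iff {r : Y → Y → Prop} (hr : ∀ a b, r a b ↔ ∃ g : Γ, g • a = b) {a b : Y} :
    Quot.mk r a = Quot.mk r b ↔ ∃ g : Γ, g • a = b := by
  have he : Equivalence r := ⟨fun x => (hr _ _).2 ⟨1, one_smul _ _⟩,
    fun hxy => by
      obtain ⟨g, rfl⟩ := (hr _ _).1 hxy
      exact (hr _ _).2 ⟨g⁻¹, inv_smul_smul _ _⟩,
    fun hxy hyz => by
      obtain ⟨g, rfl⟩ := (hr _ _).1 hxy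
      obtain ⟨g', rfl⟩ := (hr _ _).1 hyz
      exact (hr _ _).2 ⟨g' * g, mul_smul _ _ _⟩⟩
  rw [Quot.eq, he.eqvGen_iff, hr]

/-- Paths in the orbit space of a finite group lift, when every stabilizer acts
trivially. -/
theorem exists_path_lift_of_orbit [TopologicalSpace Y] [ContinuousConstSMul Γ Y] [Finite Γ]
    [T2Space Y] [LocallyCompactSpace Y]
    (hfree : ∀ (g : Γ) (y : Y), g • y = y → ∀ y' : Y, g • y' = y') {r : Y → Y → Prop}
    (hr : ∀ a b, r a b ↔ ∃ g : Γ, g • a = b) {y : Y} (γ : Path (Quot.mk r y) (Quot.mk r y)) :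
    ∃ (w : Γ) (γ' : Path y (w • y)), ∀ s, Quot.mk r (γ' s) = γ s := by
  let Q := (MulAction.toPermHom Γ Y).range
  have : Finite Q := (Set.finite_range (MulAction.toPermHom Γ Y)).to_subtype
  have : ContinuousConstSMul Q Y := ⟨by
    rintro ⟨_, g, rfl⟩
    exact continuous_const_smul g⟩
  have : ProperlyDiscontinuousSMul Q Y := ⟨fun _ _ => Set.toFinite _⟩
  have : IsCancelSMul Q Y := isCancelSMul_iff_eq_one_of_smul_eq.2 (by
    rintro ⟨_, g, rfl⟩ y hy
    exact Subtype.ext (Equiv.ext (hfree g y hy)))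
  have hcov := (isQuotientMap_quot_mk (r := r)).isQuotientCoveringMap_of_properlyDiscontinuousSMul
    (G := Q) (fun {a b} => by
      rw [eq_comm, quot_mk_eq_iff hr]
      constructor
      · rintro ⟨g, rfl⟩; exact ⟨⟨_, g, rfl⟩, rfl⟩
      · rintro ⟨⟨_, g, rfl⟩, h⟩; exact ⟨g, h⟩)
  obtain ⟨δ, hδ, hδ0⟩ := hcov.isCoveringMap.exists_path_lifts γ y γ.source
  obtain ⟨w, hw⟩ := (quot_mk_eq_iff hr (a := y) (b := δ 1)).1
    (((congrFun hδ 1).trans γ.target).symm)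
  exact ⟨w, ⟨δ, hδ0, hw.symm⟩, congrFun hδ⟩

/-- An equivariant map induces a surjection on fundamental groups of orbit spaces, if paths
between points in the orbit of the image of some point lift up to homotopy. -/
theorem exists_loop_map_homotopic [TopologicalSpace X] [TopologicalSpace Y]
    [ContinuousConstSMul Γ Y] {f : C(X, Y)} {rX : X → X → Prop}
    (hrX : ∀ a b, rX a b ↔ ∃ g : Γ, g • a = b) {rY : Y → Y → Prop}
    (hrY : ∀ a b, rY a b ↔ ∃ g : Γ, g • a = b) {F : C(Quot rX, Quot rY)}
    (hF : ∀ x, F (Quot.mk rX x) = Quot.mk rY (f x)) {x₀ pt : X} (β : Path x₀ pt)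
    (hlift : ∀ (w : Γ) (γ : Path (f pt) (w • f pt)), ∃ (g : Γ) (h : w • f pt = f (g • pt))
      (δ : Path pt (g • pt)), ((δ.map f.continuous).cast rfl h).Homotopic γ)
    {γ : Path (Quot.mk rY (f x₀)) (Quot.mk rY (f x₀))} {w : Γ} {γ' : Path (f x₀) (w • f x₀)}
    (hγ : ∀ s, Quot.mk rY (γ' s) = γ s) :
    ∃ δ : Path (Quot.mk rX x₀) (Quot.mk rX x₀),
      ((δ.map F.continuous).cast (hF x₀).symm (hF x₀).symm).Homotopic γ := by
  have hX : ∀ (g : Γ) x, Quot.mk rX (g • x) = Quot.mk rX x := fun g x =>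
    (Quot.sound ((hrX _ _).2 ⟨g, rfl⟩)).symm
  have hY : ∀ (g : Γ) y, Quot.mk rY (g • y) = Quot.mk rY y := fun g y =>
    (Quot.sound ((hrY _ _).2 ⟨g, rfl⟩)).symm
  have hmX : Continuous (Quot.mk rX) := continuous_quot_mk
  have hmY : Continuous (Quot.mk rY) := continuous_quot_mk
  obtain ⟨g, hg, δ, hδ⟩ := hlift w ((β.map f.continuous).symm.trans
    (γ'.trans ((β.map f.continuous).map (continuous_const_smul w))))
  let b : Path (Quot.mk rY (f x₀)) (Quot.mk rY (f pt)) := (β.map f.continuous).map hmY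
  let e : Path (Quot.mk rX pt) (Quot.mk rX pt) := (δ.map hmX).cast rfl (hX g pt).symm
  let e' : Path (Quot.mk rY (f pt)) (Quot.mk rY (f pt)) :=
    (e.map F.continuous).cast (hF pt).symm (hF pt).symm
  have he : e'.Homotopic (b.symm.trans (γ.trans b)) := by
    let q : C(Y, Quot rY) := ⟨Quot.mk rY, hmY⟩
    have h1 : Path.Homotopic
        ((((δ.map f.continuous).cast rfl hg).map hmY).cast (rfl : Quot.mk rY (f pt) = _)
          (hY w (f pt)).symm)
        ((((β.map f.continuous).symm.trans
          (γ'.trans ((β.map f.continuous).map (continuous_const_smul w)))).map hmY).cast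
          (rfl : Quot.mk rY (f pt) = _) (hY w (f pt)).symm) :=
      (hδ.map q).pathCast rfl _
    have h2 : e' = (((δ.map f.continuous).cast rfl hg).map hmY).cast
        (rfl : Quot.mk rY (f pt) = _) (hY w (f pt)).symm :=
      Path.ext (funext fun s => hF (δ s))
    have h3 : b.symm.trans (γ.trans b) = (((β.map f.continuous).symm.trans
        (γ'.trans ((β.map f.continuous).map (continuous_const_smul w)))).map hmY).cast
        (rfl : Quot.mk rY (f pt) = _) (hY w (f pt)).symm := by
      refine Path.ext (funext fun s => ?_)
      simp only [Path.cast_coe, Path.map_coe, Function.comp_apply, Path.trans_apply]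
      split_ifs
      · rfl
      · exact (hγ _).symm
      · exact (hY w _).symm
    rwa [h2, h3]
  refine ⟨((β.map hmX).trans e).trans (β.map hmX).symm, ?_⟩
  have h2 : ((((β.map hmX).trans e).trans (β.map hmX).symm).map F.continuous).cast
      (hF x₀).symm (hF x₀).symm = (b.trans e').trans b.symm := by
    refine Path.ext (funext fun s => ?_)
    simp only [Path.cast_coe, Path.map_coe, Function.comp_apply, Path.trans_apply]
    split_ifs
    · exact hF _
    · rfl
    · exact hF _
  rw [h2, ← Path.Homotopic.Quotient.eq]
  rw [← Path.Homotopic.Quotient.eq] at he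
  simp only [Path.Homotopic.Quotient.mk_trans, Path.Homotopic.Quotient.mk_symm] at he ⊢
  rw [he]
  rw [Path.Homotopic.Quotient.trans_assoc, Path.Homotopic.Quotient.trans_assoc,
    Path.Homotopic.Quotient.trans_assoc, Path.Homotopic.Quotient.trans_symm,
    Path.Homotopic.Quotient.trans_refl, ← Path.Homotopic.Quotient.trans_assoc,
    Path.Homotopic.Quotient.trans_symm, Path.Homotopic.Quotient.refl_trans]

end OrbitSpaces

end

section

/-- The complement of finitely many complex hyperplanes is path connected. -/
theorem exists_path_ne_zero {V ι : Type*} [AddCommGroup V] [Module ℂ V] [TopologicalSpace V]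
    [ContinuousAdd V] [ContinuousSMul ℂ V] [Finite ι] (L : ι → V →ₗ[ℂ] ℂ) {x y : V}
    (hx : ∀ i, L i x ≠ 0) (hy : ∀ i, L i y ≠ 0) :
    ∃ f : Path x y, ∀ u i, L i (f u) ≠ 0 := by
  let line : ℂ → V := fun ζ => x + ζ • (y - x)
  have hline : Continuous line := continuous_const.add (continuous_id.smul continuous_const)
  have hB : (⋃ i, {ζ : ℂ | L i (line ζ) = 0}).Countable := by
    refine Set.countable_iUnion fun i => Set.Subsingleton.countable fun a ha b hb => ?_
    simp only [line, Set.mem_ofPred_eq, map_add, map_smul, map_sub, smul_eq_mul] at ha hb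
    have h1 : (a - b) * (L i y - L i x) = 0 := by linear_combination ha - hb
    rcases mul_eq_zero.1 h1 with h2 | h2
    · exact sub_eq_zero.1 h2
    · rw [h2, mul_zero, add_zero] at ha
      exact absurd ha (hx i)
  have hp := hB.isPathConnected_compl_of_one_lt_rank (by
    rw [Complex.rank_real_complex]; norm_num)
  obtain ⟨f, hf⟩ := hp.joinedIn 0 (by simpa [line] using hx) 1 (by simpa [line] using hy)
  refine ⟨(f.map hline).cast (by simp [line]) (by simp [line]), fun u i => ?_⟩
  have := hf u
  simp only [Set.mem_compl_iff, Set.mem_iUnion, not_exists, Set.mem_ofPred_eq] at this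
  exact this i

namespace RealStr

variable {n m : ℕ} {Wt G : Subgroup (Matrix.GeneralLinearGroup (Fin n) ℂ)}
  {p : Fin m → MvPolynomial (Fin n) ℂ} {d : Fin m → ℕ} {c : ↥Wt → Fin m → Fin m → ℂ}
  {h : QuotSetup Wt G p d c}

theorem joined_bigMt (S : RealStr p h) (Kt : Chamber (tautForm S.real).group)
    (x y : ↥(bigMt Wt)) : Nonempty (Path x y) := by
  have := h.finite_Wt
  have : Finite (tautForm S.real).group := inferInstance
  have := finite_reflSet (tautForm S.real).group
  choose L hL using fun r : reflSet (tautForm S.real).group =>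
    (tautForm S.real).exists_complexification (Kt.form r.1)
  have key : ∀ v, v ∈ bigMt Wt ↔ ∀ r, L r v ≠ 0 := fun v => by
    rw [S.mem_bigMt_iff_coords Kt, ← S.coords_tautForm]
    simp only [hL, Ne, Complex.ext_iff, Complex.zero_re, Complex.zero_im, not_and_or,
      Subtype.forall]
    rfl
  obtain ⟨f, hf⟩ := exists_path_ne_zero L ((key _).1 x.2) ((key _).1 y.2)
  exact ⟨⟨⟨fun u => ⟨f u, (key _).2 (hf u)⟩, Continuous.subtype_mk f.continuous _⟩,
    Subtype.ext f.source, Subtype.ext f.target⟩⟩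

section Lifting

variable {S : RealStr p h} {Kt : Chamber (tautForm S.real).group} {K : Chamber S.form.group}

/-- The quotient map in real coordinates, as a lifting problem for walls. -/
def wallLifting (htc : TrivialConormal Wt p c) (hb : K.base = (S.realQuot htc).f Kt.base) :
    WallLifting K ↥Wt ↥(bigMt Wt) where
  map := ⟨fun x => ⟨S.form.coords (pMap p x.1),
      (S.mem_bigMV_iff_coords K _).1 (S.pMap_mem_bigMV x.2)⟩,
    Continuous.subtype_mk (S.form.coords.continuous.comp
      ((continuous_pMap p).comp continuous_subtype_val)) _⟩
  hom := matEquiv S.form.A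
  hom_mem := fun g => S.form.mem_group g
  equivariant := fun g x => S.coords_pMap_mulVec g x.1
  pt := ⟨cplx Kt.base, cplx_mem_bigMt S Kt.base_mem_opn⟩
  pt_mem := by
    have := K.base_mem_opn
    rwa [hb] at this
  lift := fun t ht e he => by
    have := h.finite_Wt
    obtain ⟨s, hs, hst⟩ := (RealQuot.exists_simple_lifts (D := S.realQuot htc) hb).2 t ht
    change matEquiv S.form.A s = t at hs
    have hs1 : matEquiv S.form.A s ≠ 1 := by
      rw [hs]
      rintro rfl
      exact one_notMem_reflSet _ ht.1
    obtain ⟨δ, hδ⟩ := exists_half_turn htc hb hst hs1 he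
      (x := ⟨cplx Kt.base, cplx_mem_bigMt S Kt.base_mem_opn⟩) rfl
    exact ⟨s, hs, δ, fun u => hs ▸ hδ u⟩

/-- The quotient map between the complements of the reflecting hyperplanes. -/
def complMap (S : RealStr p h) : C(↥(bigMt Wt), ↥(bigMV c)) :=
  ⟨fun x => ⟨pMap p x.1, S.pMap_mem_bigMV x.2⟩,
    Continuous.subtype_mk ((continuous_pMap p).comp continuous_subtype_val) _⟩

/-- The complement of the hyperplanes in real coordinates. -/
def complHomeo (S : RealStr p h) (K : Chamber S.form.group) : ↥(bigMV c) ≃ₜ K.hypComp :=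
  S.form.coords.subtype (S.mem_bigMV_iff_coords K)

theorem exists_path_lift (htc : TrivialConormal Wt p c)
    (hb : K.base = (S.realQuot htc).f Kt.base)
    (hK : Subgroup.closure (reflSet S.form.group) = S.form.group) (w : ↥Wt)
    {x : ↥(bigMt Wt)} (hx : x.1 = cplx Kt.base) {u : ↥(bigMV c)}
    (hu : u.1 = (qMat c w).mulVec (pMap p x.1)) (γ : Path (S.complMap x) u) :
    ∃ (g : ↥Wt) (hg : u = S.complMap (g • x)) (δ : Path x (g • x)),
      ((δ.map S.complMap.continuous).cast rfl hg).Homotopic γ := by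
  have := h.finite_Wt
  have : Finite S.form.group := inferInstance
  obtain rfl : x = (wallLifting htc hb).pt := Subtype.ext hx
  set φ := S.complHomeo K
  obtain ⟨g, -, hg, δ, hδ⟩ := (wallLifting htc hb).exists_lift hK (S.form.mem_group w) (u := φ u)
    ((congrArg S.form.coords hu).trans (S.form.coords_mulVec w _)) (γ.map φ.continuous)
  have hg' : u = S.complMap (g • (wallLifting htc hb).pt) := φ.injective hg
  refine ⟨g, hg', δ, ?_⟩
  have h1 := (hδ.map (φ.symm : C(K.hypComp, ↥(bigMV c)))).pathCast
    (φ.symm_apply_apply (S.complMap (wallLifting htc hb).pt)).symm (φ.symm_apply_apply u).symm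
  have h2 : ((γ.map φ.continuous).map φ.symm.continuous).cast
    (φ.symm_apply_apply (S.complMap (wallLifting htc hb).pt)).symm (φ.symm_apply_apply u).symm = γ :=
    Path.ext (funext fun s => φ.symm_apply_apply (γ s))
  have h3 : (δ.map S.complMap.continuous).cast rfl hg' =
      (((δ.map (wallLifting htc hb).map.continuous).cast rfl hg).map φ.symm.continuous).cast
    (φ.symm_apply_apply (S.complMap (wallLifting htc hb).pt)).symm (φ.symm_apply_apply u).symm :=
    Path.ext (funext fun s => (φ.symm_apply_apply (S.complMap (δ s))).symm)
  rw [h3, ← h2]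
  exact h1

end Lifting
end RealStr

end

section

namespace RealStr

variable {n m : ℕ} {Wt G : Subgroup (Matrix.GeneralLinearGroup (Fin n) ℂ)}
  {p : Fin m → MvPolynomial (Fin n) ℂ} {d : Fin m → ℕ} {c : ↥Wt → Fin m → Fin m → ℂ}
  {h : QuotSetup Wt G p d c}

/-- The map induced on orbit spaces. -/
def orbitMap (S : RealStr p h) : C(Quot (rt Wt), Quot (rV c)) :=
  ⟨Quot.map S.complMap fun x y ⟨w, hw, hxy⟩ => ⟨⟨w, hw⟩, by
      change (qMat c ⟨w, hw⟩).mulVec (pMap p x.1) = pMap p y.1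
      rw [← pMap_mulVec h.equivar, ← hxy]
      rfl⟩,
    continuous_quot_lift _ (continuous_quot_mk.comp S.complMap.continuous)⟩

theorem exists_loop_lift (S : RealStr p h) (htc : TrivialConormal Wt p c) (x₀ : ↥(bigMt Wt))
    (γ : Path (Quot.mk (rV c) (S.complMap x₀)) (Quot.mk (rV c) (S.complMap x₀))) :
    ∃ δ : Path (Quot.mk (rt Wt) x₀) (Quot.mk (rt Wt) x₀),
      ((δ.map S.orbitMap.continuous).cast (rfl : Quot.mk (rV c) (S.complMap x₀) = _)
        (rfl : Quot.mk (rV c) (S.complMap x₀) = _)).Homotopic γ := by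
  have := h.finite_Wt
  have : Finite (tautForm S.real).group := inferInstance
  have : Finite S.form.group := inferInstance
  obtain ⟨b, hb⟩ := exists_moved_by_all (tautForm S.real).group
  obtain ⟨Kt, rfl⟩ := exists_chamber _ b hb
  obtain ⟨K, hK⟩ := exists_chamber S.form.group _ ((S.realQuot htc).refl_f_ne hb)
  have hcl : Subgroup.closure (reflSet S.form.group) = S.form.group :=
    (RealQuot.exists_simple_lifts (D := S.realQuot htc) hK).1
  let _ : MulAction ↥Wt ↥(bigMV c) := reflComplAction h.qHom fun w _ hx =>
    (mem_bigMV_iff h).2 (mulVec_mem_reflCompl w ((mem_bigMV_iff h).1 hx))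
  have : ContinuousConstSMul ↥Wt ↥(bigMV c) := ⟨fun w => Continuous.subtype_mk
    (Continuous.matrix_mulVec continuous_const continuous_subtype_val) _⟩
  have hopen : IsOpen (bigMV c) := by
    rw [show bigMV c = S.form.coords ⁻¹' K.hypComp from Set.ext (S.mem_bigMV_iff_coords K)]
    exact Chamber.isOpen_hypComp.preimage S.form.coords.continuous
  have : LocallyCompactSpace ↥(bigMV c) := hopen.locallyCompactSpace
  have hfree : ∀ (g : ↥Wt) (y : ↥(bigMV c)), g • y = y → ∀ y' : ↥(bigMV c), g • y' = y' := by
    intro g y hy y'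
    have h1 := S.form.coords_mulVec g y.1
    have h2 : (h.qHom g).mulVec y.1 = y.1 := congrArg Subtype.val hy
    rw [h2] at h1
    have h3 := S.form.eq_of_matEquiv_eq_one (K.eq_one_of_mem_hypComp hcl
      ((S.mem_bigMV_iff_coords K _).1 y.2) (S.form.mem_group g) (congrArg Prod.fst h1).symm
      (congrArg Prod.snd h1).symm)
    refine Subtype.ext ?_
    change (h.qHom g).mulVec y'.1 = y'.1
    rw [h3, Matrix.one_mulVec]
  have hrV : ∀ a b : ↥(bigMV c), rV c a b ↔ ∃ g : ↥Wt, g • a = b := fun a b =>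
    exists_congr fun g => (Subtype.ext_iff (a1 := g • a)).symm
  have hrt : ∀ a b : ↥(bigMt Wt), rt Wt a b ↔ ∃ g : ↥Wt, g • a = b := fun a b =>
    ⟨fun ⟨w, hw, hab⟩ => ⟨⟨w, hw⟩, Subtype.ext hab⟩,
      fun ⟨g, hg⟩ => ⟨g.1, g.2, congrArg Subtype.val hg⟩⟩
  obtain ⟨w, γ', hγ⟩ := exists_path_lift_of_orbit hfree hrV γ
  obtain ⟨β⟩ := S.joined_bigMt Kt x₀ ⟨cplx Kt.base, cplx_mem_bigMt S Kt.base_mem_opn⟩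
  exact exists_loop_map_homotopic hrt hrV (F := S.orbitMap) (fun _ => rfl) β
    (fun w γ => S.exists_path_lift htc hK hcl w rfl rfl γ) hγ

end RealStr

end

/-- suppose `Wt` is the complexification of a real reflection group and
`G` is good in `Wt`. Then `p(Mt) ⊆ M` and, for any basepoint `x0 ∈ Mt`, the continuous
map `Mt/Wt → M/W` induced by `p` induces a surjection of fundamental groups: every
loop of `M/W` at `[p(x0)]` is path-homotopic to the image of a loop of `Mt/Wt`
at `[x0]`. -/
theorem statement9 {n m : ℕ}
    (Wt G : Subgroup (Matrix.GeneralLinearGroup (Fin n) ℂ))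
    (p : Fin m → MvPolynomial (Fin n) ℂ) (d : Fin m → ℕ)
    (c : ↥Wt → Fin m → Fin m → ℂ)
    (hsetup : QuotSetup Wt G p d c)
    (hgood : IsGoodQuot Wt p c)
    (hreal : ∀ g ∈ Wt, ∀ i j,
      (((g : Matrix.GeneralLinearGroup (Fin n) ℂ) : Matrix (Fin n) (Fin n) ℂ) i j).im
        = 0) :
    ∃ hp : ∀ x ∈ bigMt Wt, pMap p x ∈ bigMV c,
      ∀ (x0 : Fin n → ℂ) (hx0 : x0 ∈ bigMt Wt),
        ∃ F : C(Quot (rt Wt), Quot (rV c)),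
          ∃ hF : ∀ y : ↥(bigMt Wt),
            F (Quot.mk (rt Wt) y) = Quot.mk (rV c) ⟨pMap p y.1, hp y.1 y.2⟩,
          ∀ γ : Path (Quot.mk (rV c) (⟨pMap p x0, hp x0 hx0⟩ : ↥(bigMV c)))
                  (Quot.mk (rV c) (⟨pMap p x0, hp x0 hx0⟩ : ↥(bigMV c))),
            ∃ γ' : Path (Quot.mk (rt Wt) (⟨x0, hx0⟩ : ↥(bigMt Wt)))
                    (Quot.mk (rt Wt) (⟨x0, hx0⟩ : ↥(bigMt Wt))),
              Path.Homotopic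
                ((γ'.map F.continuous).cast
                  (hF ⟨x0, hx0⟩).symm (hF ⟨x0, hx0⟩).symm) γ := by
  obtain ⟨S⟩ := QuotSetup.nonempty_realStr hsetup hreal
  exact ⟨fun x hx => S.pMap_mem_bigMV hx, fun x0 hx0 => ⟨S.orbitMap, fun _ => rfl,
    fun γ => S.exists_loop_lift hgood.2 ⟨x0, hx0⟩ γ⟩⟩
end ReflQuot
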